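/- arXiv:2101.06899 — 9 statements merged into one kernel-verified Lean document; each statement's English description precedes it below -/
import Mathlib

section
/- Let G be a finite abelian group and M a set of nonzero integers. Then M splits G nonsingularly (i.e., there is a splitter set S ⊆ G forming a splitting of G with M, and every element of M is coprime to |G|) if and only if for every prime divisor p of |G|, M splits the cyclic group Z_p. -/
/-- `(M, S)` forms a splitting of the additive group `G`: every nonzero `g ∈ G`
has a unique representation `g = m • s` with `m ∈ M`, `s ∈ S`, while `0` has no
such representation. -/
def IsSplitting {G : Type*} [AddCommGroup G] (M : Set ℤ) (S : Set G) : Prop :=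
  (∀ g : G, g ≠ 0 → ∃! ms : ℤ × G, ms.1 ∈ M ∧ ms.2 ∈ S ∧ ms.1 • ms.2 = g) ∧
  ¬ ∃ m ∈ M, ∃ s ∈ S, m • s = (0 : G)

/-- An integer coprime to the order of an abelian group acts invertibly on it. -/
theorem exists_zsmul_inverse_of_gcd_card_eq_one {G : Type*} [AddCommGroup G] {m : ℤ}
    (h : Int.gcd m (Nat.card G) = 1) :
    ∃ u : ℤ, (∀ a : G, u • m • a = a) ∧ ∀ a : G, m • u • a = a := by
  obtain ⟨u, v, huv⟩ := Int.isCoprime_iff_gcd_eq_one.mpr h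
  have key (a : G) : u • m • a = a := by
    have h1 : (u * m + v * (Nat.card G : ℤ)) • a = a := by rw [huv, one_zsmul]
    rwa [add_zsmul, mul_zsmul, mul_zsmul, natCast_zsmul, card_nsmul_eq_zero', zsmul_zero,
      add_zero] at h1
  exact ⟨u, key, fun a => by rw [smul_comm, key]⟩

/-- A splitting pulls back along an injective homomorphism if the orders of both groups are
coprime to the members of `M`. -/
theorem IsSplitting.comap {A G : Type*} [AddCommGroup A] [AddCommGroup G] {M : Set ℤ}
    {S : Set G} (hS : IsSplitting M S) (hM : ∀ m ∈ M, Int.gcd m (Nat.card G) = 1)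
    (hA : ∀ m ∈ M, Int.gcd m (Nat.card A) = 1)
    (f : A →+ G) (hf : Function.Injective f) : IsSplitting M (f ⁻¹' S) := by
  refine ⟨fun a ha => ?_, ?_⟩
  · obtain ⟨⟨m, s⟩, ⟨hm, hs, hms⟩, huniq⟩ := hS.1 (f a) ((map_ne_zero_iff f hf).mpr ha)
    dsimp only at hm hs hms
    obtain ⟨u, hu, -⟩ := exists_zsmul_inverse_of_gcd_card_eq_one (hM m hm)
    obtain ⟨v, -, hv⟩ := exists_zsmul_inverse_of_gcd_card_eq_one (hA m hm)
    have hs' : s = f (v • a) := by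
      rw [← hu s, ← hu (f (v • a)), hms, ← map_zsmul f m, hv]
    refine ⟨(m, v • a), ⟨hm, by simpa [← hs'] using hs, hv a⟩, ?_⟩
    rintro ⟨m', s'⟩ ⟨hm', hs'', hms'⟩
    dsimp only at hm' hs'' hms'
    have h := huniq (m', f s') ⟨hm', hs'', by simp [← hms']⟩
    rw [Prod.mk.injEq, hs'] at h
    exact Prod.ext h.1 (hf h.2)
  · rintro ⟨m, hm, s, hs, h0⟩
    exact hS.2 ⟨m, hm, f s, hs, by rw [← map_zsmul, h0, map_zero]⟩

/-- Splittings of the outer terms of a short exact sequence combine to a splitting of the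
middle term. -/
theorem IsSplitting.extension {A G B : Type*} [AddCommGroup A] [AddCommGroup G]
    [AddCommGroup B] {M : Set ℤ} (hM : ∀ m ∈ M, Int.gcd m (Nat.card G) = 1)
    {S : Set A} {T : Set B} (hS : IsSplitting M S) (hT : IsSplitting M T)
    (f : A →+ G) (hf : Function.Injective f) (π : G →+ B) (hπ : Function.Surjective π)
    (hexact : ∀ g, π g = 0 ↔ g ∈ f.range) : IsSplitting M (f '' S ∪ π ⁻¹' T) := by
  have hπf (a : A) : π (f a) = 0 := (hexact _).mpr ⟨a, rfl⟩
  refine ⟨fun g hg => ?_, ?_⟩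
  · by_cases h0 : π g = 0
    · obtain ⟨a, rfl⟩ := (hexact g).mp h0
      obtain ⟨⟨m, s⟩, ⟨hm, hs, hms⟩, huniq⟩ := hS.1 a ((map_ne_zero_iff f hf).mp hg)
      dsimp only at hm hs hms
      refine ⟨(m, f s), ⟨hm, Or.inl ⟨s, hs, rfl⟩, by simp [← hms]⟩, ?_⟩
      rintro ⟨m', s'⟩ ⟨hm', hs' | hs', hms'⟩
      · obtain ⟨t, ht, rfl⟩ := hs'
        have h := huniq (m', t) ⟨hm', ht, hf (by simpa using hms')⟩
        rw [Prod.mk.injEq] at h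
        rw [h.1, h.2]
      · exact absurd ⟨m', hm', π s', hs', by rw [← map_zsmul, hms', h0]⟩ hT.2
    · obtain ⟨⟨m, b⟩, ⟨hm, hb, hmb⟩, huniq⟩ := hT.1 (π g) h0
      dsimp only at hm hb hmb
      obtain ⟨u, hu, hu'⟩ := exists_zsmul_inverse_of_gcd_card_eq_one (hM m hm)
      have hub : π (u • g) = b := by
        obtain ⟨c, rfl⟩ := hπ b
        rw [map_zsmul, ← hmb, ← map_zsmul, ← map_zsmul, hu]
      refine ⟨(m, u • g), ⟨hm, Or.inr (by rwa [Set.mem_preimage, hub]), hu' g⟩, ?_⟩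
      rintro ⟨m', s'⟩ ⟨hm', hs' | hs', hms'⟩
      · obtain ⟨t, -, rfl⟩ := hs'
        exact absurd (by rw [← hms', map_zsmul, hπf, zsmul_zero]) h0
      · dsimp only at hm' hs' hms'
        have h := huniq (m', π s') ⟨hm', hs', by rw [← hms', map_zsmul]⟩
        obtain rfl : m' = m := congrArg Prod.fst h
        rw [← hms', hu]
  · rintro ⟨m, hm, s, hs | hs, h0⟩
    · obtain ⟨t, ht, rfl⟩ := hs
      exact hS.2 ⟨m, hm, t, ht, hf (by rw [map_zsmul, h0, map_zero])⟩
    · exact hT.2 ⟨m, hm, π s, hs, by rw [← map_zsmul, h0, map_zero]⟩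

/-- A finite abelian group contains a copy of `ZMod p` for each prime `p` dividing its order. -/
theorem exists_injective_zmod_addMonoidHom {G : Type*} [AddCommGroup G] [Finite G] {p : ℕ}
    (hp : p.Prime) (hdvd : p ∣ Nat.card G) : ∃ f : ZMod p →+ G, Function.Injective f := by
  have := Fact.mk hp
  obtain ⟨x, hx⟩ := exists_prime_addOrderOf_dvd_card' p hdvd
  refine ⟨ZMod.lift p ⟨zmultiplesHom G x, ?_⟩, (ZMod.lift_injective _).mpr fun m hm => ?_⟩
  · simp [← hx, addOrderOf_nsmul_eq_zero]
  · rw [ZMod.intCast_zmod_eq_zero_iff_dvd, ← hx, addOrderOf_dvd_iff_zsmul_eq_zero]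
    simpa using hm

/-- The members of a set that splits `ZMod p` are coprime to `p`. -/
theorem IsSplitting.gcd_eq_one_of_zmod {p : ℕ} (hp : p.Prime) {M : Set ℤ} {S : Set (ZMod p)}
    (hS : IsSplitting M S) {m : ℤ} (hm : m ∈ M) : Int.gcd m p = 1 := by
  have := Fact.mk hp
  obtain ⟨⟨m', s⟩, ⟨-, hs, -⟩, -⟩ := hS.1 1 one_ne_zero
  rw [Int.gcd_comm, ← Int.isCoprime_iff_gcd_eq_one,
    (Nat.prime_iff_prime_int.mp hp).coprime_iff_not_dvd]
  intro hdvd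
  refine hS.2 ⟨m, hm, s, hs, ?_⟩
  rw [zsmul_eq_mul, (ZMod.intCast_zmod_eq_zero_iff_dvd m p).mpr hdvd, zero_mul]

/-- If `M` splits `ZMod p` for each prime `p` dividing `n`, then the members of `M` are coprime
to `n`. -/
theorem gcd_eq_one_of_splits_zmod {n : ℕ} {M : Set ℤ}
    (h : ∀ p : ℕ, p.Prime → p ∣ n → ∃ S : Set (ZMod p), IsSplitting M S) {m : ℤ} (hm : m ∈ M) :
    Int.gcd m n = 1 := by
  refine Nat.coprime_of_dvd fun p hp hpm hpn => ?_
  obtain ⟨S, hS⟩ := h p hp hpn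
  have hgcd := hS.gcd_eq_one_of_zmod hp hm
  exact hp.one_lt.ne' (Nat.dvd_one.mp (hgcd ▸ Nat.dvd_gcd hpm dvd_rfl))

/-- If `M` splits `ZMod p` for each prime `p` dividing the order of `G`, then `M` splits `G`. -/
theorem exists_isSplitting_of_splits_zmod {M : Set ℤ} {G : Type*} [AddCommGroup G] [Finite G]
    (h : ∀ p : ℕ, p.Prime → p ∣ Nat.card G → ∃ S : Set (ZMod p), IsSplitting M S) :
    ∃ S : Set G, IsSplitting M S := by
  induction hn : Nat.card G using Nat.strong_induction_on generalizing G with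
  | _ n ih =>
    subst hn
    by_cases h1 : Nat.card G = 1
    · have := (Nat.card_eq_one_iff_unique.mp h1).1
      exact ⟨∅, fun g hg => absurd (Subsingleton.elim g 0) hg, by simp⟩
    · obtain ⟨p, hp, hdvd⟩ := Nat.exists_prime_and_dvd h1
      obtain ⟨f, hf⟩ := exists_injective_zmod_addMonoidHom hp hdvd
      obtain ⟨S, hS⟩ := h p hp hdvd
      have hcard := f.range.card_eq_card_quotient_mul_card_addSubgroup
      have hrange : Nat.card f.range = p := by
        rw [← Nat.card_congr (AddMonoidHom.ofInjective hf).toEquiv, Nat.card_zmod]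
      rw [hrange] at hcard
      have hlt : Nat.card (G ⧸ f.range) < Nat.card G := by
        rw [hcard]
        exact lt_mul_of_one_lt_right Nat.card_pos hp.one_lt
      obtain ⟨T, hT⟩ := ih _ hlt
        (fun q hq hqd => h q hq (hqd.trans ⟨p, hcard⟩)) rfl
      exact ⟨_, IsSplitting.extension (fun m hm => gcd_eq_one_of_splits_zmod h hm) hS hT f hf
        (QuotientAddGroup.mk' f.range) (QuotientAddGroup.mk'_surjective _)
        fun g => QuotientAddGroup.eq_zero_iff g⟩

/-- Hickerson's theorem: a set `M` of nonzero integers splits a finite abelian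
group `G` nonsingularly iff `M` splits `ℤ_p` for every prime divisor `p` of `|G|`. -/
theorem nonsingular_splitting_iff_splits_prime_divisors
    {G : Type*} [AddCommGroup G] [Finite G] (M : Set ℤ) (hM : ∀ m ∈ M, m ≠ 0) :
    (∃ S : Set G, IsSplitting M S ∧ ∀ m ∈ M, Int.gcd m (Nat.card G) = 1) ↔
      (∀ p : ℕ, p.Prime → p ∣ Nat.card G → ∃ S : Set (ZMod p), IsSplitting M S) := by
  constructor
  · rintro ⟨S, hS, hcop⟩ p hp hdvd
    obtain ⟨f, hf⟩ := exists_injective_zmod_addMonoidHom hp hdvd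
    refine ⟨_, hS.comap hcop (fun m hm => ?_) f hf⟩
    rw [Nat.card_zmod]
    exact Nat.Coprime.coprime_dvd_right hdvd (hcop m hm)
  · intro h
    obtain ⟨S, hS⟩ := exists_isSplitting_of_splits_zmod h
    exact ⟨S, hS, fun m hm => gcd_eq_one_of_splits_zmod h hm⟩
end

section
/- Let k be an odd positive integer, let p_1, ..., p_t be distinct primes, and let b_1, ..., b_t be arbitrary elements of Z_k. Then there are infinitely many primes p (not dividing any p_i) for which there exists a surjective group homomorphism χ from the multiplicative group (Z_p)^* to the additive group Z_k such that χ(p_i mod p) = b_i for all 1 ≤ i ≤ t. -/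
section NumberField

open NumberField Ideal

/-- The number of ideals of norm `n` in the ring of integers of `L`. -/
noncomputable def idealCount (L : Type*) [Field L] [NumberField L] (n : ℕ) : ℕ :=
  Nat.card {I : Ideal (𝓞 L) // absNorm I = n}

section IdealCount

variable (L : Type*) [Field L] [NumberField L]

lemma idealCount_one : idealCount L 1 = 1 := by
  have : ∀ I : Ideal (𝓞 L), absNorm I = 1 ↔ I = ⊤ := fun I => absNorm_eq_one_iff
  simp [idealCount, this]

variable {L}

lemma absNorm_sup_span_natCast_coprime {m n : ℕ} (h : m.Coprime n) (I : Ideal (𝓞 L)) :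
    (absNorm (I ⊔ span {(m : 𝓞 L)})).Coprime n := by
  have h1 : absNorm (I ⊔ span {(m : 𝓞 L)}) ∣ absNorm (span {(m : 𝓞 L)}) :=
    absNorm_dvd_absNorm_of_le le_sup_right
  rw [absNorm_span_natCast] at h1
  exact Nat.Coprime.coprime_dvd_left h1 (h.pow_left _)

lemma isCoprime_span_natCast {R : Type*} [CommRing R] {m n : ℕ} (h : m.Coprime n) :
    IsCoprime (span {(m : R)}) (span {(n : R)}) := by
  rw [isCoprime_span_singleton_iff]
  simpa using (Nat.isCoprime_iff_coprime.mpr h).map (Int.castRingHom R)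

lemma span_natCast_absNorm_le {n : ℕ} {I : Ideal (𝓞 L)} (h : absNorm I = n) :
    span {(n : 𝓞 L)} ≤ I := by
  subst h; exact span_singleton_absNorm_le I

lemma sup_mul_sup_of_isCoprime {R : Type*} [CommRing R] {I A B : Ideal R} (h : IsCoprime A B)
    (hI : A * B ≤ I) : (I ⊔ A) * (I ⊔ B) = I := by
  have h : A ⊔ B = ⊤ := Ideal.isCoprime_iff_sup_eq.mp h
  apply le_antisymm
  · rw [Ideal.sup_mul, Ideal.mul_sup, Ideal.mul_sup]
    refine sup_le (sup_le Ideal.mul_le_left Ideal.mul_le_left) (sup_le Ideal.mul_le_right hI)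
  · calc I = (A ⊔ B) * I := by rw [h, Ideal.top_mul]
      _ = A * I ⊔ I * B := by rw [Ideal.sup_mul, mul_comm B]
      _ ≤ _ := sup_le (by
        rw [mul_comm]
        exact (mul_comm I A ▸ (Ideal.mul_mono le_sup_right le_sup_left)))
        (Ideal.mul_mono le_sup_left le_sup_right)

lemma mul_sup_of_isCoprime {R : Type*} [CommRing R] {I J A B : Ideal R} (h : IsCoprime A B)
    (hI : A ≤ I) (hJ : B ≤ J) : I * J ⊔ A = I := by
  apply le_antisymm (sup_le Ideal.mul_le_left hI)
  have h : J ⊔ A = ⊤ := by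
    rw [eq_top_iff, ← Ideal.isCoprime_iff_sup_eq.mp h, sup_comm]
    exact sup_le_sup_right hJ _
  calc I = I * (J ⊔ A) := by rw [h, Ideal.mul_top]
    _ = I * J ⊔ I * A := Ideal.mul_sup _ _ _
    _ ≤ _ := sup_le_sup_left Ideal.mul_le_right _

lemma idealCount_mul {m n : ℕ} (h : m.Coprime n) :
    idealCount L (m * n) = idealCount L m * idealCount L n := by
  rw [idealCount, idealCount, idealCount, ← Nat.card_prod]
  have key : ∀ I : Ideal (𝓞 L), absNorm I = m * n →
      (I ⊔ span {(m : 𝓞 L)}) * (I ⊔ span {(n : 𝓞 L)}) = I := fun I hI =>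
    sup_mul_sup_of_isCoprime (isCoprime_span_natCast h) (by
      rw [span_singleton_mul_span_singleton, ← Nat.cast_mul]
      exact span_natCast_absNorm_le hI)
  have hdvd : ∀ I : Ideal (𝓞 L), absNorm I = m * n →
      absNorm (I ⊔ span {(m : 𝓞 L)}) ∣ m ∧ absNorm (I ⊔ span {(n : 𝓞 L)}) ∣ n := by
    intro I hI
    have h3 := hI
    rw [← key I hI, map_mul] at h3
    exact ⟨(absNorm_sup_span_natCast_coprime h I).dvd_of_dvd_mul_right (Dvd.intro _ h3),
      (absNorm_sup_span_natCast_coprime h.symm I).dvd_of_dvd_mul_left (Dvd.intro_left _ h3)⟩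
  have hnorm : ∀ I : Ideal (𝓞 L), absNorm I = m * n →
      absNorm (I ⊔ span {(m : 𝓞 L)}) = m ∧ absNorm (I ⊔ span {(n : 𝓞 L)}) = n := by
    intro I hI
    obtain ⟨h1, h2⟩ := hdvd I hI
    have h3 := hI
    rw [← key I hI, map_mul] at h3
    rcases Nat.eq_zero_or_pos m with rfl | hm
    · have : n = 1 := by simpa using h
      subst this
      refine ⟨?_, Nat.dvd_one.mp h2⟩
      rw [Nat.dvd_one.mp h2] at h3; simpa using h3
    rcases Nat.eq_zero_or_pos n with rfl | hn
    · have : m = 1 := by simpa using h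
      subst this
      refine ⟨Nat.dvd_one.mp h1, ?_⟩
      rw [Nat.dvd_one.mp h1] at h3; simpa using h3
    have h4 := Nat.le_of_dvd hm h1
    have h5 := Nat.le_of_dvd hn h2
    constructor <;> nlinarith
  refine Nat.card_congr
    { toFun := fun I => ⟨⟨_, (hnorm I.1 I.2).1⟩, ⟨_, (hnorm I.1 I.2).2⟩⟩
      invFun := fun J => ⟨J.1.1 * J.2.1, by rw [map_mul, J.1.2, J.2.2]⟩
      left_inv := fun I => Subtype.ext (key I.1 I.2)
      right_inv := ?_ }
  rintro ⟨⟨I, hI⟩, ⟨J, hJ⟩⟩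
  have h1 := span_natCast_absNorm_le hI
  have h2 := span_natCast_absNorm_le hJ
  simp only [Prod.mk.injEq, Subtype.mk.injEq]
  refine ⟨mul_sup_of_isCoprime (isCoprime_span_natCast h) h1 h2, ?_⟩
  rw [mul_comm]
  exact mul_sup_of_isCoprime (isCoprime_span_natCast h.symm) h2 h1


open UniqueFactorizationMonoid in
lemma dvd_absNorm_of_mem_normalizedFactors {p e : ℕ} (hp : p.Prime) {I P : Ideal (𝓞 L)}
    (hI : absNorm I = p ^ e) (hP : P ∈ normalizedFactors I) : p ∣ absNorm P := by
  have hdvd : absNorm P ∣ p ^ e := by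
    rw [← hI]; exact map_dvd absNorm (dvd_of_mem_normalizedFactors hP)
  obtain ⟨j, -, hj⟩ := (Nat.dvd_prime_pow hp).mp hdvd
  rw [hj]
  refine dvd_pow_self p fun h0 => ?_
  rw [h0, pow_zero, absNorm_eq_one_iff] at hj
  exact (prime_of_normalized_factor P hP).not_isUnit (isUnit_iff.mpr hj)

lemma Multiset.pow_card_dvd_prod {M : Type*} [CommMonoid M] {a : M} {s : Multiset M}
    (h : ∀ x ∈ s, a ∣ x) : a ^ s.card ∣ s.prod := by
  induction s using Multiset.induction_on with
  | empty => simp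
  | cons b s ih =>
    rw [Multiset.card_cons, Multiset.prod_cons, pow_succ']
    exact mul_dvd_mul (h _ (by simp)) (ih fun x hx => h x (by simp [hx]))

open UniqueFactorizationMonoid in
lemma card_normalizedFactors_le {p e : ℕ} (hp : p.Prime) {I : Ideal (𝓞 L)}
    (hI : absNorm I = p ^ e) : (normalizedFactors I).card ≤ e := by
  have hI0 : I ≠ ⊥ := by
    rintro rfl
    rw [absNorm_bot] at hI
    exact pow_ne_zero e hp.ne_zero hI.symm
  have h1 : p ^ ((normalizedFactors I).map absNorm).card ∣
      ((normalizedFactors I).map absNorm).prod := by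
    refine Multiset.pow_card_dvd_prod fun x hx => ?_
    obtain ⟨P, hP, rfl⟩ := Multiset.mem_map.mp hx
    exact dvd_absNorm_of_mem_normalizedFactors hp hI hP
  rw [← map_multiset_prod, Ideal.prod_normalizedFactors_eq_self hI0, hI, Multiset.card_map] at h1
  exact (Nat.pow_dvd_pow_iff_le_right hp.one_lt).mp h1

open UniqueFactorizationMonoid Classical in
lemma idealCount_prime_pow_le {p : ℕ} (hp : p.Prime) (e : ℕ) :
    idealCount L (p ^ e) ≤ (e + 1) ^ Module.finrank ℤ (𝓞 L) := by
  set T := (normalizedFactors (span {(p : 𝓞 L)})).toFinset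
  have hT : T.card ≤ Module.finrank ℤ (𝓞 L) :=
    (Multiset.toFinset_card_le _).trans (card_normalizedFactors_le hp (absNorm_span_natCast p))
  have hne : ∀ I : Ideal (𝓞 L), absNorm I = p ^ e → I ≠ ⊥ := by
    rintro I hI rfl
    rw [absNorm_bot] at hI
    exact pow_ne_zero e hp.ne_zero hI.symm
  have hmem : ∀ I : Ideal (𝓞 L), absNorm I = p ^ e → ∀ P ∈ normalizedFactors I, P ∈ T := by
    intro I hI P hP
    have hPp := prime_of_normalized_factor P hP
    have : (p : 𝓞 L) ^ e ∈ P := by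
      have := absNorm_mem I
      rw [hI] at this
      exact le_of_dvd (dvd_of_mem_normalizedFactors hP) (by exact_mod_cast this)
    rw [Multiset.mem_toFinset, Ideal.mem_normalizedFactors_iff]
    · refine ⟨isPrime_of_prime hPp, ?_⟩
      rw [span_singleton_le_iff_mem]
      exact (isPrime_of_prime hPp).mem_of_pow_mem _ this
    · simpa using hp.ne_zero
  let F : {I : Ideal (𝓞 L) // absNorm I = p ^ e} → (T → Fin (e + 1)) := fun I P =>
    ⟨(normalizedFactors I.1).count P.1, Nat.lt_succ_of_le
      ((Multiset.count_le_card _ _).trans (card_normalizedFactors_le hp I.2))⟩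
  have hF : Function.Injective F := by
    intro I J hIJ
    apply Subtype.ext
    rw [← Ideal.prod_normalizedFactors_eq_self (hne I.1 I.2),
      ← Ideal.prod_normalizedFactors_eq_self (hne J.1 J.2)]
    congr 1
    ext P
    by_cases hP : P ∈ T
    · simpa [F] using congrArg Fin.val (congrFun hIJ ⟨P, hP⟩)
    · rw [Multiset.count_eq_zero_of_notMem fun h => hP (hmem _ I.2 _ h),
        Multiset.count_eq_zero_of_notMem fun h => hP (hmem _ J.2 _ h)]
  refine (Nat.card_le_card_of_injective F hF).trans ?_
  rw [Nat.card_fun, Nat.card_eq_fintype_card, Fintype.card_fin, Nat.card_eq_fintype_card,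
    Fintype.card_coe]
  exact Nat.pow_le_pow_right (Nat.succ_pos e) hT

end IdealCount

section EulerProductLog

open Filter Topology

variable {a : ℕ → ℝ} {N : ℕ}

lemma summable_add_three_pow_mul_half_pow (N : ℕ) :
    Summable fun e : ℕ => ((e : ℝ) + 3) ^ N * (1 / 2 : ℝ) ^ e := by
  have h := summable_pow_mul_geometric_of_norm_lt_one (R := ℝ) N (r := 1 / 2) (by norm_num)
  have h' := ((summable_nat_add_iff 3).mpr h).mul_left 8
  refine h'.congr fun e => ?_
  push_cast
  rw [pow_add]
  ring

lemma abs_log_tsum_sub_le (ha0 : ∀ e, 0 ≤ a e) (hone : a 0 = 1)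
    (hbd : ∀ e, a e ≤ ((e : ℝ) + 1) ^ N) {x : ℝ} (hx0 : 0 ≤ x) (hx : x ≤ 1 / 2) :
    0 < ∑' e, a e * x ^ e ∧
    |Real.log (∑' e, a e * x ^ e) - a 1 * x| ≤
      ((∑' e : ℕ, ((e : ℝ) + 3) ^ N * (1 / 2 : ℝ) ^ e) +
        (2 ^ N + ∑' e : ℕ, ((e : ℝ) + 3) ^ N * (1 / 2 : ℝ) ^ e) ^ 2) * x ^ 2 := by
  have hsC := summable_add_three_pow_mul_half_pow N
  set C := ∑' e : ℕ, ((e : ℝ) + 3) ^ N * (1 / 2 : ℝ) ^ e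
  have hle : ∀ e, a (e + 2) * x ^ e ≤ ((e : ℝ) + 3) ^ N * (1 / 2 : ℝ) ^ e := by
    intro e
    have := hbd (e + 2)
    push_cast at this
    have h3 : (e : ℝ) + 2 + 1 = e + 3 := by ring
    rw [h3] at this
    gcongr
  have hs2 : Summable fun e => a (e + 2) * x ^ e :=
    Summable.of_nonneg_of_le (fun e => mul_nonneg (ha0 _) (pow_nonneg hx0 _)) hle hsC
  have hT0 : 0 ≤ ∑' e, a (e + 2) * x ^ e :=
    tsum_nonneg fun e => mul_nonneg (ha0 _) (pow_nonneg hx0 _)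
  have hTC : ∑' e, a (e + 2) * x ^ e ≤ C := hs2.tsum_le_tsum hle hsC
  set T := ∑' e, a (e + 2) * x ^ e
  have hs2' : Summable fun e => a (e + 2) * x ^ (e + 2) :=
    (hs2.mul_right (x ^ 2)).congr fun e => by ring
  have hs : Summable fun e => a e * x ^ e :=
    (summable_nat_add_iff (f := fun e => a e * x ^ e) 2).mp hs2'
  have hsum : ∑' e, a e * x ^ e = 1 + (a 1 * x + T * x ^ 2) := by
    rw [← hs.sum_add_tsum_nat_add 2, Finset.sum_range_succ, Finset.sum_range_one, hone,
      ← tsum_mul_right]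
    simp only [pow_zero, pow_one, mul_one, add_assoc]
    congr 3
    ext e
    ring
  rw [hsum]
  have ha1 : a 1 ≤ 2 ^ N := by
    refine (hbd 1).trans (le_of_eq ?_)
    norm_num
  have ha1' := ha0 1
  have hu0 : 0 ≤ a 1 * x + T * x ^ 2 := by positivity
  have hu : a 1 * x + T * x ^ 2 ≤ (2 ^ N + C) * x := by
    have : T * x ^ 2 ≤ C * x := by
      have h1 : x ^ 2 ≤ x := by nlinarith
      calc T * x ^ 2 ≤ T * x := by gcongr
        _ ≤ C * x := by gcongr
    have : a 1 * x ≤ 2 ^ N * x := by gcongr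
    linarith
  set u := a 1 * x + T * x ^ 2 with hu_def
  have hu2 : u ^ 2 ≤ (2 ^ N + C) ^ 2 * x ^ 2 := by
    rw [← mul_pow]; exact pow_le_pow_left₀ hu0 hu 2
  have hTx : T * x ^ 2 ≤ C * x ^ 2 := by gcongr
  have hTx0 : 0 ≤ T * x ^ 2 := by positivity
  have hup : Real.log (1 + u) ≤ u := by
    have := Real.log_le_sub_one_of_pos (show 0 < 1 + u by linarith)
    linarith
  have hlow : u - u ^ 2 ≤ Real.log (1 + u) := by
    have h1 := Real.one_sub_inv_le_log_of_pos (show 0 < 1 + u by linarith)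
    have h2 : u - u ^ 2 ≤ 1 - (1 + u)⁻¹ := by
      have : 1 - (1 + u)⁻¹ - (u - u ^ 2) = u ^ 3 / (1 + u) := by
        field_simp
        ring
      have h3 : 0 ≤ u ^ 3 / (1 + u) := by positivity
      linarith
    linarith
  refine ⟨by linarith, ?_⟩
  rw [abs_le]
  constructor <;> nlinarith [sq_nonneg u]

lemma natCast_rpow_neg_pow (p e : ℕ) (s : ℝ) :
    ((p ^ e : ℕ) : ℝ) ^ (-s) = ((p : ℝ) ^ (-s)) ^ e := by
  rw [Nat.cast_pow, ← Real.rpow_natCast_mul (Nat.cast_nonneg p), ← Real.rpow_mul_natCast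
    (Nat.cast_nonneg p), mul_comm]

lemma Nat.Primes.rpow_neg_le_half (p : Nat.Primes) {s : ℝ} (hs : 1 < s) :
    ((p : ℕ) : ℝ) ^ (-s) ≤ 1 / 2 := by
  have h2 : (2 : ℝ) ≤ (p : ℕ) := by exact_mod_cast p.2.two_le
  calc ((p : ℕ) : ℝ) ^ (-s) ≤ ((p : ℕ) : ℝ) ^ (-1 : ℝ) :=
        Real.rpow_le_rpow_of_exponent_le (by linarith) (by linarith)
    _ = ((p : ℕ) : ℝ)⁻¹ := Real.rpow_neg_one _
    _ ≤ 1 / 2 := by rw [one_div]; exact inv_anti₀ (by norm_num) h2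

lemma abs_tsum_primes_sub_log_le (ha0 : ∀ n, 0 ≤ a n) (hone : a 1 = 1)
    (hmul : ∀ {m n : ℕ}, m.Coprime n → a (m * n) = a m * a n)
    (hbd : ∀ p e : ℕ, p.Prime → a (p ^ e) ≤ ((e : ℝ) + 1) ^ N)
    (hsum : ∀ s : ℝ, 1 < s → Summable fun n : ℕ => a n * (n : ℝ) ^ (-s)) :
    ∃ C : ℝ, ∀ s : ℝ, 1 < s →
      |(∑' p : Nat.Primes, a p * ((p : ℕ) : ℝ) ^ (-s)) -
        Real.log (∑' n : ℕ, a n * (n : ℝ) ^ (-s))| ≤ C := by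
  set B := (∑' e : ℕ, ((e : ℝ) + 3) ^ N * (1 / 2 : ℝ) ^ e) +
        (2 ^ N + ∑' e : ℕ, ((e : ℝ) + 3) ^ N * (1 / 2 : ℝ) ^ e) ^ 2 with hB
  have hB0 : 0 ≤ B := by
    have : 0 ≤ ∑' e : ℕ, ((e : ℝ) + 3) ^ N * (1 / 2 : ℝ) ^ e :=
      tsum_nonneg fun e => by positivity
    positivity
  have hsq : Summable fun p : Nat.Primes => B * ((p : ℕ) : ℝ) ^ (-2 : ℝ) :=
    (Nat.Primes.summable_rpow.mpr (by norm_num)).mul_left B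
  refine ⟨∑' p : Nat.Primes, B * ((p : ℕ) : ℝ) ^ (-2 : ℝ), fun s hs => ?_⟩
  have key : ∀ p : Nat.Primes, (∑' e : ℕ, a (p ^ e) * (((p ^ e : ℕ) : ℕ) : ℝ) ^ (-s)) =
      ∑' e : ℕ, a (p ^ e) * (((p : ℕ) : ℝ) ^ (-s)) ^ e := fun p => by
    simp_rw [natCast_rpow_neg_pow]
  have hloc := fun p : Nat.Primes => abs_log_tsum_sub_le (a := fun e => a (p ^ e)) (N := N)
    (fun e => ha0 _) (by simpa using hone) (fun e => hbd p e p.2)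
    (x := ((p : ℕ) : ℝ) ^ (-s)) (by positivity) (p.rpow_neg_le_half hs)
  simp only [← key, pow_one] at hloc
  have hprod := EulerProduct.eulerProduct_hasProd (R := ℝ)
    (f := fun n : ℕ => a n * (n : ℝ) ^ (-s)) (by simp [hone])
    (fun {m n} h => by
      simp only [hmul h, Nat.cast_mul]
      rw [Real.mul_rpow (Nat.cast_nonneg _) (Nat.cast_nonneg _)]
      ring) (hsum s hs).norm
    (by simp [Real.zero_rpow (show -s ≠ 0 by linarith)])
  set F := fun p : Nat.Primes => ∑' e : ℕ, a (p ^ e) * (((p ^ e : ℕ) : ℕ) : ℝ) ^ (-s)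
  have hG : Summable fun p : Nat.Primes => a p * ((p : ℕ) : ℝ) ^ (-s) :=
    (hsum s hs).subtype _
  have hdiff : ∀ p : Nat.Primes, ‖Real.log (F p) - a p * ((p : ℕ) : ℝ) ^ (-s)‖ ≤
      B * ((p : ℕ) : ℝ) ^ (-2 : ℝ) := by
    intro p
    refine (hloc p).2.trans ?_
    have h1 : (1 : ℝ) ≤ (p : ℕ) := by exact_mod_cast p.2.one_lt.le
    rw [← hB, ← Real.rpow_mul_natCast (Nat.cast_nonneg _)]
    exact mul_le_mul_of_nonneg_left
      (Real.rpow_le_rpow_of_exponent_le h1 (by push_cast; linarith)) hB0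
  have hdsum : Summable fun p : Nat.Primes => Real.log (F p) - a p * ((p : ℕ) : ℝ) ^ (-s) :=
    Summable.of_norm_bounded hsq hdiff
  have hlogs : Summable fun p : Nat.Primes => Real.log (F p) :=
    (hdsum.add hG).congr fun p => by ring
  have hexp := Real.rexp_tsum_eq_tprod (f := F) (fun p => (hloc p).1) hlogs
  rw [hprod.tprod_eq] at hexp
  rw [← hexp, Real.log_exp, abs_sub_comm, ← hlogs.tsum_sub hG]
  exact tsum_of_norm_bounded hsq.hasSum hdiff

lemma tendsto_neg_log_sub_one_atTop :
    Tendsto (fun s : ℝ => -Real.log (s - 1)) (𝓝[>] 1) atTop := by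
  have h : Tendsto (fun s : ℝ => s - 1) (𝓝[>] 1) (𝓝[>] 0) := by
    refine tendsto_nhdsWithin_iff.mpr ⟨?_, ?_⟩
    · refine tendsto_nhdsWithin_of_tendsto_nhds ?_
      have : Continuous fun s : ℝ => s - 1 := by fun_prop
      simpa using this.tendsto 1
    · filter_upwards [self_mem_nhdsWithin] with s hs
      simpa using hs
  exact tendsto_neg_atBot_atTop.comp (Real.tendsto_log_nhdsGT_zero.comp h)

lemma tendsto_tsum_primes_div_log (ha0 : ∀ n, 0 ≤ a n) (hone : a 1 = 1)
    (hmul : ∀ {m n : ℕ}, m.Coprime n → a (m * n) = a m * a n)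
    (hbd : ∀ p e : ℕ, p.Prime → a (p ^ e) ≤ ((e : ℝ) + 1) ^ N)
    (hsum : ∀ s : ℝ, 1 < s → Summable fun n : ℕ => a n * (n : ℝ) ^ (-s))
    {c : ℝ} (hc : 0 < c)
    (hlim : Tendsto (fun s : ℝ => (s - 1) * ∑' n : ℕ, a n * (n : ℝ) ^ (-s)) (𝓝[>] 1) (𝓝 c)) :
    Tendsto (fun s : ℝ => (∑' p : Nat.Primes, a p * ((p : ℕ) : ℝ) ^ (-s)) / -Real.log (s - 1))
      (𝓝[>] 1) (𝓝 1) := by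
  obtain ⟨C, hC⟩ := abs_tsum_primes_sub_log_le ha0 hone hmul hbd hsum
  have hΛ := tendsto_neg_log_sub_one_atTop
  have h1 : Tendsto (fun s : ℝ => ((∑' p : Nat.Primes, a p * ((p : ℕ) : ℝ) ^ (-s)) -
        Real.log (∑' n : ℕ, a n * (n : ℝ) ^ (-s))) / -Real.log (s - 1)) (𝓝[>] 1) (𝓝 0) := by
    refine squeeze_zero_norm' ?_ (hΛ.const_div_atTop C)
    filter_upwards [self_mem_nhdsWithin, hΛ.eventually_gt_atTop 0] with s hs hs'
    rw [Real.norm_eq_abs, abs_div, abs_of_pos hs']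
    exact div_le_div_of_nonneg_right (hC s hs) hs'.le
  have h2 : Tendsto (fun s : ℝ => Real.log ((s - 1) * ∑' n : ℕ, a n * (n : ℝ) ^ (-s)) /
      -Real.log (s - 1)) (𝓝[>] 1) (𝓝 0) :=
    ((Real.continuousAt_log hc.ne').tendsto.comp hlim).div_atTop hΛ
  have h3 := (h1.add h2).add_const 1
  rw [add_zero, zero_add] at h3
  refine h3.congr' ?_
  filter_upwards [self_mem_nhdsWithin, hΛ.eventually_gt_atTop 0,
    hlim.eventually (lt_mem_nhds hc)] with s hs hs' hpos
  have hs1 : 0 < s - 1 := sub_pos.mpr hs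
  have hZ : 0 < ∑' n : ℕ, a n * (n : ℝ) ^ (-s) := pos_of_mul_pos_right hpos hs1.le
  rw [Real.log_mul hs1.ne' hZ.ne']
  have : Real.log (s - 1) ≠ 0 := by intro h; rw [h] at hs'; simp at hs'
  field_simp
  ring

end EulerProductLog

section Dedekind

open Filter Topology

variable (L : Type*) [Field L] [NumberField L]

lemma tendsto_sum_idealCount_div :
    Tendsto (fun n : ℕ => (∑ k ∈ Finset.Icc 1 n, (idealCount L k : ℝ)) / n) atTop
      (𝓝 (dedekindZeta_residue L)) := by
  refine ((NumberField.Ideal.tendsto_norm_le_div_atTop₀ L).comp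
    tendsto_natCast_atTop_atTop).congr fun n ↦ ?_
  simp only [Function.comp_apply, Nat.cast_le, ← Nat.cast_sum]
  congr
  rw [← add_left_inj 1, ← card_norm_le_eq_card_norm_le_add_one,
    show Finset.Icc 1 n = Finset.Ioc 0 n from Finset.Icc_succ_left_eq_Ioc _ _,
    show 1 = idealCount L 0 by simp [idealCount, Ideal.absNorm_eq_zero_iff],
    Finset.sum_Ioc_add_eq_sum_Icc (n.zero_le)]
  simp only [idealCount]
  rw [← Finset.card_preimage_eq_sum_card_image_eq (fun k _ ↦ finite_setOfPred_absNorm_eq k)]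
  simp [Set.coe_eq_subtype]

lemma norm_LSeries_term_idealCount {s : ℝ} (hs : 1 < s) (n : ℕ) :
    LSeries.term (fun n => ((idealCount L n : ℝ) : ℂ)) s n =
      (((idealCount L n : ℝ) * (n : ℝ) ^ (-s) : ℝ) : ℂ) := by
  rcases eq_or_ne n 0 with rfl | hn
  · simp [Real.zero_rpow (show -s ≠ 0 by linarith)]
  · rw [LSeries.term_of_ne_zero hn, Complex.ofReal_mul,
      Complex.ofReal_cpow (Nat.cast_nonneg n), Complex.ofReal_neg, Complex.cpow_neg,
      div_eq_mul_inv]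
    simp

lemma summable_idealCount {s : ℝ} (hs : 1 < s) :
    Summable fun n : ℕ => (idealCount L n : ℝ) * (n : ℝ) ^ (-s) := by
  have hO : (fun n : ℕ => ∑ k ∈ Finset.Icc 1 n, (idealCount L k : ℝ)) =O[atTop]
      fun n : ℕ => (n : ℝ) ^ (1 : ℝ) := by
    simp only [Real.rpow_one]
    refine Asymptotics.isBigO_of_div_tendsto_nhds ?_ _ (tendsto_sum_idealCount_div L)
    filter_upwards [eventually_ne_atTop 0] with n hn h
    exact absurd (by exact_mod_cast h) hn
  have h := LSeriesSummable_of_sum_norm_bigO_and_nonneg hO (fun n => Nat.cast_nonneg _)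
    zero_le_one (s := (s : ℂ)) (by simpa using hs)
  rw [LSeriesSummable] at h
  rw [← Complex.summable_ofReal]
  exact h.congr (norm_LSeries_term_idealCount L hs)

lemma tendsto_tsum_idealCount_primes :
    Tendsto (fun s : ℝ => (∑' p : Nat.Primes, (idealCount L p : ℝ) * ((p : ℕ) : ℝ) ^ (-s)) /
      -Real.log (s - 1)) (𝓝[>] 1) (𝓝 1) := by
  refine tendsto_tsum_primes_div_log (a := fun n => (idealCount L n : ℝ))
    (N := Module.finrank ℤ (𝓞 L)) (fun n => Nat.cast_nonneg _)
    (by simp [idealCount_one]) (fun h => by simp [idealCount_mul h])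
    (fun p e hp => by exact_mod_cast idealCount_prime_pow_le hp e)
    (fun s hs => summable_idealCount L hs) (dedekindZeta_residue_pos L) ?_
  have h := tendsto_sub_one_mul_dedekindZeta_nhdsGT L
  rw [← Filter.tendsto_ofReal_iff]
  refine h.congr' ?_
  filter_upwards [self_mem_nhdsWithin] with s hs
  have : dedekindZeta L s = ((∑' n : ℕ, (idealCount L n : ℝ) * (n : ℝ) ^ (-s) : ℝ) : ℂ) := by
    rw [Complex.ofReal_tsum, dedekindZeta, LSeries]
    exact tsum_congr (fun n => by
      rw [← norm_LSeries_term_idealCount L hs]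
      simp [idealCount])
  simp [this]

end Dedekind

section SplittingCriterion

open Polynomial

variable {L : Type*} [Field L]

lemma splits_map_ringOfIntegers {f : ℤ[X]} (hf : f.Monic)
    (hs : (f.map (algebraMap ℤ L)).Splits) : (f.map (algebraMap ℤ (𝓞 L))).Splits := by
  rw [IsScalarTower.algebraMap_eq ℤ (𝓞 L) L, ← Polynomial.map_map] at hs
  refine hs.of_splits_map_of_injective (FaithfulSMul.algebraMap_injective (𝓞 L) L) fun a ha ↦ ?_
  have : IsIntegral ℤ a := by
    refine ⟨f, hf, ?_⟩
    rw [Polynomial.map_map, ← IsScalarTower.algebraMap_eq] at ha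
    simpa [eval_map] using (mem_roots'.1 ha).2
  exact ⟨⟨a, this⟩, rfl⟩

variable (L) in
/-- The product of the differences of distinct roots of `f` in the ring of integers. -/
noncomputable def rootDifferences (f : ℤ[X]) : 𝓞 L :=
  open Classical in
  ∏ x ∈ (f.map (algebraMap ℤ (𝓞 L))).roots.toFinset.offDiag, (x.1 - x.2)

lemma rootDifferences_ne_zero (f : ℤ[X]) : rootDifferences L f ≠ 0 := by
  classical
  refine Finset.prod_ne_zero_iff.2 fun x hx ↦ ?_
  exact sub_ne_zero.2 (Finset.mem_offDiag.1 hx).2.2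

variable [NumberField L]

lemma splits_map_zmod_of_idealCount_ne_zero {f : ℤ[X]} (hf : f.Monic)
    (hs : (f.map (algebraMap ℤ L)).Splits) {p : ℕ} (hp : p.Prime) (h : idealCount L p ≠ 0) :
    (f.map (Int.castRingHom (ZMod p))).Splits := by
  have : Nonempty {I : Ideal (𝓞 L) // Ideal.absNorm I = p} := by
    by_contra hne
    rw [not_nonempty_iff] at hne
    exact h Nat.card_of_isEmpty
  obtain ⟨I, hI⟩ := this
  rw [Ideal.absNorm_apply, Submodule.cardQuot_apply] at hI
  have : Finite (𝓞 L ⧸ I) := Nat.finite_of_card_ne_zero (hI ▸ hp.ne_zero)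
  let _ := Fintype.ofFinite (𝓞 L ⧸ I)
  let e := ZMod.ringEquivOfPrime (𝓞 L ⧸ I) hp (by rw [← Nat.card_eq_fintype_card]; exact hI)
  have := (splits_map_ringOfIntegers hf hs).map
    ((e.symm : (𝓞 L ⧸ I) →+* ZMod p).comp (Ideal.Quotient.mk I))
  rw [Polynomial.map_map] at this
  convert this using 2
  exact RingHom.ext_int _ _

open scoped Pointwise in
lemma stabilizer_eq_bot [IsGalois ℚ L] {f : ℤ[X]} (hf : f.Monic)
    (hgen : ∀ σ : Gal(L/ℚ), (∀ x : L, aeval x f = 0 → σ x = x) → σ = 1)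
    {p : ℕ} (hp : p.Prime) (hsp : (f.map (Int.castRingHom (ZMod p))).Splits)
    (𝔓 : Ideal (𝓞 L)) [𝔓.IsPrime] (hp𝔓 : (p : 𝓞 L) ∈ 𝔓) (hD : rootDifferences L f ∉ 𝔓) :
    MulAction.stabilizer Gal(L/ℚ) 𝔓 = ⊥ := by
  classical
  have : Fact p.Prime := ⟨hp⟩
  have : CharP (𝓞 L ⧸ 𝔓) p := by
    refine (CharP.charP_iff_prime_eq_zero hp).2 ?_
    rw [← map_natCast (Ideal.Quotient.mk 𝔓)]
    exact Ideal.Quotient.eq_zero_iff_mem.2 hp𝔓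
  let φ : ZMod p →+* 𝓞 L ⧸ 𝔓 := ZMod.castHom dvd_rfl _
  have hroot : ∀ x : 𝓞 L, aeval x f = 0 → ∃ c : ℤ, x - c ∈ 𝔓 := by
    intro x hx
    have h1 : eval (Ideal.Quotient.mk 𝔓 x) ((f.map (Int.castRingHom (ZMod p))).map φ) = 0 := by
      rw [Polynomial.map_map, eval_map, RingHom.ext_int (φ.comp (Int.castRingHom (ZMod p)))
        ((Ideal.Quotient.mk 𝔓).comp (algebraMap ℤ (𝓞 L))), ← hom_eval₂]
      rw [aeval_def] at hx
      rw [hx, map_zero]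
    rw [(hsp.map φ).eval_eq_prod_roots_of_monic ((hf.map _).map _), Multiset.prod_eq_zero_iff] at h1
    obtain ⟨c, hc, hc0⟩ := Multiset.mem_map.1 h1
    rw [hsp.roots_map φ] at hc
    obtain ⟨d, -, rfl⟩ := Multiset.mem_map.1 hc
    obtain ⟨d, rfl⟩ := ZMod.intCast_surjective d
    refine ⟨d, Ideal.Quotient.eq_zero_iff_mem.1 ?_⟩
    simpa using hc0
  refine (Subgroup.eq_bot_iff_forall _).2 fun σ hσ ↦ hgen σ fun x hx ↦ ?_
  have hxi : IsIntegral ℤ x := ⟨f, hf, by simpa [aeval_def] using hx⟩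
  obtain ⟨x, rfl⟩ : ∃ y : 𝓞 L, algebraMap (𝓞 L) L y = x := ⟨⟨x, hxi⟩, rfl⟩
  have hx' : aeval x f = 0 := by
    apply FaithfulSMul.algebraMap_injective (𝓞 L) L
    rw [← aeval_algebraMap_apply, hx, map_zero]
  have hsx : algebraMap (𝓞 L) L (σ • x) = σ (algebraMap (𝓞 L) L x) := rfl
  rw [← hsx]
  congr 1
  by_contra hne
  obtain ⟨c, hc⟩ := hroot x hx'
  have hσc : σ • x - c ∈ 𝔓 := by
    have := Ideal.smul_mem_pointwise_smul σ _ _ hc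
    rw [MulAction.mem_stabilizer_iff.1 hσ, smul_sub] at this
    convert this
    exact (map_intCast (MulSemiringAction.toRingHom Gal(L/ℚ) (𝓞 L) σ) c).symm
  have hσx : aeval (σ • x) f = 0 := by
    apply FaithfulSMul.algebraMap_injective (𝓞 L) L
    rw [← aeval_algebraMap_apply, hsx]
    have := aeval_algHom_apply (σ.toAlgHom.restrictScalars ℤ) (algebraMap (𝓞 L) L x) f
    rw [hx, map_zero] at this
    rw [map_zero]
    exact this
  have hsub : σ • x - x ∈ 𝔓 := by simpa using 𝔓.sub_mem hσc hc
  refine hD (𝔓.mem_of_dvd (Finset.dvd_prod_of_mem _ (?_ : (σ • x, x) ∈ _)) hsub)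
  simp only [Finset.mem_offDiag, Multiset.mem_toFinset, mem_roots', ne_eq,
    (hf.map (algebraMap ℤ (𝓞 L))).ne_zero, not_false_iff, true_and, IsRoot.def, eval_map]
  exact ⟨hσx, hx', hne⟩

open scoped Pointwise in
lemma idealCount_eq_finrank [IsGalois ℚ L] {f : ℤ[X]} (hf : f.Monic)
    (hgen : ∀ σ : Gal(L/ℚ), (∀ x : L, aeval x f = 0 → σ x = x) → σ = 1)
    {p : ℕ} (hp : p.Prime) (hsp : (f.map (Int.castRingHom (ZMod p))).Splits)
    (hpD : Ideal.absNorm (Ideal.span {rootDifferences L f}) < p) :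
    idealCount L p = Module.finrank ℚ L := by
  have hpi : Prime (p : ℤ) := Nat.prime_iff_prime_int.1 hp
  let 𝔭 : Ideal ℤ := Ideal.span {(p : ℤ)}
  have h𝔭 : 𝔭.IsPrime := (Ideal.span_singleton_prime hpi.ne_zero).2 hpi
  have h𝔭b : 𝔭 ≠ ⊥ := by simpa [𝔭, Ideal.span_singleton_eq_bot] using hp.ne_zero
  have h𝔭max : 𝔭.IsMaximal := h𝔭.isMaximal h𝔭b
  have hD0 : Ideal.absNorm (Ideal.span {rootDifferences L f}) ≠ 0 := by
    simpa [Ideal.absNorm_eq_zero_iff, Ideal.span_singleton_eq_bot] using rootDifferences_ne_zero f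
  have hmem : ∀ 𝔓 : Ideal (𝓞 L), 𝔓.LiesOver 𝔭 → (p : 𝓞 L) ∈ 𝔓 := by
    intro 𝔓 h
    have : (p : ℤ) ∈ 𝔭 := Ideal.mem_span_singleton_self _
    rw [h.over, Ideal.mem_comap] at this
    simpa using this
  have hstab : ∀ 𝔓 : Ideal (𝓞 L), 𝔓.IsPrime → 𝔓.LiesOver 𝔭 →
      MulAction.stabilizer Gal(L/ℚ) 𝔓 = ⊥ := by
    intro 𝔓 _ _
    refine stabilizer_eq_bot hf hgen hp hsp 𝔓 (hmem 𝔓 inferInstance) fun h ↦ ?_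
    have h1 : Ideal.absNorm 𝔓 ∣ Ideal.absNorm (Ideal.span {rootDifferences L f}) :=
      Ideal.absNorm_dvd_absNorm_of_le ((Ideal.span_singleton_le_iff_mem _).2 h)
    rw [Ideal.absNorm_eq_pow_inertiaDeg' 𝔓 hp] at h1
    have h2 : 𝔭.inertiaDeg' 𝔓 ≠ 0 := (Ideal.inertiaDeg'_pos 𝔭 𝔓).ne'
    exact absurd (Nat.le_of_dvd (Nat.pos_of_ne_zero hD0) ((dvd_pow_self p h2).trans h1)) hpD.not_ge
  obtain ⟨𝔓, _, _⟩ := (inferInstance : Nonempty (𝔭.primesOver (𝓞 L)))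
  have hcard : (𝔭.primesOver (𝓞 L)).ncard = Module.finrank ℚ L := by
    rw [← IsGalois.card_aut_eq_finrank,
      ← Algebra.IsInvariant.orbit_eq_primesOver ℤ (𝓞 L) Gal(L/ℚ) 𝔭 𝔓,
      ← Nat.card_congr (MulAction.orbitProdStabilizerEquivGroup Gal(L/ℚ) 𝔓), Nat.card_prod,
      hstab 𝔓 inferInstance inferInstance]
    simp [Nat.card_coe_set_eq]
  have hef := Ideal.ncard_primesOver_mul_ramificationIdxIn_mul_inertiaDegIn 𝔭 (𝓞 L) Gal(L/ℚ)
  rw [hcard, IsGalois.card_aut_eq_finrank, Nat.mul_eq_left Module.finrank_pos.ne'] at hef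
  have hf1 : 𝔭.inertiaDegIn (𝓞 L) = 1 := Nat.eq_one_of_mul_eq_one_left hef
  rw [← hcard, idealCount, ← Nat.card_coe_set_eq]
  congr
  ext I
  constructor
  · intro (hI : Ideal.absNorm I = p)
    have hIp : I.IsPrime := Ideal.isPrime_of_irreducible_absNorm (by rw [hI]; exact hp)
    refine ⟨hIp, ⟨?_⟩⟩
    refine h𝔭max.eq_of_le (Ideal.IsPrime.ne_top inferInstance) ?_
    rw [Ideal.span_singleton_le_iff_mem, Ideal.mem_comap]
    simpa [hI] using Ideal.absNorm_mem I
  · rintro ⟨hI, hIp⟩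
    have : I.IsMaximal := hI.isMaximal (Ideal.ne_bot_of_liesOver_of_ne_bot h𝔭b I)
    change Ideal.absNorm I = p
    rw [Ideal.absNorm_eq_pow_inertiaDeg' I hp, Ideal.inertiaDeg'_eq_inertiaDeg,
      ← Ideal.inertiaDegIn_eq_inertiaDeg 𝔭 I Gal(L/ℚ), hf1,
      pow_one]

end SplittingCriterion

section SplitField

open Polynomial

/-- The splitting field of `f` over `ℚ` inside `ℂ`. -/
noncomputable abbrev splitField (f : ℤ[X]) : IntermediateField ℚ ℂ :=
  IntermediateField.adjoin ℚ ((f.map (algebraMap ℤ ℚ)).rootSet ℂ)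

variable (f : ℤ[X])

instance : (f.map (algebraMap ℤ ℚ)).IsSplittingField ℚ (splitField f) :=
  IntermediateField.adjoin_rootSet_isSplittingField (IsAlgClosed.splits _)

instance : FiniteDimensional ℚ (splitField f) :=
  IsSplittingField.finiteDimensional _ (f.map (algebraMap ℤ ℚ))

instance : NumberField (splitField f) where

instance : IsGalois ℚ (splitField f) where
  to_normal := Normal.of_isSplittingField (f.map (algebraMap ℤ ℚ))

variable {f}

lemma exists_idealCount_splitField_div (hf : f.Monic) :
    ∃ N : ℕ, ∀ p : ℕ, p.Prime → N < p → (idealCount (splitField f) p : ℝ) /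
      Module.finrank ℚ (splitField f) =
        (open Classical in if (f.map (Int.castRingHom (ZMod p))).Splits then 1 else 0) := by
  refine ⟨Ideal.absNorm (Ideal.span {rootDifferences (splitField f) f}), fun p hp hN ↦ ?_⟩
  have hs : (f.map (algebraMap ℤ (splitField f))).Splits := by
    have := IsSplittingField.splits (splitField f) (f.map (algebraMap ℤ ℚ))
    rwa [Polynomial.map_map, ← IsScalarTower.algebraMap_eq] at this
  have hgen : ∀ σ : Gal(splitField f/ℚ), (∀ x, aeval x f = 0 → σ x = x) → σ = 1 := by
    intro σ hσ
    have h := IsSplittingField.adjoin_rootSet (splitField f) (f.map (algebraMap ℤ ℚ))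
    have : (σ : splitField f →ₐ[ℚ] splitField f) = AlgHom.id ℚ _ := by
      refine AlgHom.ext_of_adjoin_eq_top h fun x hx ↦ ?_
      have := (mem_rootSet.1 hx).2
      rw [aeval_map_algebraMap] at this
      exact hσ x this
    ext x
    exact congr_arg Subtype.val (DFunLike.congr_fun this x)
  split_ifs with h
  · rw [idealCount_eq_finrank hf hgen hp h hN]
    exact div_self (by exact_mod_cast Module.finrank_pos.ne')
  · have : idealCount (splitField f) p = 0 := by
      by_contra h0
      exact h (splits_map_zmod_of_idealCount_ne_zero hf hs hp h0)
    simp [this]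

end SplitField

section Combination

open Polynomial Filter Topology

lemma sum_div_finrank_splitField_eq_zero {ι : Type*} (s : Finset ι) (f : ι → ℤ[X])
    (hf : ∀ i, (f i).Monic) (c : ι → ℝ)
    (h : ∃ N : ℕ, ∀ p : ℕ, p.Prime → N < p → ∑ i ∈ s, c i *
      (open Classical in if ((f i).map (Int.castRingHom (ZMod p))).Splits then 1 else 0) = 0) :
    ∑ i ∈ s, c i / Module.finrank ℚ (splitField (f i)) = 0 := by
  classical
  obtain ⟨N, hN⟩ := h
  choose M hM using fun i ↦ exists_idealCount_splitField_div (hf i)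
  let B := max N (s.sup M)
  let n : ι → ℝ := fun i ↦ Module.finrank ℚ (splitField (f i))
  let W : ℕ → ℝ := fun p ↦ ∑ i ∈ s, c i / n i * idealCount (splitField (f i)) p
  let T : Finset Nat.Primes := ((Finset.range (B + 1)).subtype Nat.Prime)
  have hW : ∀ p : Nat.Primes, p ∉ T → W p = 0 := by
    intro p hp
    have hp : B < p := by
      by_contra h
      exact hp (Finset.mem_subtype.2 (Finset.mem_range.2 (by omega)))
    rw [← hN p p.2 ((le_max_left _ _).trans_lt hp)]
    refine Finset.sum_congr rfl fun i hi ↦ ?_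
    rw [← hM i p p.2 (((Finset.le_sup hi).trans (le_max_right _ _)).trans_lt hp)]
    simp only [n]
    ring
  have hG : ∀ x : ℝ, 1 < x → ∑ i ∈ s, c i / n i *
      (∑' p : Nat.Primes, (idealCount (splitField (f i)) p : ℝ) * ((p : ℕ) : ℝ) ^ (-x)) =
      ∑ p ∈ T, W p * ((p : ℕ) : ℝ) ^ (-x) := by
    intro x hx
    have hsum : ∀ i, Summable fun p : Nat.Primes ↦
        (idealCount (splitField (f i)) p : ℝ) * ((p : ℕ) : ℝ) ^ (-x) := fun i ↦
      (summable_idealCount (splitField (f i)) hx).subtype _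
    simp_rw [← tsum_mul_left]
    rw [← Summable.tsum_finsetSum fun i _ ↦ (hsum i).mul_left _]
    rw [tsum_eq_sum (s := T)]
    · refine Finset.sum_congr rfl fun p _ ↦ ?_
      simp only [W, Finset.sum_mul, mul_assoc]
    · intro p hp
      rw [← zero_mul (((p : ℕ) : ℝ) ^ (-x)), ← hW p hp]
      simp only [W, Finset.sum_mul, mul_assoc]
  have h1 : Tendsto (fun x : ℝ ↦ ∑ i ∈ s, c i / n i *
      ((∑' p : Nat.Primes, (idealCount (splitField (f i)) p : ℝ) * ((p : ℕ) : ℝ) ^ (-x)) /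
        -Real.log (x - 1))) (𝓝[>] 1) (𝓝 (∑ i ∈ s, c i / n i * 1)) :=
    tendsto_finsetSum _ fun i _ ↦ (tendsto_tsum_idealCount_primes _).const_mul _
  have h2 : Tendsto (fun x : ℝ ↦ (∑ p ∈ T, W p * ((p : ℕ) : ℝ) ^ (-x)) / -Real.log (x - 1))
      (𝓝[>] 1) (𝓝 0) := by
    refine Tendsto.div_atTop (a := ∑ p ∈ T, W p * ((p : ℕ) : ℝ) ^ (-1 : ℝ)) ?_
      tendsto_neg_log_sub_one_atTop
    refine tendsto_finsetSum _ fun p _ ↦ Tendsto.const_mul _ ?_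
    have hp0 : ((p : ℕ) : ℝ) ≠ 0 := by exact_mod_cast p.2.ne_zero
    have : ContinuousAt (fun x : ℝ ↦ ((p : ℕ) : ℝ) ^ (-x)) 1 :=
      continuousAt_const.rpow continuousAt_neg (Or.inl hp0)
    exact this.tendsto.mono_left nhdsWithin_le_nhds
  have := tendsto_nhds_unique (h1.congr' ?_) h2
  · simpa using this
  · filter_upwards [self_mem_nhdsWithin] with x hx
    rw [← hG x hx, Finset.sum_div]
    exact Finset.sum_congr rfl fun i _ ↦ (mul_div_assoc _ _ _).symm

/-- If the splitting fields of `g * ∏ i ∈ S, h i` have degree `n * ∏ i ∈ S, d i` over `ℚ` for every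
subset `S` of a finite set `Q`, then there are infinitely many primes modulo which `g` splits and
none of the `h i` does. -/
lemma exists_prime_splits_and_forall_not_splits {ι : Type*} (Q : Finset ι) (d : ι → ℕ)
    (hd : ∀ i ∈ Q, 1 < d i) (g : ℤ[X])
    (hg : g.Monic) (h : ι → ℤ[X]) (hh : ∀ i, (h i).Monic) (n : ℕ) (hn : n ≠ 0)
    (hdeg : ∀ S ⊆ Q, Module.finrank ℚ (splitField (g * ∏ i ∈ S, h i)) = n * ∏ i ∈ S, d i) (N : ℕ) :
    ∃ p : ℕ, p.Prime ∧ N < p ∧ (g.map (Int.castRingHom (ZMod p))).Splits ∧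
      ∀ i ∈ Q, ¬ ((h i).map (Int.castRingHom (ZMod p))).Splits := by
  classical
  by_contra! hcon
  have key := sum_div_finrank_splitField_eq_zero Q.powerset (fun S ↦ g * ∏ i ∈ S, h i)
    (fun S ↦ hg.mul (monic_prod_of_monic _ _ fun i _ ↦ hh i)) (fun S ↦ (-1) ^ S.card)
    ⟨N, fun p hp hNp ↦ ?_⟩
  · have : ∑ S ∈ Q.powerset, (-1 : ℝ) ^ S.card / Module.finrank ℚ (splitField (g * ∏ i ∈ S, h i)) =
        (1 / n) * ∏ i ∈ Q, (1 - 1 / (d i : ℝ)) := by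
      rw [Finset.prod_sub, Finset.mul_sum]
      refine Finset.sum_congr rfl fun S hS ↦ ?_
      rw [hdeg S (Finset.mem_powerset.1 hS)]
      push_cast
      rw [Finset.prod_div_distrib, Finset.prod_const_one, Finset.prod_const_one, mul_one]
      ring
    rw [this] at key
    refine absurd key (mul_ne_zero (by positivity) (Finset.prod_ne_zero_iff.2 fun i hi ↦ ?_))
    have h1 : (1 : ℝ) < d i := by exact_mod_cast hd i hi
    rw [sub_ne_zero, ne_eq, eq_div_iff (by positivity)]
    linarith
  · have : Fact p.Prime := ⟨hp⟩
    let I : ℤ[X] → ℝ := fun f ↦ if (f.map (Int.castRingHom (ZMod p))).Splits then 1 else 0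
    have hI : ∀ S : Finset ι, I (g * ∏ i ∈ S, h i) = I g * ∏ i ∈ S, I (h i) := by
      intro S
      simp only [I]
      rw [Finset.prod_ite_zero, Finset.prod_const_one, ite_zero_mul_ite_zero, one_mul,
          Polynomial.map_mul,
        splits_mul (hg.map _).ne_zero ((monic_prod_of_monic _ _ fun i _ ↦ hh i).map _).ne_zero,
        Polynomial.map_prod, splits_prod_iff fun i _ ↦ ((hh i).map _).ne_zero]
      congr
    change ∑ S ∈ Q.powerset, (-1) ^ S.card * I (g * ∏ i ∈ S, h i) = 0
    simp_rw [hI, mul_left_comm _ (I g)]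
    have hprod : ∑ S ∈ Q.powerset, (-1) ^ S.card * ∏ i ∈ S, I (h i) = ∏ i ∈ Q, (1 - I (h i)) := by
      simp [Finset.prod_sub]
    rw [← Finset.mul_sum, hprod, mul_eq_zero]
    by_cases hgs : (g.map (Int.castRingHom (ZMod p))).Splits
    · obtain ⟨i, hi, hs⟩ := hcon p hp hNp hgs
      exact Or.inr (Finset.prod_eq_zero hi (by simp [I, hs]))
    · exact Or.inl (by simp [I, hgs])

end Combination

section KummerTheory

open scoped Polynomial

/-- In a Galois extension `E` of a field `K` containing the `k`-th roots of unity of `E`, generated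
by elements whose `k`-th powers lie in `K`, every element with `k`-th power in `K` agrees up to `K`
with a monomial in the generators. -/
lemma exists_mem_closure_div_mem_range {K E : Type*} [Field K] [CharZero K] [Field E] [Algebra K E]
    [FiniteDimensional K E] [IsGalois K E] {k : ℕ}
    (hroot : ∀ z : E, z ^ k = 1 → z ∈ Set.range (algebraMap K E)) {X : Set E}
    (hX : ∀ x ∈ X, x ^ k ∈ (algebraMap K E).range) (hgen : Algebra.adjoin K X = ⊤)
    {y : E} (hy0 : y ≠ 0) (hy : y ^ k ∈ (algebraMap K E).range) :
    ∃ m ∈ Submonoid.closure X, m ≠ 0 ∧ m / y ∈ (algebraMap K E).range := by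
  have hpow : ∀ m ∈ Submonoid.closure X, m ^ k ∈ (algebraMap K E).range := by
    intro m hm
    induction hm using Submonoid.closure_induction with
    | mem x hx => exact hX x hx
    | one => rw [one_pow]; exact one_mem _
    | mul x z _ _ hx hz => rw [mul_pow]; exact mul_mem hx hz
  have htrace : ∀ u : E, u ^ k ∈ (algebraMap K E).range → Algebra.trace K E u ≠ 0 →
      u ∈ (algebraMap K E).range := by
    rintro u ⟨q, hq⟩ hu
    refine (IsGalois.mem_range_algebraMap_iff_fixed u).2 fun σ ↦ ?_
    have hu0 : u ≠ 0 := by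
      rintro rfl
      exact hu (map_zero _)
    obtain ⟨z, hz⟩ := hroot (σ u / u) (by
      rw [div_pow, ← map_pow, ← hq, AlgEquiv.commutes, div_self]
      rw [hq]
      exact pow_ne_zero _ hu0)
    rw [eq_div_iff hu0, ← Algebra.smul_def] at hz
    have h1 : Algebra.trace K E (σ u) = Algebra.trace K E u := Algebra.trace_eq_of_algEquiv σ u
    rw [← hz, map_smul, smul_eq_mul, mul_eq_right₀ hu] at h1
    rw [← hz, h1, one_smul]
  let φ : E →ₗ[K] K := Algebra.trace K E ∘ₗ LinearMap.mulLeft K y⁻¹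
  have hφ : φ y ≠ 0 := by
    simp only [φ, LinearMap.comp_apply, LinearMap.mulLeft_apply, inv_mul_cancel₀ hy0]
    rw [← map_one (algebraMap K E), Algebra.trace_algebraMap]
    simpa using Module.finrank_pos.ne'
  obtain ⟨m, hm, hφm⟩ : ∃ m ∈ Submonoid.closure X, φ m ≠ 0 := by
    by_contra! h
    refine hφ ?_
    have hspan : Submodule.span K (Submonoid.closure X : Set E) ≤ LinearMap.ker φ :=
      Submodule.span_le.2 fun m hm ↦ h m hm
    rw [← Algebra.adjoin_eq_span, hgen] at hspan
    exact hspan (Submodule.mem_top)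
  have hm0 : m ≠ 0 := by
    rintro rfl
    exact hφm (map_zero _)
  refine ⟨m, hm, hm0, htrace _ ?_ ?_⟩
  · obtain ⟨a, ha⟩ := hpow m hm
    obtain ⟨b, hb⟩ := hy
    exact ⟨a / b, by rw [map_div₀, ha, hb, div_pow]⟩
  · simpa [φ, div_eq_inv_mul] using hφm

/-- If a rational number is an odd `k`-th power in an abelian number field containing the `k`-th
roots of unity, then it is a `k`-th power in `ℚ`. -/
lemma exists_rat_pow_eq {K : Type*} [Field K] [NumberField K] [IsGalois ℚ K]
    (hcomm : ∀ σ τ : Gal(K/ℚ), σ * τ = τ * σ) {k : ℕ} (hk : Odd k) {ζ : K}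
    (hζ : IsPrimitiveRoot ζ k) {u : K} {q : ℚ} (hu : u ^ k = algebraMap ℚ K q) :
    ∃ r : ℚ, r ^ k = q := by
  have : NeZero k := ⟨hk.pos.ne'⟩
  obtain ⟨φ⟩ : Nonempty (K →+* ℂ) := inferInstance
  have hinj : Function.Injective φ := φ.injective
  obtain ⟨r, hr⟩ : ∃ r : ℝ, r ^ k = q := by
    rcases le_total 0 (q : ℝ) with h | h
    · exact ⟨(q : ℝ) ^ (k : ℝ)⁻¹, Real.rpow_inv_natCast_pow h (NeZero.ne k)⟩
    · refine ⟨-(-(q : ℝ)) ^ (k : ℝ)⁻¹, ?_⟩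
      rw [hk.neg_pow, Real.rpow_inv_natCast_pow (neg_nonneg.2 h) (NeZero.ne k), neg_neg]
  obtain ⟨v, hv⟩ : ∃ v : K, φ v = r := by
    rcases eq_or_ne u 0 with rfl | hu0
    · refine ⟨0, ?_⟩
      rw [zero_pow (NeZero.ne k), eq_comm, map_eq_zero] at hu
      rw [hu, Rat.cast_zero, pow_eq_zero_iff (NeZero.ne k)] at hr
      simp [hr]
    · have hφu : φ u ≠ 0 := (map_ne_zero φ).2 hu0
      have : ((r : ℂ) / φ u) ^ k = 1 := by
        rw [div_pow, ← map_pow, hu, ← Complex.ofReal_pow, hr]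
        rw [eq_ratCast, map_ratCast, Complex.ofReal_ratCast, div_self]
        intro h0
        rw [Rat.cast_eq_zero] at h0
        rw [h0, map_zero, pow_eq_zero_iff (NeZero.ne k)] at hu
        exact hu0 hu
      obtain ⟨j, -, hj⟩ := (hζ.map_of_injective hinj).eq_pow_of_pow_eq_one this
      exact ⟨ζ ^ j * u, by rw [map_mul, map_pow, hj, div_mul_cancel₀ _ hφu]⟩
  obtain ⟨τ, hτ⟩ := NumberField.ComplexEmbedding.exists_comp_symm_eq_of_comp_eq (k := ℚ) φ
    ((starRingEnd ℂ).comp φ) (RingHom.ext_rat _ _)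
  have hτ' : ∀ x, φ (τ.symm x) = starRingEnd ℂ (φ x) := fun x ↦ DFunLike.congr_fun hτ x
  have hτv : τ.symm v = v := hinj (by rw [hτ', hv, Complex.conj_ofReal])
  have hvk : v ^ k = algebraMap ℚ K q := hinj (by
    rw [map_pow, hv, ← Complex.ofReal_pow, hr]
    simp)
  have hfix : ∀ σ : Gal(K/ℚ), σ v = v := by
    intro σ
    have h1 : starRingEnd ℂ (φ (σ v)) = φ (σ v) := by
      rw [← hτ']
      have := DFunLike.congr_fun (hcomm τ.symm σ) v
      rw [AlgEquiv.mul_apply, AlgEquiv.mul_apply, hτv] at this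
      rw [this]
    obtain ⟨s, hs⟩ := Complex.conj_eq_iff_real.1 h1
    have h2 : s ^ k = r ^ k := by
      apply Complex.ofReal_injective
      rw [Complex.ofReal_pow, Complex.ofReal_pow, ← hs, ← hv, ← map_pow, ← map_pow, ← map_pow, hvk,
        AlgEquiv.commutes]
    apply hinj
    rw [hs, hk.pow_injective h2, hv]
  obtain ⟨t, rfl⟩ := (IsGalois.mem_range_algebraMap_iff_fixed v).2 hfix
  exact ⟨t, (algebraMap ℚ K).injective (by rw [map_pow, hvk])⟩

lemma exists_mem_closure_pow_eq {E : Type*} [Field E] [NumberField E] [IsGalois ℚ E]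
    {k : ℕ} (hk : Odd k) {ζ : E} (hζ : IsPrimitiveRoot ζ k) {X : Set E}
    (hX : ∀ x ∈ X, x ^ k ∈ (algebraMap ℚ E).range) (hgen : Algebra.adjoin ℚ X = ⊤)
    {y : E} (hy0 : y ≠ 0) (hy : y ^ k ∈ (algebraMap ℚ E).range) :
    ∃ m ∈ Submonoid.closure X, m ≠ 0 ∧ ∃ r : ℚ, m ^ k = algebraMap ℚ E r ^ k * y ^ k := by
  have : NeZero k := ⟨hk.pos.ne'⟩
  have hle : (algebraMap ℚ E).range ≤ (algebraMap (IntermediateField.adjoin ℚ {ζ}) E).range := by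
    rintro _ ⟨x, rfl⟩
    exact ⟨algebraMap ℚ _ x, rfl⟩
  let K := IntermediateField.adjoin ℚ {ζ}
  have hζK : ζ ∈ K := IntermediateField.mem_adjoin_simple_self ℚ ζ
  obtain ⟨m, hm, hm0, u, hu⟩ := exists_mem_closure_div_mem_range (K := K) (E := E) (k := k)
    (fun z hz ↦ by
      obtain ⟨j, -, rfl⟩ := hζ.eq_pow_of_pow_eq_one hz
      exact ⟨⟨ζ ^ j, pow_mem hζK j⟩, rfl⟩)
    (fun x hx ↦ hle (hX x hx)) (by
      refine top_le_iff.1 fun x _ ↦ ?_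
      have : Algebra.adjoin ℚ X ≤ (Algebra.adjoin K X).restrictScalars ℚ :=
        Algebra.adjoin_le Algebra.subset_adjoin
      exact this (hgen ▸ Algebra.mem_top)) hy0 (hle hy)
  refine ⟨m, hm, hm0, ?_⟩
  have : IsCyclotomicExtension {k} ℚ K := hζ.intermediateField_adjoin_isCyclotomicExtension ℚ
  have : IsGalois ℚ K := IsCyclotomicExtension.isGalois {k} ℚ K
  have hcomm := IsCyclotomicExtension.isMulCommutative {k} ℚ K
  have hmk : ∀ m ∈ Submonoid.closure X, m ^ k ∈ (algebraMap ℚ E).range := by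
    intro m hm
    induction hm using Submonoid.closure_induction with
    | mem x hx => exact hX x hx
    | one => rw [one_pow]; exact one_mem _
    | mul x z _ _ hx hz => rw [mul_pow]; exact mul_mem hx hz
  obtain ⟨q, hq⟩ : (m / y) ^ k ∈ (algebraMap ℚ E).range := by
    obtain ⟨a, ha⟩ := hmk m hm
    obtain ⟨b, hb⟩ := hy
    exact ⟨a / b, by rw [map_div₀, ha, hb, div_pow]⟩
  obtain ⟨r, rfl⟩ := exists_rat_pow_eq (K := K) (fun σ τ ↦ hcomm.is_comm.comm σ τ) hk
    (ζ := ⟨ζ, hζK⟩) (IsPrimitiveRoot.coe_submonoidClass_iff.1 hζ) (u := u) (q := q) (by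
      apply (algebraMap K E).injective
      rw [map_pow, hu, ← hq]
      rfl)
  refine ⟨r, ?_⟩
  rw [← map_pow, hq, div_pow, div_mul_cancel₀]
  exact pow_ne_zero _ hy0

end KummerTheory
section KummerDegree

open Polynomial

lemma dvd_mul_of_pow_eq {E : Type*} [Field E] [NumberField E] [IsGalois ℚ E]
    {k : ℕ} (hk : Odd k) {ζ : E} (hζ : IsPrimitiveRoot ζ k) {ψ : ℚ → ℤ}
    (hψ : ∀ x y, x ≠ 0 → y ≠ 0 → ψ (x * y) = ψ x + ψ y) {D : ℤ} {X : Set E}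
    (hX : ∀ x ∈ X, ∃ q : ℚ, q ≠ 0 ∧ x ^ k = algebraMap ℚ E q ∧ (k : ℤ) ∣ D * ψ q)
    (hgen : Algebra.adjoin ℚ X = ⊤) {y : E} {q : ℚ} (hq : q ≠ 0)
    (hy : y ^ k = algebraMap ℚ E q) : (k : ℤ) ∣ D * ψ q := by
  have hψ1 : ψ 1 = 0 := by simpa using hψ 1 1 one_ne_zero one_ne_zero
  have hψpow : ∀ (x : ℚ) (n : ℕ), x ≠ 0 → ψ (x ^ n) = n * ψ x := by
    intro x n hx
    induction n with
    | zero => simp [hψ1]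
    | succ n ih => rw [pow_succ, hψ _ _ (pow_ne_zero n hx) hx, ih]; push_cast; ring
  have hcl : ∀ x ∈ Submonoid.closure X,
      ∃ q : ℚ, q ≠ 0 ∧ x ^ k = algebraMap ℚ E q ∧ (k : ℤ) ∣ D * ψ q := by
    intro x hx
    induction hx using Submonoid.closure_induction with
    | mem x hx => exact hX x hx
    | one => exact ⟨1, one_ne_zero, by simp, by simp [hψ1]⟩
    | mul x z _ _ hx hz =>
      obtain ⟨a, ha, hxa, hda⟩ := hx
      obtain ⟨b, hb, hzb, hdb⟩ := hz
      refine ⟨a * b, mul_ne_zero ha hb, by rw [mul_pow, hxa, hzb, map_mul], ?_⟩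
      rw [hψ a b ha hb, mul_add]
      exact dvd_add hda hdb
  have hy0 : y ≠ 0 := by
    rintro rfl
    rw [zero_pow hk.pos.ne', eq_comm, map_eq_zero] at hy
    exact hq hy
  obtain ⟨m, hm, hm0, r, hr⟩ := exists_mem_closure_pow_eq hk hζ (X := X)
    (fun x hx ↦ by
      obtain ⟨b, -, hb, -⟩ := hX x hx
      exact ⟨b, hb.symm⟩) hgen hy0 ⟨q, hy.symm⟩
  obtain ⟨b, hb, hmb, hdb⟩ := hcl m hm
  rw [hmb, hy, ← map_pow, ← map_mul] at hr
  replace hr := (algebraMap ℚ E).injective hr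
  have hr0 : r ≠ 0 := by
    rintro rfl
    rw [zero_pow hk.pos.ne', zero_mul] at hr
    exact hb hr
  rw [hr, hψ _ _ (pow_ne_zero k hr0) hq, hψpow r k hr0, mul_add] at hdb
  exact (dvd_add_right ⟨D * ψ r, by ring⟩).1 hdb

/-- The polynomial `(X ^ k - 1) * ∏ i, (X ^ k - a i)`. -/
noncomputable def kummerPoly {ι : Type*} [Fintype ι] (k : ℕ) (a : ι → ℤ) : ℤ[X] :=
  (X ^ k - 1) * ∏ i, (X ^ k - C (a i))

variable {ι : Type*} [Fintype ι] {k : ℕ} {a : ι → ℤ} {c : ℤ} {S : Finset Nat.Primes}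

lemma monic_kummerPoly (hk : k ≠ 0) : (kummerPoly k a).Monic := by
  refine Monic.mul ?_ (monic_prod_of_monic _ _ fun i _ ↦ monic_X_pow_sub_C _ hk)
  simpa using monic_X_pow_sub_C (1 : ℤ) hk

lemma monic_kummerPoly_mul (hk : k ≠ 0) :
    (kummerPoly k a * ∏ ℓ ∈ S, (X ^ (ℓ : ℕ) - C c)).Monic :=
  (monic_kummerPoly hk).mul (monic_prod_of_monic _ _ fun ℓ _ ↦ monic_X_pow_sub_C _ ℓ.2.ne_zero)

lemma mem_rootSet_kummerPoly_mul {A : Type*} [Field A] [Algebra ℚ A] (hk : k ≠ 0) {x : A} :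
    x ∈ ((kummerPoly k a * ∏ ℓ ∈ S, (X ^ (ℓ : ℕ) - C c)).map (algebraMap ℤ ℚ)).rootSet A ↔
      (x ^ k = 1 ∨ ∃ i, x ^ k = a i) ∨ ∃ ℓ ∈ S, x ^ (ℓ : ℕ) = c := by
  rw [mem_rootSet_of_ne ((monic_kummerPoly_mul hk).map _).ne_zero, aeval_map_algebraMap]
  simp [kummerPoly, Finset.prod_eq_zero_iff, sub_eq_zero]

lemma mem_splitField_kummerPoly_mul (hk : k ≠ 0) {x : ℂ}
    (hx : (x ^ k = 1 ∨ ∃ i, x ^ k = a i) ∨ ∃ ℓ ∈ S, x ^ (ℓ : ℕ) = c) :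
    x ∈ splitField (kummerPoly k a * ∏ ℓ ∈ S, (X ^ (ℓ : ℕ) - C c)) :=
  IntermediateField.subset_adjoin _ _ ((mem_rootSet_kummerPoly_mul hk).2 hx)

lemma mem_of_pow_eq_of_splitField (hk : Odd k) (ha : ∀ i, a i ≠ 0) (hc : c ≠ 0) {ψ : ℚ → ℤ}
    (hψ : ∀ x y, x ≠ 0 → y ≠ 0 → ψ (x * y) = ψ x + ψ y) (hψa : ∀ i, ψ (a i) = 0) (hψc : ψ c = 1)
    (hS : ∀ ℓ ∈ S, (ℓ : ℕ) ∣ k) {ℓ : Nat.Primes} (hℓ : (ℓ : ℕ) ∣ k)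
    {y : splitField (kummerPoly k a * ∏ ℓ ∈ S, (X ^ (ℓ : ℕ) - C c))} (hy : y ^ (ℓ : ℕ) = c) :
    ℓ ∈ S := by
  have hk0 : k ≠ 0 := hk.pos.ne'
  have hψ1 : ψ 1 = 0 := by simpa using hψ 1 1 one_ne_zero one_ne_zero
  have hc' : (c : ℚ) ≠ 0 := by exact_mod_cast hc
  have hψpow : ∀ n : ℕ, ψ ((c : ℚ) ^ n) = n := by
    intro n
    induction n with
    | zero => simp [hψ1]
    | succ n ih => rw [pow_succ, hψ _ _ (pow_ne_zero n hc') hc', ih, hψc]; push_cast; ring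
  have hζ := Complex.isPrimitiveRoot_exp k hk0
  have hmem := mem_splitField_kummerPoly_mul (a := a) (c := c) (S := S) hk0
    (Or.inl (Or.inl hζ.pow_eq_one))
  have key := dvd_mul_of_pow_eq (D := ((∏ ℓ ∈ S, (ℓ : ℕ) : ℕ) : ℤ)) (q := (c : ℚ) ^ (k / ℓ))
    (y := y) (ψ := ψ) hk (ζ := ⟨_, hmem⟩) (IsPrimitiveRoot.coe_submonoidClass_iff.1 hζ) hψ ?_
    (IsSplittingField.adjoin_rootSet
      (splitField (kummerPoly k a * ∏ ℓ ∈ S, (X ^ (ℓ : ℕ) - C c)))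
      ((kummerPoly k a * ∏ ℓ ∈ S, (X ^ (ℓ : ℕ) - C c)).map (algebraMap ℤ ℚ)))
    (pow_ne_zero _ hc') ?_
  · rw [hψpow] at key
    obtain ⟨d, hd⟩ := hℓ
    rw [hd, Nat.mul_div_cancel_left _ ℓ.2.pos, ← Nat.cast_mul, Int.natCast_dvd_natCast] at key
    have hd0 : d ≠ 0 := by
      rintro rfl
      exact hk0 hd
    have := Nat.dvd_of_mul_dvd_mul_right (Nat.pos_of_ne_zero hd0) key
    obtain ⟨q, hq, hdvd⟩ := (Prime.dvd_finsetProd_iff ℓ.2.prime _).1 this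
    rwa [Subtype.ext ((Nat.prime_dvd_prime_iff_eq ℓ.2 q.2).1 hdvd)]
  · intro x hx
    rcases (mem_rootSet_kummerPoly_mul hk0).1 hx with (h | ⟨i, h⟩) | ⟨q, hq, h⟩
    · exact ⟨1, one_ne_zero, by simp [h], by simp [hψ1]⟩
    · exact ⟨a i, by exact_mod_cast ha i, by simp [h], by simp [hψa]⟩
    · refine ⟨(c : ℚ) ^ (k / q), pow_ne_zero _ hc', ?_, ?_⟩
      · rw [map_pow, map_intCast, ← h, ← pow_mul, Nat.mul_div_cancel' (hS q hq)]
      · rw [hψpow, ← Nat.cast_mul, Int.natCast_dvd_natCast]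
        have := Nat.mul_dvd_mul (Finset.dvd_prod_of_mem (fun ℓ : Nat.Primes ↦ (ℓ : ℕ)) hq)
          (dvd_refl (k / q))
        rwa [Nat.mul_div_cancel' (hS q hq)] at this
  · rw [map_pow, map_intCast, ← hy, ← pow_mul, Nat.mul_div_cancel' hℓ]

lemma finrank_splitField_insert [DecidableEq Nat.Primes] (hk : Odd k) (ha : ∀ i, a i ≠ 0)
    (hc : c ≠ 0) {ψ : ℚ → ℤ}
    (hψ : ∀ x y, x ≠ 0 → y ≠ 0 → ψ (x * y) = ψ x + ψ y) (hψa : ∀ i, ψ (a i) = 0) (hψc : ψ c = 1)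
    (hS : ∀ ℓ ∈ S, (ℓ : ℕ) ∣ k) {ℓ : Nat.Primes} (hℓ : (ℓ : ℕ) ∣ k) (hℓS : ℓ ∉ S) :
    Module.finrank ℚ (splitField (kummerPoly k a * ∏ q ∈ insert ℓ S, (X ^ (q : ℕ) - C c))) =
      Module.finrank ℚ (splitField (kummerPoly k a * ∏ q ∈ S, (X ^ (q : ℕ) - C c))) * ℓ := by
  have hk0 : k ≠ 0 := hk.pos.ne'
  set f := kummerPoly k a * ∏ q ∈ S, (X ^ (q : ℕ) - C c) with hf
  set f' := kummerPoly k a * ∏ q ∈ insert ℓ S, (X ^ (q : ℕ) - C c) with hf'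
  obtain ⟨β, hβ⟩ : ∃ β : ℂ, β ^ (ℓ : ℕ) = c := IsAlgClosed.exists_pow_nat_eq _ ℓ.2.pos
  have hβ0 : β ≠ 0 := by
    rintro rfl
    rw [zero_pow ℓ.2.ne_zero, eq_comm, Int.cast_eq_zero] at hβ
    exact hc hβ
  have hirr : Irreducible (X ^ (ℓ : ℕ) - C (c : splitField f)) :=
    X_pow_sub_C_irreducible_of_prime ℓ.2 fun y hy ↦
      hℓS (mem_of_pow_eq_of_splitField hk ha hc hψ hψa hψc hS hℓ hy)
  have hmin : minpoly (splitField f) β = X ^ (ℓ : ℕ) - C (c : splitField f) :=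
    (minpoly.eq_of_irreducible_of_monic hirr (by simp [hβ]) (monic_X_pow_sub_C _ ℓ.2.ne_zero)).symm
  have hβint : IsIntegral (splitField f) β :=
    ⟨_, monic_X_pow_sub_C (c : splitField f) ℓ.2.ne_zero, by
      rw [eval₂_sub, eval₂_X_pow, eval₂_C, hβ, map_intCast, sub_self]⟩
  have hrank : Module.finrank (splitField f) (IntermediateField.adjoin (splitField f) {β}) = ℓ := by
    rw [IntermediateField.adjoin.finrank hβint, hmin, natDegree_X_pow_sub_C]
  have heq : (IntermediateField.adjoin (splitField f) {β}).restrictScalars ℚ = splitField f' := by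
    refine (IntermediateField.adjoin_adjoin_left ℚ
      ((f.map (algebraMap ℤ ℚ)).rootSet ℂ) {β}).trans ?_
    apply le_antisymm
    · rw [IntermediateField.adjoin_le_iff]
      rintro x (hx | rfl)
      · refine mem_splitField_kummerPoly_mul hk0 ?_
        refine ((mem_rootSet_kummerPoly_mul hk0).1 hx).imp_right ?_
        rintro ⟨q, hq, h⟩
        exact ⟨q, Finset.mem_insert_of_mem hq, h⟩
      · exact mem_splitField_kummerPoly_mul hk0 (Or.inr ⟨ℓ, Finset.mem_insert_self _ _, hβ⟩)
    · rw [IntermediateField.adjoin_le_iff]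
      intro x hx
      have hsub : ∀ x : ℂ, ((x ^ k = 1 ∨ ∃ i, x ^ k = a i) ∨ ∃ ℓ ∈ S, x ^ (ℓ : ℕ) = c) →
          x ∈ IntermediateField.adjoin ℚ ((f.map (algebraMap ℤ ℚ)).rootSet ℂ ∪ {β}) :=
        fun x hx ↦ IntermediateField.subset_adjoin _ _
          (Or.inl ((mem_rootSet_kummerPoly_mul hk0).2 hx))
      rcases (mem_rootSet_kummerPoly_mul hk0).1 hx with h | ⟨q, hq, h⟩
      · exact hsub x (Or.inl h)
      · rcases Finset.mem_insert.1 hq with rfl | hq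
        · have h1 : (x / β) ^ k = 1 := by
            obtain ⟨d, hd⟩ := hℓ
            rw [hd, pow_mul, div_pow, h, hβ, div_self (by exact_mod_cast hc), one_pow]
          rw [← div_mul_cancel₀ x hβ0]
          exact mul_mem (hsub _ (Or.inl (Or.inl h1)))
            (IntermediateField.subset_adjoin _ _ (Or.inr rfl))
        · exact hsub x (Or.inr ⟨q, hq, h⟩)
  rw [← heq, ← hrank]
  exact (Module.finrank_mul_finrank ℚ (splitField f)
    (IntermediateField.adjoin (splitField f) {β})).symm

lemma finrank_splitField_kummerPoly_mul (hk : Odd k) (ha : ∀ i, a i ≠ 0) (hc : c ≠ 0) {ψ : ℚ → ℤ}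
    (hψ : ∀ x y, x ≠ 0 → y ≠ 0 → ψ (x * y) = ψ x + ψ y) (hψa : ∀ i, ψ (a i) = 0) (hψc : ψ c = 1)
    (hS : ∀ ℓ ∈ S, (ℓ : ℕ) ∣ k) :
    Module.finrank ℚ (splitField (kummerPoly k a * ∏ q ∈ S, (X ^ (q : ℕ) - C c))) =
      Module.finrank ℚ (splitField (kummerPoly k a)) * ∏ q ∈ S, (q : ℕ) := by
  classical
  induction S using Finset.induction_on with
  | empty => rw [Finset.prod_empty, Finset.prod_empty, mul_one, mul_one]
  | insert ℓ S hℓS ih =>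
    have hS' : ∀ q ∈ S, (q : ℕ) ∣ k := fun q hq ↦ hS q (Finset.mem_insert_of_mem hq)
    rw [finrank_splitField_insert hk ha hc hψ hψa hψc hS' (hS ℓ (Finset.mem_insert_self _ _)) hℓS,
      ih hS', Finset.prod_insert hℓS]
    ring

end KummerDegree

end NumberField

section KummerCharacter

open Polynomial

/-- In a finite cyclic group of order divisible by `k`, an element that is not an `ℓ`-th power for
any prime `ℓ ∣ k` is sent to `1` by some surjective `k`-character. -/
lemma exists_surjective_hom_apply_eq {G : Type*} [CommGroup G] [Finite G] [hG : IsCyclic G] {k : ℕ}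
    (hk : k ∣ Nat.card G) (c : G) (hc : ∀ ℓ : ℕ, ℓ.Prime → ℓ ∣ k → ∀ x : G, x ^ ℓ ≠ c) :
    ∃ χ : G →* Multiplicative (ZMod k), Function.Surjective χ ∧ χ c = Multiplicative.ofAdd 1 := by
  have : NeZero (Nat.card G) := ⟨Nat.card_pos.ne'⟩
  let e := zmodCyclicMulEquiv hG
  let m : ZMod (Nat.card G) := (e.symm c).toAdd
  have hm : ((m.val : ℕ) : ZMod (Nat.card G)) = m := ZMod.natCast_zmod_val m
  have hcop : m.val.Coprime k := by
    refine Nat.Coprime.symm (Nat.coprime_of_dvd fun ℓ hℓ hℓk hℓm ↦ ?_)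
    obtain ⟨d, hd⟩ := hℓm
    refine hc ℓ hℓ hℓk (e (Multiplicative.ofAdd (d : ZMod (Nat.card G)))) ?_
    rw [← map_pow, ← ofAdd_nsmul, nsmul_eq_mul, ← Nat.cast_mul, ← hd, hm, ofAdd_toAdd,
      MulEquiv.apply_symm_apply]
  obtain ⟨v, hv⟩ := (ZMod.isUnit_iff_coprime m.val k).2 hcop
  let φ : ZMod (Nat.card G) →+ ZMod k :=
    (AddMonoidHom.mulLeft (↑v⁻¹ : ZMod k)).comp (ZMod.castHom hk (ZMod k)).toAddMonoidHom
  have hφ : ∀ x, φ x = ↑v⁻¹ * ZMod.castHom hk (ZMod k) x := fun x ↦ rfl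
  refine ⟨φ.toMultiplicative.comp e.symm.toMonoidHom, ?_, ?_⟩
  · intro y
    obtain ⟨x, hx⟩ := ZMod.castHom_surjective hk (v * y.toAdd)
    refine ⟨e (Multiplicative.ofAdd x), ?_⟩
    change Multiplicative.ofAdd (φ (e.symm (e (Multiplicative.ofAdd x))).toAdd) = y
    rw [MulEquiv.symm_apply_apply, toAdd_ofAdd, hφ, hx, Units.inv_mul_cancel_left, ofAdd_toAdd]
  · change Multiplicative.ofAdd (φ m) = _
    rw [hφ, ← hm, map_natCast, ← hv, Units.inv_mul]

lemma exists_isPrimitiveRoot_of_splits {K : Type*} [Field K] {k : ℕ} (hk : (k : K) ≠ 0)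
    (h : (X ^ k - 1 : K[X]).Splits) : ∃ ζ : K, IsPrimitiveRoot ζ k := by
  have : NeZero (k : K) := ⟨hk⟩
  have hk0 : k ≠ 0 := by
    rintro rfl
    exact hk Nat.cast_zero
  have hne : (X ^ k - 1 : K[X]) ≠ 0 := by
    simpa using (monic_X_pow_sub_C (1 : K) hk0).ne_zero
  obtain ⟨ζ, hζ⟩ := (h.of_dvd hne (cyclotomic.dvd_X_pow_sub_one k K)).exists_eval_eq_zero
    (degree_cyclotomic_pos k K (Nat.pos_of_ne_zero hk0)).ne'
  exact ⟨ζ, isRoot_cyclotomic_iff.1 hζ⟩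

lemma exists_isPrimitiveRoot_and_pow_eq_of_splits_kummerPoly {ι : Type*} [Fintype ι] {k : ℕ}
    {a : ι → ℤ} {K : Type*} [Field K] (hk : (k : K) ≠ 0)
    (h : ((kummerPoly k a).map (Int.castRingHom K)).Splits) :
    (∃ ζ : K, IsPrimitiveRoot ζ k) ∧ ∀ i, ∃ x : K, x ^ k = a i := by
  have hk0 : k ≠ 0 := by
    rintro rfl
    exact hk Nat.cast_zero
  have hmap : (kummerPoly k a).map (Int.castRingHom K) =
      (X ^ k - 1) * ∏ i, (X ^ k - C (a i : K)) := by
    simp only [kummerPoly, Polynomial.map_mul, Polynomial.map_prod, Polynomial.map_sub,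
      Polynomial.map_pow, Polynomial.map_X, Polynomial.map_one, Polynomial.map_C,
      Int.coe_castRingHom]
  have hmonic : ∀ i, (X ^ k - C (a i : K)).Monic := fun i ↦ monic_X_pow_sub_C _ hk0
  have hne : (X ^ k - 1 : K[X]) ≠ 0 := by
    simpa using (monic_X_pow_sub_C (1 : K) hk0).ne_zero
  rw [hmap, splits_mul hne (monic_prod_of_monic _ _ fun i _ ↦ hmonic i).ne_zero,
    splits_prod_iff fun i _ ↦ (hmonic i).ne_zero] at h
  refine ⟨exists_isPrimitiveRoot_of_splits hk h.1, fun i ↦ ?_⟩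
  obtain ⟨x, hx⟩ := (h.2 i (Finset.mem_univ i)).exists_eval_eq_zero (by
    rw [degree_X_pow_sub_C (Nat.pos_of_ne_zero hk0)]
    exact_mod_cast hk0)
  exact ⟨x, by simpa [sub_eq_zero] using hx⟩

/-- If `a i ≠ 0` for all `i` and an additive valuation `ψ` vanishes on all `a i` and is `1` on `c`,
then there are arbitrarily large primes `p` modulo which all `a i` are `k`-th powers, and for which
some surjective `k`-character sends `c` to `1`. -/
lemma exists_prime_hom_apply_eq_one {ι : Type*} [Fintype ι] {k : ℕ} (hk : Odd k) {a : ι → ℤ}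
    (ha : ∀ i, a i ≠ 0) {c : ℤ} (hc : c ≠ 0) {ψ : ℚ → ℤ}
    (hψ : ∀ x y, x ≠ 0 → y ≠ 0 → ψ (x * y) = ψ x + ψ y) (hψa : ∀ i, ψ (a i) = 0) (hψc : ψ c = 1)
    (N : ℕ) : ∃ p : ℕ, p.Prime ∧ N < p ∧ (∀ i, ∃ x : ZMod p, x ^ k = a i) ∧
      ∃ χ : (ZMod p)ˣ →* Multiplicative (ZMod k), Function.Surjective χ ∧
        ∀ u : (ZMod p)ˣ, (u : ZMod p) = c → χ u = Multiplicative.ofAdd 1 := by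
  have hk0 : k ≠ 0 := hk.pos.ne'
  obtain ⟨p, hp, hNp, hs, hns⟩ := exists_prime_splits_and_forall_not_splits
    (k.primeFactors.subtype Nat.Prime : Finset Nat.Primes) (fun ℓ ↦ ℓ) (fun ℓ _ ↦ ℓ.2.one_lt)
    (kummerPoly k a) (monic_kummerPoly hk0) (fun ℓ ↦ X ^ (ℓ : ℕ) - C c)
    (fun ℓ ↦ monic_X_pow_sub_C _ ℓ.2.ne_zero) (Module.finrank ℚ (splitField (kummerPoly k a)))
    Module.finrank_pos.ne'
    (fun S hS ↦ finrank_splitField_kummerPoly_mul hk ha hc hψ hψa hψc fun ℓ hℓ ↦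
      Nat.dvd_of_mem_primeFactors (Finset.mem_subtype.1 (hS hℓ))) (max N (max k c.natAbs))
  have : Fact p.Prime := ⟨hp⟩
  simp only [max_lt_iff] at hNp
  obtain ⟨hNp, hkp, hcp⟩ := hNp
  have hkZ : (k : ZMod p) ≠ 0 := by
    rw [Ne, ZMod.natCast_eq_zero_iff]
    exact Nat.not_dvd_of_pos_of_lt hk.pos hkp
  obtain ⟨⟨ζ, hζ⟩, hroot⟩ := exists_isPrimitiveRoot_and_pow_eq_of_splits_kummerPoly hkZ hs
  have hcZ : (c : ZMod p) ≠ 0 := by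
    rw [Ne, ZMod.intCast_zmod_eq_zero_iff_dvd, Int.natCast_dvd]
    exact Nat.not_dvd_of_pos_of_lt (Int.natAbs_pos.2 hc) hcp
  have hcard : k ∣ Nat.card (ZMod p)ˣ := by
    rw [Nat.card_eq_fintype_card, ZMod.card_units, hζ.eq_orderOf]
    exact ZMod.orderOf_dvd_card_sub_one (hζ.ne_zero hk0)
  obtain ⟨χ, hχ, hχc⟩ := exists_surjective_hom_apply_eq hcard (Units.mk0 _ hcZ)
    fun ℓ hℓ hℓk x hx ↦ by
    refine hns ⟨ℓ, hℓ⟩ (Finset.mem_subtype.2 (Nat.mem_primeFactors.2 ⟨hℓ, hℓk, hk0⟩)) ?_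
    obtain ⟨d, hd⟩ := hℓk
    rw [Polynomial.map_sub, Polynomial.map_pow, Polynomial.map_X, Polynomial.map_C, eq_intCast]
    exact X_pow_sub_C_splits_of_isPrimitiveRoot (hζ.pow hk.pos (hd.trans (mul_comm _ _)))
      (by simpa using congrArg Units.val hx)
  refine ⟨p, hp, hNp, hroot, χ, hχ, fun u hu ↦ ?_⟩
  rw [← hχc]
  congr 1
  exact Units.ext hu

/-- A valuation separating a prime `q` from the numbers `P i * q ^ e i`, for `P i` distinct primes
other than `q`. -/
lemma exists_valuation_mul_pow_eq_zero {ι : Type*} [Fintype ι] {P : ι → ℕ} (hP : ∀ i, (P i).Prime)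
    (hPinj : Function.Injective P) {q : ℕ} (hq : q.Prime) (hqP : ∀ i, P i ≠ q) (e : ι → ℕ) :
    ∃ ψ : ℚ → ℤ, (∀ x y, x ≠ 0 → y ≠ 0 → ψ (x * y) = ψ x + ψ y) ∧
      (∀ i, ψ ((P i : ℚ) * (q : ℚ) ^ e i) = 0) ∧ ψ q = 1 := by
  classical
  have hq' : Fact q.Prime := ⟨hq⟩
  have hP' : ∀ i, Fact (P i).Prime := fun i ↦ ⟨hP i⟩
  have hval : ∀ {r s : ℕ}, r.Prime → s.Prime → padicValRat r s = if r = s then 1 else 0 := by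
    intro r s hr hs
    have := Fact.mk hr
    have := Fact.mk hs
    split_ifs with h
    · rw [h, padicValRat.self hs.one_lt]
    · rw [padicValRat.of_nat, padicValNat_primes h, Nat.cast_zero]
  refine ⟨fun x ↦ padicValRat q x - ∑ i, e i * padicValRat (P i) x, fun x y hx hy ↦ ?_,
    fun i ↦ ?_, ?_⟩
  · simp only [padicValRat.mul hx hy, mul_add, Finset.sum_add_distrib]
    ring
  · have h1 : (P i : ℚ) ≠ 0 := by exact_mod_cast (hP i).ne_zero
    have h2 : (q : ℚ) ≠ 0 := by exact_mod_cast hq.ne_zero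
    simp only [padicValRat.mul h1 (pow_ne_zero _ h2), padicValRat.pow, hval hq hq, hval hq (hP i),
      hval (hP _) hq, hval (hP _) (hP i), hqP, (hqP i).symm, hPinj.eq_iff]
    simp
  · simp [hval hq hq, hval (hP _) hq, hqP]

end KummerCharacter

/-- The Kummer–Mills theorem, case (1): `k` odd. For distinct primes
`p₁, …, p_t` and arbitrary prescribed values `b₁, …, b_t ∈ ℤ_k`, there are
infinitely many primes `p` (dividing no `pᵢ`) admitting a surjective
`k`-character `χ : (ℤ_p)ˣ →* ℤ_k` with `χ(pᵢ) = bᵢ` for all `i`. -/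
theorem kummer_mills_odd (k : ℕ) (hk : 0 < k) (hkodd : Odd k)
    (t : ℕ) (P : Fin t → ℕ) (hP : ∀ i, (P i).Prime)
    (hPinj : Function.Injective P) (b : Fin t → ZMod k) :
    {p : ℕ | p.Prime ∧ (∀ i, ¬ p ∣ P i) ∧
      ∃ χ : (ZMod p)ˣ →* Multiplicative (ZMod k), Function.Surjective χ ∧
        ∀ i, ∀ u : (ZMod p)ˣ, (u : ZMod p) = ((P i : ℕ) : ZMod p) →
          χ u = Multiplicative.ofAdd (b i)}.Infinite := by
  classical
  have : NeZero k := ⟨hk.ne'⟩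
  obtain ⟨q, hqP, hq⟩ := Nat.exists_infinite_primes (∑ i, P i + 1)
  have hPq : ∀ i, P i < q := fun i ↦
    (Nat.lt_succ_of_le (Finset.single_le_sum (fun _ _ ↦ Nat.zero_le _)
      (Finset.mem_univ i))).trans_le hqP
  obtain ⟨ψ, hψ, hψa, hψq⟩ := exists_valuation_mul_pow_eq_zero hP hPinj hq (fun i ↦ (hPq i).ne)
    (fun i ↦ k - (b i).val)
  refine Set.infinite_of_forall_exists_gt fun N ↦ ?_
  obtain ⟨p, hp, hNp, hroot, χ, hχ, hχq⟩ := exists_prime_hom_apply_eq_one hkodd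
    (a := fun i ↦ (P i : ℤ) * (q : ℤ) ^ (k - (b i).val)) (c := q)
    (fun i ↦ mul_ne_zero (by exact_mod_cast (hP i).ne_zero)
      (pow_ne_zero _ (by exact_mod_cast hq.ne_zero)))
    (by exact_mod_cast hq.ne_zero) hψ (fun i ↦ by simpa using hψa i) (by simpa using hψq)
    (max N q)
  rw [max_lt_iff] at hNp
  have : Fact p.Prime := ⟨hp⟩
  refine ⟨p, ⟨hp, fun i ↦ Nat.not_dvd_of_pos_of_lt (hP i).pos ((hPq i).trans hNp.2), χ, hχ,
    fun i u hu ↦ ?_⟩, hNp.1⟩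
  have hqZ : (q : ZMod p) ≠ 0 := by
    rw [Ne, ZMod.natCast_eq_zero_iff]
    exact Nat.not_dvd_of_pos_of_lt hq.pos hNp.2
  obtain ⟨x, hx⟩ := hroot i
  let w : (ZMod p)ˣ := Units.mk0 _ hqZ
  have hw : χ w = Multiplicative.ofAdd 1 := hχq w (by simp [w])
  have hx' : x ^ k = ((u * w ^ (k - (b i).val) : (ZMod p)ˣ) : ZMod p) := by
    simp [hx, hu, w]
  have hx0 : x ≠ 0 := by
    rintro rfl
    rw [zero_pow hk.ne'] at hx'
    exact Units.ne_zero _ hx'.symm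
  have hχx : χ (u * w ^ (k - (b i).val)) = 1 := by
    have : Units.mk0 x hx0 ^ k = u * w ^ (k - (b i).val) := Units.ext hx'
    rw [← this, map_pow, ← ofAdd_toAdd (χ _), ← ofAdd_nsmul, nsmul_eq_mul, ZMod.natCast_self,
      zero_mul, ofAdd_zero]
  have hcast : ((k - (b i).val : ℕ) : ZMod k) = -b i := by
    rw [Nat.cast_sub (ZMod.val_lt _).le, ZMod.natCast_self, ZMod.natCast_zmod_val, zero_sub]
  rw [map_mul, map_pow, hw, ← ofAdd_nsmul, nsmul_eq_mul, mul_one, hcast, ofAdd_neg,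
    mul_inv_eq_one] at hχx
  exact hχx
end

section
/- Let k be a positive integer and let A, B ⊆ Z_k be such that Z_k = A + B is a factorization of the additive group Z_k. Let ι: Z_k → Z_{8k} be the injective group homomorphism sending the class of a to the class of 8a. Then Z_{8k} = ι(A) + (ι(B) + {0,1,2,3,4,5,6,7}) is a factorization of the additive group Z_{8k}; in particular, ι(A) is a direct factor of Z_{8k}. -/
open Pointwise

/-- `G = A + B` is a factorization of the additive group `G`: every element has
a unique representation `a + b` with `a ∈ A`, `b ∈ B`. -/
def IsAddFactorization {G : Type*} [AddCommGroup G] (A B : Set G) : Prop :=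
  ∀ g : G, ∃! ab : G × G, ab.1 ∈ A ∧ ab.2 ∈ B ∧ ab.1 + ab.2 = g

/-- A factorization of `G` lifts along an injective homomorphism `f : G →+ H`, given a set `R` of
representatives of the cosets of the range of `f`. -/
lemma IsAddFactorization.image_add {G H : Type*} [AddCommGroup G] [AddCommGroup H] {A B : Set G}
    (hAB : IsAddFactorization A B) {f : G →+ H} (hf : Function.Injective f) {R : Set H}
    (hR : IsAddFactorization (Set.range f) R) : IsAddFactorization (f '' A) (f '' B + R) := by
  intro h
  obtain ⟨⟨_, r⟩, ⟨⟨g, rfl⟩, hr, hgr⟩, hR_unique⟩ := hR h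
  obtain ⟨⟨a, b⟩, ⟨ha, hb, rfl⟩, hAB_unique⟩ := hAB g
  refine ⟨(f a, f b + r), ⟨⟨a, ha, rfl⟩, Set.add_mem_add ⟨b, hb, rfl⟩ hr, ?_⟩, ?_⟩
  · simpa [add_assoc] using hgr
  · rintro ⟨_, _⟩ ⟨⟨a', ha', rfl⟩, ⟨_, ⟨b', hb', rfl⟩, r', hr', rfl⟩, h_eq⟩
    have h_pair := hR_unique (f (a' + b'), r')
      ⟨⟨_, rfl⟩, hr', by simpa [add_assoc] using h_eq⟩
    obtain ⟨h_range, rfl⟩ := Prod.mk.inj h_pair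
    obtain ⟨rfl, rfl⟩ := Prod.mk.inj (hAB_unique (a', b') ⟨ha', hb', hf h_range⟩)
    rfl

/-- The map `a ↦ m * a` from `ℤ_k` to `ℤ_{mk}` is injective. -/
lemma ZMod.injective_of_intCast_eq_mul {m k : ℕ} (hm : m ≠ 0) {f : ZMod k →+ ZMod (m * k)}
    (hf : ∀ a : ℤ, f a = m * (a : ZMod (m * k))) : Function.Injective f := by
  refine (injective_iff_map_eq_zero f).2 fun x hx => ?_
  obtain ⟨a, rfl⟩ := ZMod.intCast_surjective x
  rw [hf] at hx
  have h_dvd : ((m * k : ℕ) : ℤ) ∣ m * a := by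
    rw [← ZMod.intCast_zmod_eq_zero_iff_dvd]
    exact_mod_cast hx
  rw [Nat.cast_mul] at h_dvd
  exact (ZMod.intCast_zmod_eq_zero_iff_dvd a k).2
    ((mul_dvd_mul_iff_left (Int.natCast_ne_zero.2 hm)).1 h_dvd)

/-- The residues `0, …, m - 1` represent the cosets of the subgroup `m ℤ_{mk}` of `ℤ_{mk}`. -/
lemma ZMod.isAddFactorization_range_Iio {m k : ℕ} (hm : m ≠ 0) {f : ZMod k →+ ZMod (m * k)}
    (hf : ∀ a : ℤ, f a = m * (a : ZMod (m * k))) :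
    IsAddFactorization (Set.range f) ((fun r : ℕ => (r : ZMod (m * k))) '' Set.Iio m) := by
  intro x
  obtain ⟨n, rfl⟩ := ZMod.intCast_surjective x
  have hm_int : (m : ℤ) ≠ 0 := Int.natCast_ne_zero.2 hm
  obtain ⟨r, hr⟩ := Int.eq_ofNat_of_zero_le (Int.emod_nonneg n hm_int)
  have h_lt : r < m := by
    have := Int.emod_lt_of_pos n (by omega : (0 : ℤ) < m)
    omega
  have hn : f ((n / m : ℤ) : ZMod k) + (r : ZMod (m * k)) = n := by
    rw [hf]
    have := Int.mul_ediv_add_emod n m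
    rw [hr] at this
    exact_mod_cast congrArg (Int.cast : ℤ → ZMod (m * k)) this
  refine ⟨(_, _), ⟨⟨_, rfl⟩, ⟨r, h_lt, rfl⟩, hn⟩, ?_⟩
  rintro ⟨_, _⟩ ⟨⟨y, rfl⟩, ⟨r', hr', rfl⟩, h_eq⟩
  obtain ⟨a, rfl⟩ := ZMod.intCast_surjective y
  have hr_eq : r' = r := by
    have h_cast : ((m * a + r' : ℤ) : ZMod (m * k)) = n := by
      rw [← h_eq, hf]
      push_cast
      rfl
    rw [ZMod.intCast_eq_intCast_iff, Nat.cast_mul] at h_cast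
    have h_mod : (m * a + r') % (m : ℤ) = n % m := h_cast.of_mul_right _
    rw [Int.mul_add_emod_self_left, hr, Int.emod_eq_of_lt (by omega) (by exact_mod_cast hr')]
      at h_mod
    exact_mod_cast h_mod
  subst hr_eq
  exact Prod.ext (add_right_cancel (h_eq.trans hn.symm)) rfl

/-- If `ℤ_k = A + B` is a factorization and `ι : ℤ_k → ℤ_{8k}` is the injective
homomorphism `a ↦ 8a`, then `ℤ_{8k} = ι(A) + (ι(B) + {0,…,7})` is a
factorization; in particular `ι(A)` is a direct factor of `ℤ_{8k}`. -/
theorem factorization_eight_times (k : ℕ) (hk : 0 < k) (A B : Set (ZMod k))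
    (hAB : IsAddFactorization A B)
    (ι : ZMod k →+ ZMod (8 * k))
    (hι : ∀ a : ℤ, ι (a : ZMod k) = 8 * (a : ZMod (8 * k))) :
    IsAddFactorization (ι '' A)
      ((ι '' B) + ((fun r : ℕ => (r : ZMod (8 * k))) '' (Set.Iio 8))) ∧
    ∃ C : Set (ZMod (8 * k)), IsAddFactorization (ι '' A) C := by
  have h_mul : ∀ a : ℤ, ι (a : ZMod k) = (8 : ℕ) * (a : ZMod (8 * k)) := by exact_mod_cast hι
  have h_fact := hAB.image_add (ZMod.injective_of_intCast_eq_mul (by norm_num) h_mul)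
    (ZMod.isAddFactorization_range_Iio (by norm_num) h_mul)
  exact ⟨h_fact, _, h_fact⟩
end

section
/- Let G and G' be finite abelian groups (written multiplicatively), let φ: G → G' be a group homomorphism, and let M ⊆ G be a subset such that the restriction of φ to M is injective. Suppose B' ⊆ φ(G) is a subset such that φ(G) = φ(M)·B' is a factorization of the image group φ(G). Let B₁ = {g ∈ G : φ(g) ∈ B'}. Then G = M·B₁ is a factorization of G. -/
/-- Every element of `T` has a unique representation `a * b` with `a ∈ A`, `b ∈ B`. -/
def IsMulFactorizationOn {G : Type*} [CommGroup G] (T A B : Set G) : Prop :=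
  ∀ g ∈ T, ∃! ab : G × G, ab.1 ∈ A ∧ ab.2 ∈ B ∧ ab.1 * ab.2 = g

/-- If `φ : G → G'` is a homomorphism injective on `M ⊆ G`, and
`φ(G) = φ(M)·B'` is a factorization of the image, then `G = M·B₁` is a
factorization of `G`, where `B₁ = φ⁻¹(B')`. -/
theorem factorization_pullback {G G' : Type*} [CommGroup G] [CommGroup G']
    [Finite G] [Finite G'] (φ : G →* G') (M : Set G)
    (hinj : Set.InjOn φ M) (B' : Set G') (hB' : B' ⊆ Set.range φ)
    (hfac : IsMulFactorizationOn (Set.range φ) ((φ : G → G') '' M) B') :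
    IsMulFactorizationOn (Set.univ : Set G) M ((φ : G → G') ⁻¹' B') := by
  rintro g -
  obtain ⟨⟨a', b'⟩, ⟨⟨m, hm, rfl⟩, hb, hab⟩, huniq⟩ := hfac (φ g) ⟨g, rfl⟩
  dsimp only at hm hb hab
  refine ⟨(m, m⁻¹ * g), ⟨hm, ?_, mul_inv_cancel_left m g⟩, ?_⟩
  · rw [Set.mem_preimage, map_mul, map_inv, ← hab, inv_mul_cancel_left]
    exact hb
  · rintro ⟨n, b⟩ ⟨hn, hb₁, rfl⟩
    have h := huniq (φ n, φ b) ⟨⟨n, hn, rfl⟩, hb₁, (map_mul φ n b).symm⟩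
    obtain rfl : n = m := hinj hn hm (congrArg Prod.fst h)
    simp
end

section
/- Let M be a finite set of nonzero integers. Suppose there is a prime q such that M splits Z_q. Then there are infinitely many primes p such that M splits Z_p. -/
/-- `M` splits `ℤ_n`: there is a splitter set `S ⊆ ℤ_n` such that every nonzero
element of `ℤ_n` has a unique representation `m * s` with `m ∈ M`, `s ∈ S`,
while `0` has no such representation. -/
def Splits (M : Finset ℤ) (n : ℕ) : Prop :=
  ∃ S : Set (ZMod n),
    (∀ g : ZMod n, g ≠ 0 → ∃! ms : ℤ × ZMod n,
      ms.1 ∈ M ∧ ms.2 ∈ S ∧ (ms.1 : ZMod n) * ms.2 = g) ∧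
    ¬ ∃ m ∈ M, ∃ s ∈ S, (m : ZMod n) * s = 0

open IsDedekindDomain NumberField Filter Topology Asymptotics
open scoped ENNReal

section Euler
variable {R : Type*} [CommRing R] [IsDedekindDomain R]

/-- The nonzero ideals whose prime divisors all lie in `T`. -/
def factoredIdeals (T : Finset (HeightOneSpectrum R)) : Set (Ideal R) :=
  {I | I ≠ ⊥ ∧ ∀ P : HeightOneSpectrum R, P.asIdeal ∣ I → P ∈ T}

lemma factoredIdeals_empty : factoredIdeals (∅ : Finset (HeightOneSpectrum R)) = {1} := by
  ext I
  simp only [factoredIdeals, Set.mem_ofPred_eq, Finset.notMem_empty, imp_false,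
    Set.mem_singleton_iff]
  constructor
  · rintro ⟨h0, h⟩
    by_contra h1
    obtain ⟨m, hm, hle⟩ := Ideal.exists_le_maximal I (by rwa [Ideal.one_eq_top] at h1)
    have hmb : m ≠ ⊥ := by rintro rfl; exact h0 (le_bot_iff.mp hle)
    exact h ⟨m, hm.isPrime, hmb⟩ (Ideal.dvd_iff_le.mpr hle)
  · rintro rfl
    exact ⟨one_ne_zero, fun P hP ↦ P.isPrime.ne_top
      (Ideal.isUnit_iff.mp (isUnit_of_dvd_one hP))⟩

lemma injective_pow_mul_factoredIdeals {T : Finset (HeightOneSpectrum R)}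
    {P : HeightOneSpectrum R} (hP : P ∉ T) :
    Function.Injective (fun x : ℕ × factoredIdeals T ↦ P.asIdeal ^ x.1 * (x.2 : Ideal R)) := by
  have hP0 : P.asIdeal ≠ 0 := P.prime.ne_zero
  have key : ∀ {a b : ℕ} {I I' : Ideal R}, I' ∈ factoredIdeals T →
      P.asIdeal ^ a * I = P.asIdeal ^ b * I' → a ≤ b := by
    intro a b I I' hI' h
    by_contra! hlt
    obtain ⟨c, rfl⟩ := Nat.exists_eq_add_of_lt hlt
    rw [add_assoc, pow_add, mul_assoc, mul_right_inj' (pow_ne_zero _ hP0)] at h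
    exact hP (hI'.2 P (h ▸ (dvd_pow_self _ (by lia)).mul_right _))
  rintro ⟨e, J⟩ ⟨e', J'⟩ h
  simp only at h
  obtain rfl := le_antisymm (key J'.2 h) (key J.2 h.symm)
  rw [mul_right_inj' (pow_ne_zero _ hP0)] at h
  rw [Subtype.ext h]

lemma range_pow_mul_factoredIdeals [DecidableEq (HeightOneSpectrum R)]
    (T : Finset (HeightOneSpectrum R)) (P : HeightOneSpectrum R) :
    Set.range (fun x : ℕ × factoredIdeals T ↦ P.asIdeal ^ x.1 * (x.2 : Ideal R)) =
      factoredIdeals (insert P T) := by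
  have hPp : Prime P.asIdeal := P.prime
  ext I
  constructor
  · rintro ⟨⟨e, J, hJ0, hJ⟩, rfl⟩
    refine ⟨mul_ne_zero (pow_ne_zero _ hPp.ne_zero) hJ0, fun Q hQ ↦ ?_⟩
    rcases Q.prime.dvd_or_dvd hQ with h | h
    · have h2 := Q.prime.associated_of_dvd hPp (Q.prime.dvd_of_dvd_pow h)
      rw [associated_iff_eq] at h2
      exact Finset.mem_insert.mpr (Or.inl (HeightOneSpectrum.ext h2))
    · exact Finset.mem_insert_of_mem (hJ Q h)
  · rintro ⟨hI0, hI⟩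
    obtain ⟨J, hJe, hJ⟩ :=
      (FiniteMultiplicity.of_prime_left hPp hI0).exists_eq_pow_mul_and_not_dvd
    refine ⟨⟨_, J, fun h ↦ hI0 ?_, fun Q hQ ↦ ?_⟩, hJe.symm⟩
    · rw [hJe, h]; exact mul_zero _
    · rcases Finset.mem_insert.mp (hI Q (hJe ▸ hQ.mul_left _)) with rfl | h
      · exact absurd hQ hJ
      · exact h

lemma tsum_factoredIdeals (w : Ideal R →* ℝ≥0∞) (T : Finset (HeightOneSpectrum R)) :
    ∑' I : factoredIdeals T, w I = ∏ P ∈ T, (1 - w P.asIdeal)⁻¹ := by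
  classical
  induction T using Finset.induction_on with
  | empty => rw [factoredIdeals_empty, tsum_singleton]; exact map_one w
  | insert P T hP ih =>
    rw [Finset.prod_insert hP, ← ih, ← range_pow_mul_factoredIdeals,
      tsum_range _ (injective_pow_mul_factoredIdeals hP)]
    simp only [map_mul, map_pow]
    rw [ENNReal.tsum_prod', ← ENNReal.tsum_geometric, ← ENNReal.tsum_mul_right]
    simp only [ENNReal.tsum_mul_left]

lemma prod_le_tsum_ideal (w : Ideal R →* ℝ≥0∞) (T : Finset (HeightOneSpectrum R)) :
    ∏ P ∈ T, (1 - w P.asIdeal)⁻¹ ≤ ∑' I, w I := by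
  rw [← tsum_factoredIdeals]
  exact ENNReal.tsum_comp_le_tsum_of_injective Subtype.val_injective _

lemma tsum_ideal_le (w : Ideal R →* ℝ≥0∞) (h0 : w ⊥ = 0) {B : ℝ≥0∞}
    (hB : ∀ T : Finset (HeightOneSpectrum R), ∏ P ∈ T, (1 - w P.asIdeal)⁻¹ ≤ B) :
    ∑' I, w I ≤ B := by
  classical
  rw [ENNReal.tsum_eq_iSup_sum]
  refine iSup_le fun U ↦ ?_
  have hfin : ∀ I ∈ U.erase ⊥, {P : HeightOneSpectrum R | P.asIdeal ∣ I}.Finite := fun I hI ↦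
    Ideal.finite_factors (Finset.ne_of_mem_erase hI)
  set T : Finset (HeightOneSpectrum R) :=
    (Set.Finite.biUnion (U.erase ⊥).finite_toSet hfin).toFinset with hT
  refine le_trans ?_ (hB T)
  rw [← tsum_factoredIdeals, ← Finset.sum_erase U h0]
  rw [tsum_subtype (factoredIdeals T) w]
  refine le_trans (Finset.sum_le_sum fun I hI ↦ ?_) (ENNReal.sum_le_tsum (U.erase ⊥))
  rw [Set.indicator_of_mem]
  refine ⟨Finset.ne_of_mem_erase hI, fun P hP ↦ ?_⟩
  rw [hT, Set.Finite.mem_toFinset]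
  exact Set.mem_biUnion hI hP

end Euler

section Zeta
variable (F : Type*) [Field F] [NumberField F]

/-- The completely multiplicative weight `I ↦ N(I) ^ (-s)` on ideals. -/
noncomputable def normWeight (s : ℝ) : Ideal (𝓞 F) →* ℝ≥0∞ where
  toFun I := ENNReal.ofReal ((Ideal.absNorm I : ℝ) ^ (-s))
  map_one' := by simp
  map_mul' I J := by
    rw [map_mul, Nat.cast_mul, Real.mul_rpow (by positivity) (by positivity),
      ENNReal.ofReal_mul (by positivity)]

variable {F}

lemma normWeight_apply (s : ℝ) (I : Ideal (𝓞 F)) :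
    normWeight F s I = ENNReal.ofReal ((Ideal.absNorm I : ℝ) ^ (-s)) := rfl

lemma two_le_absNorm (P : HeightOneSpectrum (𝓞 F)) : (2 : ℝ) ≤ Ideal.absNorm P.asIdeal := by
  have h0 : Ideal.absNorm P.asIdeal ≠ 0 := fun h ↦ P.ne_bot (Ideal.absNorm_eq_zero_iff.mp h)
  have h1 : Ideal.absNorm P.asIdeal ≠ 1 := fun h ↦ P.isPrime.ne_top (Ideal.absNorm_eq_one_iff.mp h)
  exact_mod_cast (by lia : 2 ≤ Ideal.absNorm P.asIdeal)

lemma absNorm_rpow_le_half (P : HeightOneSpectrum (𝓞 F)) {s : ℝ} (hs : 1 ≤ s) :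
    (Ideal.absNorm P.asIdeal : ℝ) ^ (-s) ≤ 1 / 2 := by
  have h2 := two_le_absNorm P
  calc (Ideal.absNorm P.asIdeal : ℝ) ^ (-s) ≤ (Ideal.absNorm P.asIdeal : ℝ) ^ (-1 : ℝ) :=
        Real.rpow_le_rpow_of_exponent_le (by linarith) (by linarith)
    _ = (Ideal.absNorm P.asIdeal : ℝ)⁻¹ := Real.rpow_neg_one _
    _ ≤ 1 / 2 := by rw [one_div]; exact inv_anti₀ (by norm_num) h2

variable (F) in
/-- The Dedekind zeta function at a real point, as the sum of its defining Dirichlet series. -/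
lemma tsum_normWeight_eventually :
    ∃ z : ℝ → ℝ, (∀ᶠ s in 𝓝[>] 1, ∑' I, normWeight F s I = ENNReal.ofReal (z s)) ∧
      Tendsto (fun s ↦ (s - 1) * z s) (𝓝[>] 1) (𝓝 (dedekindZeta_residue F)) := by
  set a : ℕ → ℕ := fun n ↦ Nat.card {I : Ideal (𝓞 F) // Ideal.absNorm I = n}
  refine ⟨fun s ↦ (dedekindZeta F s).re, ?_, ?_⟩
  · have hne : ∀ᶠ s : ℝ in 𝓝[>] 1, ((s : ℂ) - 1) * dedekindZeta F s ≠ 0 :=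
      (tendsto_sub_one_mul_dedekindZeta_nhdsGT F).eventually_ne
        (by exact_mod_cast dedekindZeta_residue_ne_zero F)
    filter_upwards [hne, self_mem_nhdsWithin] with s hs hs1
    have hs1 : 1 < s := hs1
    have hsum : LSeriesSummable (fun n ↦ (a n : ℂ)) s := by
      by_contra h
      exact hs (by rw [dedekindZeta, LSeries, tsum_eq_zero_of_not_summable h, mul_zero])
    have hterm : ∀ n, LSeries.term (fun n ↦ (a n : ℂ)) s n =
        ((a n * (n : ℝ) ^ (-s) : ℝ) : ℂ) := by
      intro n
      rcases eq_or_ne n 0 with rfl | hn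
      · simp [Real.zero_rpow (by linarith : -s ≠ 0)]
      · rw [LSeries.term_of_ne_zero hn, Real.rpow_neg (by positivity)]
        push_cast
        rw [Complex.ofReal_cpow (by positivity), div_eq_mul_inv]
        simp
    have hsumR : Summable fun n : ℕ ↦ (a n * (n : ℝ) ^ (-s) : ℝ) := by
      have := hsum
      rw [LSeriesSummable] at this
      simp_rw [funext hterm] at this
      exact_mod_cast this
    have hz : (dedekindZeta F s).re = ∑' n : ℕ, (a n * (n : ℝ) ^ (-s) : ℝ) := by
      have : dedekindZeta F s = ∑' n : ℕ, ((a n * (n : ℝ) ^ (-s) : ℝ) : ℂ) := by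
        rw [dedekindZeta, LSeries]; exact tsum_congr hterm
      rw [this, ← Complex.ofReal_tsum, Complex.ofReal_re]
    rw [hz, ENNReal.ofReal_tsum_of_nonneg (fun n ↦ by positivity) hsumR,
      ← ENNReal.tsum_fiberwise _ (fun I : Ideal (𝓞 F) ↦ Ideal.absNorm I)]
    refine tsum_congr fun n ↦ ?_
    have : ∀ I : (fun I : Ideal (𝓞 F) ↦ Ideal.absNorm I) ⁻¹' {n}, normWeight F s I =
        ENNReal.ofReal ((n : ℝ) ^ (-s)) := fun I ↦ by
      rw [normWeight_apply, show Ideal.absNorm I.1 = n from I.2]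
    have : Finite ((fun I : Ideal (𝓞 F) ↦ Ideal.absNorm I) ⁻¹' {n}) :=
      (Ideal.finite_setOfPred_absNorm_eq n).to_subtype
    rw [tsum_congr ‹_›, ENNReal.ofReal_mul (by positivity), ENNReal.tsum_const,
      ENNReal.ofReal_natCast, ENat.card_eq_coe_natCard]
    rfl
  · have := (Complex.continuous_re.tendsto _).comp (tendsto_sub_one_mul_dedekindZeta_nhdsGT F)
    refine this.congr fun s ↦ ?_
    simp [Complex.mul_re]

lemma exp_sum_le_of_tsum_normWeight {s z : ℝ} (hs : 1 ≤ s)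
    (h : ∑' I, normWeight F s I = ENNReal.ofReal z) (hz : 0 < z)
    (T : Finset (HeightOneSpectrum (𝓞 F))) :
    ∑ P ∈ T, (Ideal.absNorm P.asIdeal : ℝ) ^ (-s) ≤ Real.log z := by
  rw [Real.le_log_iff_exp_le hz, Real.exp_sum]
  have hle := h ▸ prod_le_tsum_ideal (normWeight F s) T
  have hx := fun P : HeightOneSpectrum (𝓞 F) ↦ absNorm_rpow_le_half P hs
  have hprod : ∏ P ∈ T, (1 - normWeight F s P.asIdeal)⁻¹ =
      ENNReal.ofReal (∏ P ∈ T, (1 - (Ideal.absNorm P.asIdeal : ℝ) ^ (-s))⁻¹) := by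
    rw [ENNReal.ofReal_prod_of_nonneg
      fun P _ ↦ inv_nonneg.mpr (by linarith [hx P])]
    refine Finset.prod_congr rfl fun P _ ↦ ?_
    rw [ENNReal.ofReal_inv_of_pos (by linarith [hx P]), ENNReal.ofReal_sub _ (by positivity),
      ENNReal.ofReal_one, normWeight_apply]
  rw [hprod, ENNReal.ofReal_le_ofReal_iff hz.le] at hle
  refine le_trans (Finset.prod_le_prod (fun P _ ↦ (Real.exp_pos _).le) fun P _ ↦ ?_) hle
  rw [le_inv_comm₀ (Real.exp_pos _) (by linarith [hx P]), ← Real.exp_neg]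
  linarith [Real.add_one_le_exp (-(Ideal.absNorm P.asIdeal : ℝ) ^ (-s))]

lemma log_le_tsum_of_tsum_normWeight {s z B : ℝ} (hs : 1 ≤ s)
    (h : ∑' I, normWeight F s I = ENNReal.ofReal z) (hz : 0 < z)
    (hB : ∀ T : Finset (HeightOneSpectrum (𝓞 F)), ∑ P ∈ T, ((Ideal.absNorm P.asIdeal : ℝ) ^ (-s) +
      2 * ((Ideal.absNorm P.asIdeal : ℝ) ^ (-s)) ^ 2) ≤ B) :
    Real.log z ≤ B := by
  rw [Real.log_le_iff_le_exp hz]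
  have hx := fun P : HeightOneSpectrum (𝓞 F) ↦ absNorm_rpow_le_half P hs
  rw [← ENNReal.ofReal_le_ofReal_iff (Real.exp_pos _).le, ← h]
  refine tsum_ideal_le _ ?_ fun T ↦ ?_
  · simp [normWeight_apply, Real.zero_rpow (by linarith : -s ≠ 0)]
  refine le_trans ?_ (ENNReal.ofReal_le_ofReal (Real.exp_le_exp.mpr (hB T)))
  rw [Real.exp_sum, ENNReal.ofReal_prod_of_nonneg fun P _ ↦ (Real.exp_pos _).le]
  refine Finset.prod_le_prod' fun P _ ↦ ?_
  have hP := hx P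
  rw [normWeight_apply, ← ENNReal.ofReal_one, ← ENNReal.ofReal_sub _ (by positivity),
    ← ENNReal.ofReal_inv_of_pos (by linarith)]
  have h0 : 0 ≤ (Ideal.absNorm P.asIdeal : ℝ) ^ (-s) := by positivity
  set x := (Ideal.absNorm P.asIdeal : ℝ) ^ (-s)
  refine ENNReal.ofReal_le_ofReal (le_trans ?_ (Real.add_one_le_exp _))
  rw [inv_le_iff_one_le_mul₀ (by linarith)]
  nlinarith [mul_nonneg (sq_nonneg x) (by linarith : 0 ≤ 1 - 2 * x)]

variable (F) in
lemma eventually_log_bound :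
    ∃ C : ℝ, ∀ᶠ s in 𝓝[>] (1 : ℝ), ∃ z > 0, ∑' I, normWeight F s I = ENNReal.ofReal z ∧
      |Real.log z - Real.log (s - 1)⁻¹| ≤ C := by
  obtain ⟨z, hz, hlim⟩ := tsum_normWeight_eventually F
  have hlog := hlim.log (dedekindZeta_residue_ne_zero F)
  refine ⟨|Real.log (dedekindZeta_residue F)| + 1, ?_⟩
  filter_upwards [hz, hlim.eventually_const_lt (dedekindZeta_residue_pos F), self_mem_nhdsWithin,
    hlog.abs.eventually_le_const (lt_add_one _)] with s hs hpos hs1 hC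
  have hs1 : 0 < s - 1 := sub_pos.mpr hs1
  have hzpos : 0 < z s := pos_of_mul_pos_right hpos hs1.le
  refine ⟨z s, hzpos, hs, ?_⟩
  rwa [Real.log_inv, sub_neg_eq_add, add_comm, ← Real.log_mul hs1.ne' hzpos.ne']

lemma summable_absNorm_rpow {s : ℝ} (hs : 1 < s) :
    Summable fun P : HeightOneSpectrum (𝓞 F) ↦ (Ideal.absNorm P.asIdeal : ℝ) ^ (-s) := by
  obtain ⟨C, hC⟩ := eventually_log_bound F
  obtain ⟨t, ⟨z, hz0, hz, -⟩, ht1, hts⟩ :=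
    (hC.and (Ioo_mem_nhdsGT hs)).exists
  refine Summable.of_nonneg_of_le (fun P ↦ by positivity) (fun P ↦ ?_)
    (summable_of_sum_le (f := fun P : HeightOneSpectrum (𝓞 F) ↦
      (Ideal.absNorm P.asIdeal : ℝ) ^ (-t)) (fun P ↦ by positivity)
      (exp_sum_le_of_tsum_normWeight ht1.le hz hz0))
  exact Real.rpow_le_rpow_of_exponent_le (by linarith [two_le_absNorm P]) (by linarith)

variable (F) in
lemma exists_abs_tsum_absNorm_rpow_sub_log_le :
    ∃ C : ℝ, ∀ᶠ s in 𝓝[>] (1 : ℝ),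
      |∑' P : HeightOneSpectrum (𝓞 F), (Ideal.absNorm P.asIdeal : ℝ) ^ (-s) -
        Real.log (s - 1)⁻¹| ≤ C := by
  obtain ⟨C, hC⟩ := eventually_log_bound F
  have h2 := summable_absNorm_rpow (F := F) (one_lt_two)
  refine ⟨C + 2 * ∑' P : HeightOneSpectrum (𝓞 F), (Ideal.absNorm P.asIdeal : ℝ) ^ (-2 : ℝ), ?_⟩
  filter_upwards [hC, self_mem_nhdsWithin] with s ⟨z, hz0, hz, hzC⟩ hs1
  have hs1 : 1 < s := hs1
  have hsum := summable_absNorm_rpow (F := F) hs1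
  have hle : ∑' P : HeightOneSpectrum (𝓞 F), (Ideal.absNorm P.asIdeal : ℝ) ^ (-s) ≤ Real.log z :=
    hsum.tsum_le_of_sum_le (exp_sum_le_of_tsum_normWeight hs1.le hz hz0)
  have hge := log_le_tsum_of_tsum_normWeight hs1.le hz hz0
    (B := ∑' P : HeightOneSpectrum (𝓞 F), (Ideal.absNorm P.asIdeal : ℝ) ^ (-s) +
      2 * ∑' P : HeightOneSpectrum (𝓞 F), (Ideal.absNorm P.asIdeal : ℝ) ^ (-2 : ℝ)) fun T ↦ by
    rw [Finset.sum_add_distrib, ← Finset.mul_sum]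
    have hT := hsum.sum_le_tsum T fun P _ ↦ by positivity
    have hT2 := h2.sum_le_tsum T fun P _ ↦ by positivity
    have : ∑ P ∈ T, ((Ideal.absNorm P.asIdeal : ℝ) ^ (-s)) ^ 2 ≤
        ∑ P ∈ T, (Ideal.absNorm P.asIdeal : ℝ) ^ (-2 : ℝ) := Finset.sum_le_sum fun P _ ↦ by
      rw [← Real.rpow_natCast, ← Real.rpow_mul (by positivity)]
      exact Real.rpow_le_rpow_of_exponent_le (by linarith [two_le_absNorm P])
        (by push_cast; linarith)
    linarith
  have h2nn : 0 ≤ ∑' P : HeightOneSpectrum (𝓞 F), (Ideal.absNorm P.asIdeal : ℝ) ^ (-2 : ℝ) :=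
    tsum_nonneg fun P ↦ by positivity
  rw [abs_le] at hzC ⊢
  constructor <;> linarith

end Zeta

section LogDensity

/-- The bounded sequence `c` satisfies `∑ c n n⁻ˢ = κ log (1 / (s - 1)) + O(1)` as `s → 1⁺`. -/
def HasLogDensity (c : ℕ → ℝ) (κ : ℝ) : Prop :=
  (∃ B, ∀ n, |c n| ≤ B) ∧
    (fun s : ℝ ↦ ∑' n, c n * (n : ℝ) ^ (-s) - κ * Real.log (s - 1)⁻¹) =O[𝓝[>] 1] fun _ ↦ (1 : ℝ)

lemma summable_mul_rpow_neg {c : ℕ → ℝ} (hc : ∃ B, ∀ n, |c n| ≤ B) {s : ℝ} (hs : 1 < s) :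
    Summable fun n ↦ c n * (n : ℝ) ^ (-s) := by
  obtain ⟨B, hB⟩ := hc
  refine Summable.of_norm_bounded ((Real.summable_nat_rpow.mpr (by linarith : -s < -1)).mul_left B)
    fun n ↦ ?_
  rw [Real.norm_eq_abs, abs_mul, abs_of_nonneg (by positivity : 0 ≤ (n : ℝ) ^ (-s))]
  exact mul_le_mul_of_nonneg_right (hB n) (by positivity)

namespace HasLogDensity

variable {c d : ℕ → ℝ} {κ μ : ℝ}

lemma summable (hc : HasLogDensity c κ) {s : ℝ} (hs : 1 < s) :
    Summable fun n ↦ c n * (n : ℝ) ^ (-s) := summable_mul_rpow_neg hc.1 hs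

lemma zero : HasLogDensity (fun _ ↦ 0) 0 :=
  ⟨⟨0, by simp⟩, by simp only [zero_mul, tsum_zero, sub_zero]; exact isBigO_zero _ _⟩

lemma add (hc : HasLogDensity c κ) (hd : HasLogDensity d μ) :
    HasLogDensity (fun n ↦ c n + d n) (κ + μ) := by
  obtain ⟨⟨B, hB⟩, h⟩ := id hc
  obtain ⟨⟨B', hB'⟩, h'⟩ := id hd
  refine ⟨⟨B + B', fun n ↦ (abs_add_le _ _).trans (add_le_add (hB n) (hB' n))⟩, ?_⟩
  refine (h.add h').congr' ?_ .rfl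
  filter_upwards [self_mem_nhdsWithin] with s hs
  simp only [add_mul]
  rw [(hc.summable hs).tsum_add (hd.summable hs)]
  ring

lemma const_mul (hc : HasLogDensity c κ) (a : ℝ) :
    HasLogDensity (fun n ↦ a * c n) (a * κ) := by
  obtain ⟨⟨B, hB⟩, h⟩ := hc
  refine ⟨⟨|a| * B, fun n ↦ ?_⟩, ?_⟩
  · rw [abs_mul]
    exact mul_le_mul_of_nonneg_left (hB n) (abs_nonneg a)
  · refine (h.const_mul_left a).congr_left fun s ↦ ?_
    simp only [mul_assoc, tsum_mul_left, mul_sub]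

lemma sub (hc : HasLogDensity c κ) (hd : HasLogDensity d μ) :
    HasLogDensity (fun n ↦ c n - d n) (κ - μ) := by
  simpa [sub_eq_add_neg] using hc.add (hd.const_mul (-1))

lemma sum {ι : Type*} (t : Finset ι) {c : ι → ℕ → ℝ} {κ : ι → ℝ}
    (h : ∀ i ∈ t, HasLogDensity (c i) (κ i)) :
    HasLogDensity (fun n ↦ ∑ i ∈ t, c i n) (∑ i ∈ t, κ i) := by
  classical
  induction t using Finset.induction_on with
  | empty => simpa using zero
  | insert i t hi ih =>
    simp only [Finset.sum_insert hi]
    exact (h i (t.mem_insert_self i)).add (ih fun j hj ↦ h j (Finset.mem_insert_of_mem hj))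

lemma of_finite_ne (h : {n | c n ≠ 0}.Finite) : HasLogDensity c 0 := by
  have hc : ∀ n ∉ h.toFinset, c n = 0 := fun n hn ↦ by simpa using hn
  refine ⟨⟨∑ n ∈ h.toFinset, |c n|, fun n ↦ ?_⟩, ?_⟩
  · by_cases hn : n ∈ h.toFinset
    · exact Finset.single_le_sum (f := fun n ↦ |c n|) (fun _ _ ↦ abs_nonneg _) hn
    · rw [hc n hn, abs_zero]
      exact Finset.sum_nonneg fun _ _ ↦ abs_nonneg _
  · refine IsBigO.of_bound (∑ n ∈ h.toFinset, |c n|) ?_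
    filter_upwards [self_mem_nhdsWithin] with s hs
    have hs : 1 < s := hs
    rw [tsum_eq_sum (s := h.toFinset) fun n hn ↦ by simp [hc n hn]]
    simp only [zero_mul, sub_zero, norm_one, mul_one]
    refine (norm_sum_le _ _).trans (Finset.sum_le_sum fun n _ ↦ ?_)
    rw [Real.norm_eq_abs, abs_mul, abs_of_nonneg (by positivity : 0 ≤ (n : ℝ) ^ (-s))]
    refine mul_le_of_le_one_right (abs_nonneg _) ?_
    rcases n.eq_zero_or_pos with rfl | hn
    · rw [Nat.cast_zero, Real.zero_rpow (by linarith)]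
      exact zero_le_one
    · exact Real.rpow_le_one_of_one_le_of_nonpos (by exact_mod_cast hn) (by linarith)

lemma congr_finite (hc : HasLogDensity c κ) (h : {n | c n ≠ d n}.Finite) :
    HasLogDensity d κ := by
  have hz : HasLogDensity (fun n ↦ d n - c n) 0 :=
    of_finite_ne (h.subset fun n hn ↦ by simpa [sub_eq_zero, eq_comm] using hn)
  simpa using hc.add hz

lemma infinite_ne_zero (hc : HasLogDensity c κ) (hκ : κ ≠ 0) : {n | c n ≠ 0}.Infinite := by
  intro h
  have hb := hc.2.sub (of_finite_ne h).2
  have hlim : Tendsto (fun s : ℝ ↦ Real.log (s - 1)⁻¹) (𝓝[>] 1) atTop := by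
    refine Real.tendsto_log_atTop.comp (tendsto_inv_nhdsGT_zero.comp ?_)
    refine tendsto_nhdsWithin_iff.mpr ⟨?_, ?_⟩
    · exact ((continuous_id.sub continuous_const).tendsto' 1 0 (by simp)).mono_left
        nhdsWithin_le_nhds
    · filter_upwards [self_mem_nhdsWithin] with s hs
      exact sub_pos.mpr (Set.mem_Ioi.mp hs)
  have hb' : (fun s : ℝ ↦ Real.log (s - 1)⁻¹) =O[𝓝[>] 1] fun _ ↦ (1 : ℝ) := by
    refine (hb.const_mul_left (-κ⁻¹)).congr_left fun s ↦ ?_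
    field_simp
    ring
  obtain ⟨C, hC⟩ := hb'.bound
  obtain ⟨s, hs, hs'⟩ := (hC.and (hlim.eventually_gt_atTop C)).exists
  rw [norm_one, mul_one] at hs
  exact (hs'.trans_le (le_abs_self _)).not_ge hs

end HasLogDensity
end LogDensity

section DegreeOne

variable {F : Type*} [Field F] [NumberField F]

/-- The residue characteristic of a prime of a number field. -/
noncomputable def resChar (P : HeightOneSpectrum (𝓞 F)) : ℕ := Ideal.absNorm (P.asIdeal.under ℤ)

omit [NumberField F] in
lemma prime_resChar (P : HeightOneSpectrum (𝓞 F)) : (resChar P).Prime :=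
  have : NeZero P.asIdeal := ⟨P.ne_bot⟩
  Nat.absNorm_under_prime P.asIdeal

omit [NumberField F] in
lemma span_resChar (P : HeightOneSpectrum (𝓞 F)) :
    Ideal.span {(resChar P : ℤ)} = P.asIdeal.under ℤ :=
  Int.ideal_span_absNorm_eq_self _

lemma absNorm_eq_resChar_pow (P : HeightOneSpectrum (𝓞 F)) :
    Ideal.absNorm P.asIdeal = resChar P ^ P.asIdeal.inertiaDeg ℤ :=
  (Ideal.absNorm_pow_inertiaDeg (P.asIdeal.under ℤ) P.asIdeal).symm

lemma finite_resChar_eq (n : ℕ) : {P : HeightOneSpectrum (𝓞 F) | resChar P = n}.Finite := by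
  by_cases hn : n.Prime
  · have : (Ideal.span {(n : ℤ)}).IsMaximal := 
      have : Fact n.Prime := ⟨hn⟩; Int.ideal_span_isMaximal_of_prime n
    refine Set.Finite.of_finite_image ((IsDedekindDomain.primesOver_finite (Ideal.span {(n : ℤ)}) (𝓞 F)).subset ?_)
      fun P _ Q _ ↦ HeightOneSpectrum.ext
    rintro _ ⟨P, rfl, rfl⟩
    exact ⟨P.isPrime, ⟨span_resChar P⟩⟩
  · convert Set.finite_empty
    exact Set.eq_empty_of_forall_notMem fun P hP ↦ hn (hP ▸ prime_resChar P)

variable (F) in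
/-- The primes of `F` of residue characteristic `n`. -/
noncomputable def primesOfResChar (n : ℕ) : Finset (HeightOneSpectrum (𝓞 F)) :=
  (finite_resChar_eq n).toFinset

@[simp]
lemma mem_primesOfResChar {n : ℕ} {P : HeightOneSpectrum (𝓞 F)} :
    P ∈ primesOfResChar F n ↔ resChar P = n := by simp [primesOfResChar]

variable (F) in
lemma card_primesOfResChar_le (n : ℕ) :
    (primesOfResChar F n).card ≤ Module.finrank ℤ (𝓞 F) := by
  by_cases hn : n.Prime
  · have hmax : (Ideal.span {(n : ℤ)}).IsMaximal := have : Fact n.Prime := ⟨hn⟩; Int.ideal_span_isMaximal_of_prime n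
    have hmem (P : primesOfResChar F n) :
        P.1.asIdeal ∈ (Ideal.span {(n : ℤ)}).primesOver (𝓞 F) :=
      ⟨P.1.isPrime, ⟨by rw [← span_resChar, mem_primesOfResChar.mp P.2]⟩⟩
    rw [← Ideal.sum_ramification_inertia_eq_finrank (Ideal.span {(n : ℤ)}) (𝓞 F),
      ← Fintype.card_coe]
    refine (Fintype.card_le_of_injective (fun P ↦ ⟨P.1.asIdeal, hmem P⟩) fun P Q h ↦
      Subtype.ext (HeightOneSpectrum.ext (congrArg Subtype.val h))).trans ?_
    rw [← Finset.card_univ, Finset.card_eq_sum_ones]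
    refine Finset.sum_le_sum fun P _ ↦ ?_
    have := P.2.1
    exact Nat.mul_pos (Ideal.ramificationIdx_pos _ _) (Ideal.inertiaDeg_pos _ _)
  · have : primesOfResChar F n = ∅ := Finset.eq_empty_of_forall_notMem fun P hP ↦
      hn (mem_primesOfResChar.mp hP ▸ prime_resChar P)
    simp [this]

variable (F) in
/-- The number of degree-one primes of `F` of residue characteristic `n`. -/
noncomputable def degreeOneCount (n : ℕ) : ℕ :=
  ((primesOfResChar F n).filter fun P ↦ P.asIdeal.inertiaDeg ℤ = 1).card

variable (F) in
lemma hasLogDensity_degreeOneCount : HasLogDensity (fun n ↦ (degreeOneCount F n : ℝ)) 1 := by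
  have hB : ∀ n, |(degreeOneCount F n : ℝ)| ≤ (Module.finrank ℤ (𝓞 F) : ℕ) := fun n ↦ by
    rw [Nat.abs_cast, Nat.cast_le]
    exact (Finset.card_filter_le _ _).trans (card_primesOfResChar_le F n)
  refine ⟨⟨((Module.finrank ℤ (𝓞 F) : ℕ) : ℝ), hB⟩, ?_⟩
  obtain ⟨C, hC⟩ := exists_abs_tsum_absNorm_rpow_sub_log_le F
  set d : ℝ := ((Module.finrank ℤ (𝓞 F) : ℕ) : ℝ)
  have h2 : Summable fun n : ℕ ↦ d * (n : ℝ) ^ (-2 : ℝ) :=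
    (Real.summable_nat_rpow.mpr (by norm_num)).mul_left d
  refine IsBigO.of_bound (∑' n : ℕ, d * (n : ℝ) ^ (-2 : ℝ) + C) ?_
  filter_upwards [hC, self_mem_nhdsWithin] with s hsC hs
  have hs : 1 < s := hs
  rw [norm_one, mul_one, one_mul, Real.norm_eq_abs]
  have hfib := (summable_absNorm_rpow (F := F) hs).hasSum.tsum_fiberwise resChar
  have hfibn (n : ℕ) : ∑' P : (resChar (F := F)) ⁻¹' {n},
      (Ideal.absNorm P.1.asIdeal : ℝ) ^ (-s) =
      ∑ P ∈ primesOfResChar F n, (Ideal.absNorm P.asIdeal : ℝ) ^ (-s) := by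
    have : (resChar (F := F)) ⁻¹' {n} = ↑(primesOfResChar F n) := by ext; simp
    rw [this, ← Finset.tsum_subtype' (primesOfResChar F n)
      (fun P ↦ (Ideal.absNorm P.asIdeal : ℝ) ^ (-s))]
  simp only [hfibn] at hfib
  have hsum := summable_mul_rpow_neg ⟨_, hB⟩ hs
  have hdiff := hfib.sub hsum.hasSum
  have hbound : ∀ n, ‖∑ P ∈ primesOfResChar F n, (Ideal.absNorm P.asIdeal : ℝ) ^ (-s) -
      degreeOneCount F n * (n : ℝ) ^ (-s)‖ ≤ d * (n : ℝ) ^ (-2 : ℝ) := fun n ↦ by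
    have hdeg : (degreeOneCount F n : ℝ) * (n : ℝ) ^ (-s) =
        ∑ P ∈ primesOfResChar F n with P.asIdeal.inertiaDeg ℤ = 1,
          (Ideal.absNorm P.asIdeal : ℝ) ^ (-s) := by
      rw [degreeOneCount, ← nsmul_eq_mul, ← Finset.sum_const]
      refine Finset.sum_congr rfl fun P hP ↦ ?_
      rw [Finset.mem_filter, mem_primesOfResChar] at hP
      rw [absNorm_eq_resChar_pow, hP.1, hP.2, pow_one]
    rw [hdeg, ← Finset.sum_filter_add_sum_filter_not (primesOfResChar F n)
      (fun P ↦ P.asIdeal.inertiaDeg ℤ = 1), add_sub_cancel_left]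
    refine (norm_sum_le_of_le _ (n := fun _ ↦ (n : ℝ) ^ (-2 : ℝ)) fun P hP ↦ ?_).trans ?_
    · rw [Finset.mem_filter, mem_primesOfResChar] at hP
      obtain ⟨rfl, hP⟩ := hP
      have h1 : (1 : ℝ) ≤ resChar P := by exact_mod_cast (prime_resChar P).one_lt.le
      have hpos := P.asIdeal.inertiaDeg_pos ℤ
      rw [Real.norm_of_nonneg (by positivity), absNorm_eq_resChar_pow, Nat.cast_pow,
        ← Real.rpow_natCast, ← Real.rpow_mul (by positivity)]
      refine Real.rpow_le_rpow_of_exponent_le h1 ?_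
      have : (2 : ℝ) ≤ P.asIdeal.inertiaDeg ℤ := by exact_mod_cast (by omega)
      nlinarith
    · rw [Finset.sum_const, nsmul_eq_mul]
      refine mul_le_mul_of_nonneg_right ?_ (by positivity)
      exact Nat.cast_le.mpr ((Finset.card_filter_le _ _).trans (card_primesOfResChar_le F n))
  have := tsum_of_norm_bounded h2.hasSum hbound
  rw [hdiff.tsum_eq, Real.norm_eq_abs] at this
  rw [abs_le] at *
  constructor <;> linarith

end DegreeOne

section Galois

open scoped Pointwise

variable {K : Type*} [Field K] [NumberField K] [IsGalois ℚ K]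

/-- A Frobenius element at a prime of a Galois number field. -/
noncomputable def frob (Q : HeightOneSpectrum (𝓞 K)) : Gal(K/ℚ) :=
  haveI := Ideal.finiteQuotientOfFreeOfNeBot Q.asIdeal Q.ne_bot
  arithFrobAt ℤ Gal(K/ℚ) Q.asIdeal

omit [NumberField K] [IsGalois ℚ K] in
lemma card_quotient_under (Q : HeightOneSpectrum (𝓞 K)) :
    Nat.card (ℤ ⧸ Q.asIdeal.under ℤ) = resChar Q := by
  rw [resChar, Ideal.absNorm_apply, Submodule.cardQuot_apply]

lemma isArithFrobAt_frob (Q : HeightOneSpectrum (𝓞 K)) : IsArithFrobAt ℤ (frob Q) Q.asIdeal :=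
  haveI := Ideal.finiteQuotientOfFreeOfNeBot Q.asIdeal Q.ne_bot
  IsArithFrobAt.arithFrobAt ℤ Gal(K/ℚ) Q.asIdeal

lemma frob_smul_sub_mem (Q : HeightOneSpectrum (𝓞 K)) (x : 𝓞 K) :
    frob Q • x - x ^ resChar Q ∈ Q.asIdeal := by
  have := isArithFrobAt_frob Q x
  rwa [card_quotient_under] at this

lemma frob_eq {Q : HeightOneSpectrum (𝓞 K)} (hQ : Q.asIdeal.inertia Gal(K/ℚ) = ⊥)
    {σ : Gal(K/ℚ)} (hσ : ∀ x : 𝓞 K, σ • x - x ^ resChar Q ∈ Q.asIdeal) : frob Q = σ := by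
  have hσ' : IsArithFrobAt ℤ σ Q.asIdeal := fun x ↦ by
    rw [card_quotient_under]
    exact hσ x
  have := (isArithFrobAt_frob Q).mul_inv_mem_inertia hσ'
  rwa [hQ, Subgroup.mem_bot, mul_inv_eq_one] at this

variable (K) in
lemma finite_inertia_ne_bot :
    {Q : HeightOneSpectrum (𝓞 K) | Q.asIdeal.inertia Gal(K/ℚ) ≠ ⊥}.Finite := by
  have hx (σ : Gal(K/ℚ)) (hσ : σ ≠ 1) : ∃ x : 𝓞 K, σ • x - x ≠ 0 := by
    by_contra! h
    have : FaithfulSMul Gal(K/ℚ) (𝓞 K) := IsGaloisGroup.faithful ℤ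
    exact hσ (FaithfulSMul.eq_of_smul_eq_smul fun x : 𝓞 K ↦ by
      rw [one_smul, sub_eq_zero.mp (h x)])
  choose! x hx using hx
  refine (Set.finite_iUnion fun σ : {σ : Gal(K/ℚ) // σ ≠ 1} ↦
    Ideal.finite_factors (I := Ideal.span {σ.1 • x σ.1 - x σ.1})
      (by simpa using hx σ.1 σ.2)).subset ?_
  intro Q hQ
  obtain ⟨σ, hσ, hσ1⟩ := (Subgroup.bot_or_exists_ne_one _).resolve_left hQ
  refine Set.mem_iUnion.mpr ⟨⟨σ, hσ1⟩, ?_⟩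
  exact Ideal.dvd_span_singleton.mpr (hσ _)

section Intermediate

variable {F : Type*} [Field F] [NumberField F] [Algebra F K] {H : Subgroup Gal(K/ℚ)}
  [IsGaloisGroup H (𝓞 F) (𝓞 K)]

omit [NumberField F] [NumberField K] [IsGalois ℚ K] [IsGaloisGroup H (𝓞 F) (𝓞 K)] in
lemma resChar_under (Q : HeightOneSpectrum (𝓞 K)) : resChar (Q.under (𝓞 F)) = resChar Q := by
  rw [resChar, resChar, HeightOneSpectrum.under_asIdeal, Ideal.under_under]

lemma frob_mem_of_inertiaDeg_eq_one {Q : HeightOneSpectrum (𝓞 K)}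
    (hQ : Q.asIdeal.inertia Gal(K/ℚ) = ⊥)
    (hP : (Q.under (𝓞 F)).asIdeal.inertiaDeg ℤ = 1) : frob Q ∈ H := by
  have := Ideal.finiteQuotientOfFreeOfNeBot Q.asIdeal Q.ne_bot
  obtain ⟨h, hh⟩ := IsArithFrobAt.exists_of_isInvariant (R := 𝓞 F) (G := H) (Q := Q.asIdeal)
  have hcard : Nat.card (𝓞 F ⧸ Q.asIdeal.under (𝓞 F)) = resChar Q := by
    rw [← HeightOneSpectrum.under_asIdeal, ← Submodule.cardQuot_apply, ← Ideal.absNorm_apply,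
      absNorm_eq_resChar_pow, hP, pow_one, resChar_under]
  rw [frob_eq hQ (σ := h) fun x ↦ ?_]
  · exact h.2
  · have := hh x
    rwa [hcard] at this

lemma inertiaDeg_eq_one_of_frob_mem {Q : HeightOneSpectrum (𝓞 K)}
    (hQ : frob Q ∈ H) : (Q.under (𝓞 F)).asIdeal.inertiaDeg ℤ = 1 := by
  set P := Q.under (𝓞 F)
  have hp := prime_resChar Q
  have := Ideal.finiteQuotientOfFreeOfNeBot P.asIdeal P.ne_bot
  have := Fintype.ofFinite (𝓞 F ⧸ P.asIdeal)
  have hroot (y : 𝓞 F ⧸ P.asIdeal) : y ^ resChar Q - y = 0 := by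
    obtain ⟨y, rfl⟩ := Ideal.Quotient.mk_surjective y
    rw [← map_pow, ← map_sub, Ideal.Quotient.eq_zero_iff_mem]
    have h1 := frob_smul_sub_mem Q (algebraMap (𝓞 F) (𝓞 K) y)
    have h2 : frob Q • algebraMap (𝓞 F) (𝓞 K) y = algebraMap (𝓞 F) (𝓞 K) y :=
      smul_algebraMap (⟨frob Q, hQ⟩ : H) y
    rw [h2, ← map_pow, ← map_sub] at h1
    rw [← neg_sub]
    exact neg_mem h1
  have hle : Nat.card (𝓞 F ⧸ P.asIdeal) ≤ resChar Q := by
    classical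
    have : P.asIdeal.IsMaximal := P.isMaximal
    let := Ideal.Quotient.field P.asIdeal
    rw [Nat.card_eq_fintype_card, ← FiniteField.X_pow_card_sub_X_natDegree_eq
      (𝓞 F ⧸ P.asIdeal) hp.one_lt, ← Finset.card_univ]
    refine le_trans (Finset.card_le_card fun y _ ↦ ?_)
      ((Multiset.toFinset_card_le _).trans (Polynomial.card_roots' _))
    rw [Multiset.mem_toFinset, Polynomial.mem_roots
      (FiniteField.X_pow_card_sub_X_ne_zero _ hp.one_lt)]
    simpa using hroot y
  rw [← Submodule.cardQuot_apply, ← Ideal.absNorm_apply, absNorm_eq_resChar_pow,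
    resChar_under] at hle
  have h1 := (Nat.pow_le_pow_iff_right hp.one_lt).mp (hle.trans_eq (pow_one _).symm)
  have := P.asIdeal.inertiaDeg_pos ℤ
  omega

open scoped Classical in
omit [IsGalois ℚ K] in
lemma sum_inertiaDeg_eq_card {n : ℕ}
    (hn : ∀ Q : HeightOneSpectrum (𝓞 K), resChar Q = n → Q.asIdeal.inertia Gal(K/ℚ) = ⊥)
    {P : HeightOneSpectrum (𝓞 F)} (hPn : resChar P = n) (hP : P.asIdeal.inertiaDeg ℤ = 1) :
    ∑ Q ∈ primesOfResChar K n with Q.under (𝓞 F) = P, Q.asIdeal.inertiaDeg ℤ = Nat.card H := by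
  set T := (primesOfResChar K n).filter fun Q ↦ Q.under (𝓞 F) = P
  have hmem (Q) : Q ∈ T ↔ Q.under (𝓞 F) = P := by
    rw [Finset.mem_filter, mem_primesOfResChar, and_iff_right_iff_imp]
    rintro rfl
    rw [← hPn, resChar_under]
  have himage : HeightOneSpectrum.asIdeal '' (T : Set (HeightOneSpectrum (𝓞 K))) =
      P.asIdeal.primesOver (𝓞 K) := by
    ext I
    constructor
    · rintro ⟨Q, hQ, rfl⟩
      exact ⟨Q.isPrime, ⟨congrArg HeightOneSpectrum.asIdeal ((hmem Q).mp hQ).symm⟩⟩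
    · rintro ⟨h1, h2⟩
      exact ⟨⟨I, h1, Ideal.ne_bot_of_liesOver_of_ne_bot P.ne_bot I⟩,
        (hmem _).mpr (HeightOneSpectrum.ext h2.over.symm), rfl⟩
  have hT : (P.asIdeal.primesOver (𝓞 K)).ncard = T.card := by
    rw [← himage, Set.ncard_image_of_injective _ fun _ _ ↦ HeightOneSpectrum.ext,
      Set.ncard_coe_finset]
  have hQ (Q) (hQT : Q ∈ T) : T.card * Q.asIdeal.inertiaDeg ℤ = Nat.card H := by
    have hover : Q.asIdeal.LiesOver P.asIdeal :=
      ⟨congrArg HeightOneSpectrum.asIdeal ((hmem Q).mp hQT).symm⟩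
    have hin : Q.asIdeal.inertia H = ⊥ := by
      refine (Subgroup.eq_bot_iff_forall _).mpr fun σ hσ ↦ Subtype.ext ?_
      have : (σ : Gal(K/ℚ)) ∈ Q.asIdeal.inertia Gal(K/ℚ) := hσ
      rwa [hn Q (mem_primesOfResChar.mp (Finset.mem_filter.mp hQT).1), Subgroup.mem_bot] at this
    have := Ideal.ncard_primesOver_mul_card_inertia_mul_finrank (G := H) P.asIdeal Q.asIdeal
    rwa [hT, hin, Subgroup.card_bot, mul_one, ← one_mul (Q.asIdeal.inertiaDeg (𝓞 F)), ← hP,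
      ← Ideal.inertiaDeg_tower] at this
  have hne : T.card ≠ 0 := by
    obtain ⟨I, hI⟩ := (inferInstance : Nonempty (P.asIdeal.primesOver (𝓞 K)))
    rw [← himage] at hI
    obtain ⟨Q, hQ, -⟩ := hI
    exact Finset.card_ne_zero_of_mem hQ
  refine Nat.eq_of_mul_eq_mul_left (Nat.pos_of_ne_zero hne) ?_
  rw [Finset.mul_sum, Finset.sum_congr rfl hQ, Finset.sum_const, smul_eq_mul]

open scoped Classical in
variable (K) in
/-- The number of primes `Q` of residue characteristic `n`, weighted by their inertia degrees, whose
Frobenius element generates `D`. -/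
noncomputable def frobCount (D : Subgroup Gal(K/ℚ)) (n : ℕ) : ℕ :=
  ∑ Q ∈ primesOfResChar K n with Subgroup.zpowers (frob Q) = D, Q.asIdeal.inertiaDeg ℤ

open scoped Classical in
lemma sum_frobCount {n : ℕ}
    (hn : ∀ Q : HeightOneSpectrum (𝓞 K), resChar Q = n → Q.asIdeal.inertia Gal(K/ℚ) = ⊥) :
    ∑ D : Subgroup Gal(K/ℚ) with D ≤ H, frobCount K D n =
      Nat.card H * degreeOneCount F n := by
  have h1 : ∑ D : Subgroup Gal(K/ℚ) with D ≤ H, frobCount K D n =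
      ∑ Q ∈ primesOfResChar K n with frob Q ∈ H, Q.asIdeal.inertiaDeg ℤ := by
    rw [← Finset.sum_fiberwise_of_maps_to (t := {D : Subgroup Gal(K/ℚ) | D ≤ H})
      (g := fun Q ↦ Subgroup.zpowers (frob Q)) fun Q hQ ↦ by
        simpa using (Finset.mem_filter.mp hQ).2]
    refine Finset.sum_congr rfl fun D hD ↦ ?_
    rw [frobCount, Finset.filter_filter]
    refine Finset.sum_congr (Finset.filter_congr fun Q _ ↦ ?_) fun _ _ ↦ rfl
    refine ⟨fun h ↦ ⟨?_, h⟩, And.right⟩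
    exact (Finset.mem_filter.mp hD).2 (h ▸ Subgroup.mem_zpowers (frob Q))
  have h2 : ∑ Q ∈ primesOfResChar K n with frob Q ∈ H, Q.asIdeal.inertiaDeg ℤ =
      ∑ P ∈ primesOfResChar F n with P.asIdeal.inertiaDeg ℤ = 1, Nat.card H := by
    rw [← Finset.sum_fiberwise_of_maps_to
      (t := {P ∈ primesOfResChar F n | P.asIdeal.inertiaDeg ℤ = 1})
      (g := fun Q ↦ Q.under (𝓞 F)) fun Q hQ ↦ by
        rw [Finset.mem_filter, mem_primesOfResChar] at hQ ⊢
        exact ⟨(resChar_under Q).trans hQ.1, inertiaDeg_eq_one_of_frob_mem hQ.2⟩]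
    refine Finset.sum_congr rfl fun P hP ↦ ?_
    rw [Finset.mem_filter, mem_primesOfResChar] at hP
    rw [← sum_inertiaDeg_eq_card (H := H) hn hP.1 hP.2, Finset.filter_filter]
    refine Finset.sum_congr (Finset.filter_congr fun Q hQ ↦ ?_) fun _ _ ↦ rfl
    refine ⟨And.right, fun h ↦ ⟨?_, h⟩⟩
    rw [mem_primesOfResChar] at hQ
    exact frob_mem_of_inertiaDeg_eq_one (F := F) (hn Q hQ) (h ▸ hP.2)
  rw [h1, h2, Finset.sum_const, smul_eq_mul, mul_comm, degreeOneCount]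

end Intermediate

open scoped Classical in
lemma card_eq_sum_card_zpowers_eq {G : Type*} [Group G] [Fintype G] (H : Subgroup G) :
    Nat.card H = ∑ D : Subgroup G with D ≤ H, Fintype.card {x : G // Subgroup.zpowers x = D} := by
  simp_rw [Fintype.card_subtype]
  rw [Nat.card_eq_fintype_card, Fintype.card_subtype, Finset.card_eq_sum_card_fiberwise
    (f := Subgroup.zpowers) (t := {D : Subgroup G | D ≤ H}) fun x hx ↦ by simpa using hx]
  refine Finset.sum_congr rfl fun D hD ↦ ?_
  rw [Finset.filter_filter]
  refine congrArg _ (Finset.filter_congr fun x _ ↦ ⟨And.right, fun h ↦ ⟨?_, h⟩⟩)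
  exact (Finset.mem_filter.mp hD).2 (h ▸ Subgroup.mem_zpowers x)

open scoped Classical in
lemma hasLogDensity_frobCount (D : Subgroup Gal(K/ℚ)) :
    HasLogDensity (fun n ↦ (frobCount K D n : ℝ))
      (Fintype.card {x : Gal(K/ℚ) // Subgroup.zpowers x = D}) := by
  induction D using WellFoundedLT.induction with
  | _ D ih =>
  let F : IntermediateField ℚ K := FixedPoints.intermediateField D
  have : IsGaloisGroup D (𝓞 F) (𝓞 K) := IsGaloisGroup.of_isFractionRing D (𝓞 F) (𝓞 K) F K
  have hsplit : ({D' : Subgroup Gal(K/ℚ) | D' ≤ D} : Finset _) =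
      insert D ({D' : Subgroup Gal(K/ℚ) | D' < D} : Finset _) := by
    ext D'
    simp [le_iff_eq_or_lt]
  have hcard : (Nat.card D : ℝ) = Fintype.card {x : Gal(K/ℚ) // Subgroup.zpowers x = D} +
      ∑ D' : Subgroup Gal(K/ℚ) with D' < D,
        (Fintype.card {x : Gal(K/ℚ) // Subgroup.zpowers x = D'} : ℝ) := by
    rw [card_eq_sum_card_zpowers_eq, hsplit, Finset.sum_insert (by simp)]
    push_cast
    rfl
  have hd := ((hasLogDensity_degreeOneCount F).const_mul (Nat.card D)).sub
    (HasLogDensity.sum {D' : Subgroup Gal(K/ℚ) | D' < D} fun D' hD' ↦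
      ih D' (Finset.mem_filter.mp hD').2)
  rw [mul_one, sub_eq_of_eq_add hcard] at hd
  refine hd.congr_finite (((finite_inertia_ne_bot K).image resChar).subset fun n hn ↦ ?_)
  by_contra hbad
  have hgood (Q : HeightOneSpectrum (𝓞 K)) (hQ : resChar Q = n) :
      Q.asIdeal.inertia Gal(K/ℚ) = ⊥ := by
    by_contra h
    exact hbad ⟨Q, h, hQ⟩
  have hsum := sum_frobCount (F := F) (H := D) hgood
  rw [hsplit, Finset.sum_insert (by simp)] at hsum
  refine hn ?_
  rw [sub_eq_iff_eq_add]
  exact_mod_cast hsum.symm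

lemma infinite_resChar_of_zpowers_frob_eq (σ : Gal(K/ℚ)) :
    {p : ℕ | ∃ Q : HeightOneSpectrum (𝓞 K), resChar Q = p ∧
      Subgroup.zpowers (frob Q) = Subgroup.zpowers σ}.Infinite := by
  classical
  have : Nonempty {x : Gal(K/ℚ) // Subgroup.zpowers x = Subgroup.zpowers σ} := ⟨σ, rfl⟩
  refine ((hasLogDensity_frobCount (Subgroup.zpowers σ)).infinite_ne_zero
    (Nat.cast_ne_zero.mpr Fintype.card_ne_zero)).mono fun n hn ↦ ?_
  obtain ⟨Q, hQ, -⟩ := Finset.exists_ne_zero_of_sum_ne_zero (Nat.cast_ne_zero.mp hn)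
  rw [Finset.mem_filter, mem_primesOfResChar] at hQ
  exact ⟨Q, hQ⟩

end Galois

section Splitting

lemma Splits.intCast_ne_zero {M : Finset ℤ} {q : ℕ} [Fact q.Prime] (h : Splits M q) {m : ℤ}
    (hm : m ∈ M) : (m : ZMod q) ≠ 0 := by
  obtain ⟨S, hS, hS0⟩ := h
  obtain ⟨ms, hms, -⟩ := hS 1 one_ne_zero
  exact fun h0 ↦ hS0 ⟨m, hm, ms.2, hms.2.1, by rw [h0, zero_mul]⟩

/-- A splitting of `ℤ_q` pulls back along a homomorphism of unit groups that is compatible with the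
multiplier set. -/
lemma Splits.of_monoidHom {M : Finset ℤ} {p q : ℕ} [Fact p.Prime] [Fact q.Prime] (h : Splits M q)
    (φ : (ZMod p)ˣ →* (ZMod q)ˣ)
    (hφ : ∀ m ∈ M, ∃ u : (ZMod p)ˣ, (u : ZMod p) = m ∧ (φ u : ZMod q) = m) : Splits M p := by
  obtain ⟨S, hS, -⟩ := h
  refine ⟨{y | ∃ u : (ZMod p)ˣ, (u : ZMod p) = y ∧ (φ u : ZMod q) ∈ S}, fun g hg ↦ ?_, ?_⟩
  · lift g to (ZMod p)ˣ using isUnit_iff_ne_zero.mpr hg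
    obtain ⟨⟨m, s⟩, ⟨hm, hs, hms⟩, huniq⟩ := hS (φ g) (φ g).ne_zero
    obtain ⟨u, hu, hφu⟩ := hφ m hm
    refine ⟨(m, ((u⁻¹ * g : (ZMod p)ˣ) : ZMod p)), ⟨hm, ⟨u⁻¹ * g, rfl, ?_⟩, ?_⟩, ?_⟩
    · dsimp only at hms
      rw [map_mul, map_inv, Units.val_mul, ← hms, ← hφu, Units.inv_mul_cancel_left]
      exact hs
    · rw [← hu, ← Units.val_mul, mul_inv_cancel_left]
    · rintro ⟨m', _⟩ ⟨hm', ⟨w, rfl, hw⟩, hmw⟩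
      dsimp only at hm' hw hmw
      obtain ⟨u', hu', hφu'⟩ := hφ m' hm'
      rw [← hu', ← Units.val_mul, Units.val_inj] at hmw
      have := huniq (m', (φ w : ZMod q)) ⟨hm', hw, by
        rw [← hφu', ← hmw, map_mul, Units.val_mul]⟩
      obtain rfl : m' = m := congrArg Prod.fst this
      obtain rfl : u' = u := Units.ext (hu'.trans hu.symm)
      rw [← hmw, inv_mul_cancel_left]
  · rintro ⟨m, hm, _, ⟨w, rfl, -⟩, h0⟩
    obtain ⟨u, hu, -⟩ := hφ m hm
    rw [← hu, ← Units.val_mul] at h0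
    exact Units.ne_zero _ h0

lemma MonoidHom.exists_comp_eq_of_range_le {X Y Z : Type*} [Group X] [Group Y] [Group Z]
    (f : X →* Z) {g : Y →* Z} (hg : Function.Injective g) (h : ∀ x, ∃ y, g y = f x) :
    ∃ φ : X →* Y, ∀ x, g (φ x) = f x := by
  refine ⟨(MonoidHom.ofInjective hg).symm.toMonoidHom.comp (f.codRestrict g.range h), fun x ↦ ?_⟩
  exact congrArg Subtype.val ((MonoidHom.ofInjective hg).apply_symm_apply _)

open Polynomial in
lemma exists_isGalois_splits (f : ℚ[X]) :
    ∃ (K : Type) (_ : Field K) (_ : NumberField K) (_ : IsGalois ℚ K),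
      (f.map (algebraMap ℚ K)).Splits := by
  obtain ⟨K, _, algK, hK⟩ : ∃ (K : Type) (_ : Field K) (_ : Algebra ℚ K), IsSplittingField ℚ K f :=
    ⟨_, _, _, IsSplittingField.splittingField f⟩
  have : CharZero K := charZero_of_injective_algebraMap (algebraMap ℚ K).injective
  obtain rfl : algK = DivisionRing.toRatAlgebra := Subsingleton.elim _ _
  have : NumberField K :=
    { to_charZero := this
      to_finiteDimensional := IsSplittingField.finiteDimensional K f }
  have : Normal ℚ K := Normal.of_isSplittingField f
  exact ⟨K, inferInstance, inferInstance, {}, IsSplittingField.splits K f⟩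

open Polynomial in
/-- A Galois number field containing the `n`-th roots of the elements of `M`. -/
lemma exists_isGalois_isPrimitiveRoot (n : ℕ) [NeZero n] (M : Finset ℤ) :
    ∃ (K : Type) (_ : Field K) (_ : NumberField K) (_ : IsGalois ℚ K),
      (∃ ζ : 𝓞 K, IsPrimitiveRoot ζ n) ∧ ∀ m ∈ M, ∃ α : 𝓞 K, α ^ n = m := by
  let g (m : ℤ) : ℚ[X] := X ^ n - C (m : ℚ)
  have hg (m : ℤ) : g m ≠ 0 := X_pow_sub_C_ne_zero (NeZero.pos n) _
  have hf : cyclotomic n ℚ * ∏ m ∈ M, g m ≠ 0 :=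
    mul_ne_zero (cyclotomic_ne_zero n ℚ) (Finset.prod_ne_zero_iff.mpr fun m _ ↦ hg m)
  obtain ⟨K, _, _, _, hK⟩ := exists_isGalois_splits (cyclotomic n ℚ * ∏ m ∈ M, g m)
  have hroot {h : ℚ[X]} (hh : h ∣ cyclotomic n ℚ * ∏ m ∈ M, g m) (hd : h.degree ≠ 0) :
      ∃ x : K, eval x (h.map (algebraMap ℚ K)) = 0 :=
    (hK.of_dvd (Polynomial.map_ne_zero hf)
      (Polynomial.map_dvd _ hh)).exists_eval_eq_zero (by rwa [degree_map])
  refine ⟨K, inferInstance, inferInstance, inferInstance, ?_, fun m hm ↦ ?_⟩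
  · obtain ⟨x, hx⟩ := hroot (dvd_mul_right _ _)
      (by rw [degree_cyclotomic]; exact_mod_cast (Nat.totient_pos.mpr (NeZero.pos n)).ne')
    rw [map_cyclotomic] at hx
    have hx : IsPrimitiveRoot x n := isRoot_cyclotomic_iff.mp hx
    exact ⟨hx.toInteger, hx.toInteger_isPrimitiveRoot⟩
  · obtain ⟨x, hx⟩ := hroot (h := g m)
      ((Finset.dvd_prod_of_mem g hm).trans (dvd_mul_left _ _))
      (by rw [degree_X_pow_sub_C (NeZero.pos n)]; exact_mod_cast NeZero.ne n)
    have hx : x ^ n = m := by simpa [g, sub_eq_zero] using hx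
    have hint : IsIntegral ℤ x :=
      .of_pow (NeZero.pos n) (hx ▸ map_intCast (algebraMap ℤ K) m ▸ isIntegral_algebraMap)
    obtain ⟨α, rfl⟩ := (IsIntegralClosure.isIntegral_iff (A := 𝓞 K)).mp hint
    exact ⟨α, RingOfIntegers.ext <|
      (map_pow (algebraMap (𝓞 K) K) α n).trans (hx.trans (map_intCast _ m).symm)⟩

section Residue

variable {K : Type*} [Field K] [NumberField K]

omit [NumberField K] in
lemma intCast_mem_asIdeal_iff {Q : HeightOneSpectrum (𝓞 K)} {d : ℤ} :
    (d : 𝓞 K) ∈ Q.asIdeal ↔ (resChar Q : ℤ) ∣ d :=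
  Int.cast_mem_ideal_iff

omit [NumberField K] in
lemma charP_quotient (Q : HeightOneSpectrum (𝓞 K)) : CharP (𝓞 K ⧸ Q.asIdeal) (resChar Q) where
  cast_eq_zero_iff d := by
    rw [← map_natCast (Ideal.Quotient.mk Q.asIdeal), Ideal.Quotient.eq_zero_iff_mem,
      ← Int.cast_natCast, intCast_mem_asIdeal_iff, Int.natCast_dvd_natCast]

lemma exists_resChar_eq (q : ℕ) [Fact q.Prime] : ∃ Q : HeightOneSpectrum (𝓞 K), resChar Q = q := by
  have hq := Nat.prime_iff_prime_int.mp (Fact.out : q.Prime)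
  have : (Ideal.span {(q : ℤ)}).IsPrime := (Ideal.span_singleton_prime hq.ne_zero).mpr hq
  obtain ⟨I, hI, hIq⟩ := (inferInstance : Nonempty ((Ideal.span {(q : ℤ)}).primesOver (𝓞 K)))
  refine ⟨⟨I, hI, Ideal.ne_bot_of_liesOver_of_ne_bot
    (p := Ideal.span {(q : ℤ)}) (by simpa using hq.ne_zero) I⟩, ?_⟩
  rw [resChar, ← hIq.over]
  simp

variable {n : ℕ} [NeZero n] {ζ : 𝓞 K} {Q : HeightOneSpectrum (𝓞 K)}

/-- Reduction of roots of unity modulo a prime. -/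
def rootsResidue (n : ℕ) (Q : HeightOneSpectrum (𝓞 K)) :
    rootsOfUnity n (𝓞 K) →* (𝓞 K ⧸ Q.asIdeal)ˣ :=
  (Units.map (Ideal.Quotient.mk Q.asIdeal : 𝓞 K →* 𝓞 K ⧸ Q.asIdeal)).comp
    (rootsOfUnity n (𝓞 K)).subtype

omit [NumberField K] [NeZero n] in
lemma coe_rootsResidue (ξ : rootsOfUnity n (𝓞 K)) :
    (rootsResidue n Q ξ : 𝓞 K ⧸ Q.asIdeal) =
      Ideal.Quotient.mk Q.asIdeal ((ξ : (𝓞 K)ˣ) : 𝓞 K) := rfl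

omit [NumberField K] [NeZero n] in
lemma rootsResidue_pow (ξ : rootsOfUnity n (𝓞 K)) : rootsResidue n Q ξ ^ n = 1 := by
  rw [← map_pow, show ξ ^ n = 1 from Subtype.ext ξ.2, map_one]

omit [NumberField K] in
lemma isPrimitiveRoot_mk (hζ : IsPrimitiveRoot ζ n) (hn : (n : 𝓞 K) ∉ Q.asIdeal) :
    IsPrimitiveRoot (Ideal.Quotient.mk Q.asIdeal ζ) n := by
  have : NeZero (n : 𝓞 K ⧸ Q.asIdeal) :=
    ⟨by rwa [← map_natCast (Ideal.Quotient.mk Q.asIdeal), ne_eq, Ideal.Quotient.eq_zero_iff_mem]⟩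
  rw [← Polynomial.isRoot_cyclotomic_iff, ← Polynomial.map_cyclotomic n (Ideal.Quotient.mk _)]
  exact (hζ.isRoot_cyclotomic (NeZero.pos n)).map

omit [NumberField K] in
lemma exists_coe_eq_pow (hζ : IsPrimitiveRoot ζ n) (ξ : rootsOfUnity n (𝓞 K)) :
    ∃ i : ℕ, ((ξ : (𝓞 K)ˣ) : 𝓞 K) = ζ ^ i := by
  obtain ⟨i, -, hi⟩ := hζ.eq_pow_of_pow_eq_one ((mem_rootsOfUnity' n _).mp ξ.2)
  exact ⟨i, hi.symm⟩

omit [NumberField K] in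
lemma rootsResidue_injective (hζ : IsPrimitiveRoot ζ n) (hn : (n : 𝓞 K) ∉ Q.asIdeal) :
    Function.Injective (rootsResidue n Q) := by
  refine (injective_iff_map_eq_one _).mpr fun ξ hξ ↦ ?_
  obtain ⟨i, hi⟩ := exists_coe_eq_pow hζ ξ
  rw [Units.ext_iff, coe_rootsResidue, hi, map_pow, Units.val_one,
    (isPrimitiveRoot_mk hζ hn).pow_eq_one_iff_dvd, ← hζ.pow_eq_one_iff_dvd, ← hi] at hξ
  exact Subtype.ext (Units.ext hξ)

/-- The inclusion of the unit group of the prime field in that of the residue field. -/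
noncomputable def primeFieldUnits (Q : HeightOneSpectrum (𝓞 K)) :
    (ZMod (resChar Q))ˣ →* (𝓞 K ⧸ Q.asIdeal)ˣ :=
  have := charP_quotient Q
  Units.map (ZMod.castHom dvd_rfl (𝓞 K ⧸ Q.asIdeal) : ZMod (resChar Q) →* _)

omit [NumberField K] in
lemma primeFieldUnits_injective : Function.Injective (primeFieldUnits Q) := by
  have := charP_quotient Q
  have : Fact (resChar Q).Prime := ⟨prime_resChar Q⟩
  exact Units.map_injective (ZMod.castHom dvd_rfl (𝓞 K ⧸ Q.asIdeal)).injective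

omit [NumberField K] in
lemma coe_primeFieldUnits {u : (ZMod (resChar Q))ˣ} {m : ℤ} (h : (u : ZMod (resChar Q)) = m) :
    (primeFieldUnits Q u : 𝓞 K ⧸ Q.asIdeal) = m := by
  have := charP_quotient Q
  change ZMod.castHom dvd_rfl (𝓞 K ⧸ Q.asIdeal) (u : ZMod (resChar Q)) = m
  rw [h, map_intCast]

omit [NumberField K] in
/-- The power residue symbol on the prime field, with values in the roots of unity of `𝓞 K`. -/
lemma exists_powerResidue (hζ : IsPrimitiveRoot ζ n) (hn : (n : 𝓞 K) ∉ Q.asIdeal)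
    (hdvd : n ∣ resChar Q - 1) :
    ∃ ρ : (ZMod (resChar Q))ˣ →* rootsOfUnity n (𝓞 K),
      ∀ u, rootsResidue n Q (ρ u) = primeFieldUnits Q u ^ ((resChar Q - 1) / n) := by
  refine MonoidHom.exists_comp_eq_of_range_le
    ((powMonoidHom ((resChar Q - 1) / n)).comp (primeFieldUnits Q))
    (rootsResidue_injective hζ hn) fun u ↦ ?_
  have : Fact (resChar Q).Prime := ⟨prime_resChar Q⟩
  have hu : (primeFieldUnits Q u ^ ((resChar Q - 1) / n)) ^ n = 1 := by
    rw [← pow_mul, Nat.div_mul_cancel hdvd, ← map_pow, ZMod.units_pow_card_sub_one_eq_one, map_one]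
  obtain ⟨i, -, hi⟩ := (isPrimitiveRoot_mk hζ hn).eq_pow_of_pow_eq_one
    (by rw [← Units.val_pow_eq_pow_val, hu, Units.val_one])
  refine ⟨hζ.toRootsOfUnity ^ i, Units.ext ?_⟩
  rw [coe_rootsResidue]
  exact hi

lemma exists_rootsOfUnity_hom :
    ∃ φ : rootsOfUnity (resChar Q - 1) (𝓞 K) →* (ZMod (resChar Q))ˣ,
      ∀ ξ, primeFieldUnits Q (φ ξ) = rootsResidue (resChar Q - 1) Q ξ := by
  refine MonoidHom.exists_comp_eq_of_range_le _ primeFieldUnits_injective fun ξ ↦ ?_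
  have := charP_quotient Q
  have : Fact (resChar Q).Prime := ⟨prime_resChar Q⟩
  have : Q.asIdeal.IsMaximal := Q.isMaximal
  let : Field (𝓞 K ⧸ Q.asIdeal) := Ideal.Quotient.field Q.asIdeal
  have hξ : (rootsResidue (resChar Q - 1) Q ξ : 𝓞 K ⧸ Q.asIdeal) ∈
      (⊥ : Subfield (𝓞 K ⧸ Q.asIdeal)) := by
    rw [Subfield.mem_bot_iff_pow_eq_self (𝓞 K ⧸ Q.asIdeal) (resChar Q), ← Units.val_pow_eq_pow_val,
      ← pow_sub_one_mul (prime_resChar Q).ne_zero, rootsResidue_pow, one_mul]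
  rw [← ZMod.fieldRange_castHom_eq_bot (resChar Q)] at hξ
  obtain ⟨y, hy⟩ := hξ
  have hy0 : y ≠ 0 := by
    rintro rfl
    exact (rootsResidue (resChar Q - 1) Q ξ).ne_zero (by rw [← hy, map_zero])
  exact ⟨Units.mk0 y hy0, Units.ext hy⟩

end Residue

section Reciprocity

variable {K : Type*} [Field K] [NumberField K] [IsGalois ℚ K] {n : ℕ} [NeZero n] {ζ : 𝓞 K}
  {Q : HeightOneSpectrum (𝓞 K)}

lemma dvd_resChar_sub_one (hζ : IsPrimitiveRoot ζ n) (hn : (n : 𝓞 K) ∉ Q.asIdeal)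
    (h : frob Q • ζ = ζ) : n ∣ resChar Q - 1 := by
  rw [← (isPrimitiveRoot_mk hζ hn).pow_eq_one_iff_dvd]
  have hmem := frob_smul_sub_mem Q ζ
  rw [h, ← Ideal.Quotient.eq, map_pow] at hmem
  refine mul_left_cancel₀ ((isPrimitiveRoot_mk hζ hn).ne_zero (NeZero.ne n)) ?_
  rw [mul_one, mul_pow_sub_one (prime_resChar Q).ne_zero, ← hmem]

omit [NeZero n] in
lemma frob_smul_eq_self (hζ : IsPrimitiveRoot ζ n) (hn : (n : 𝓞 K) ∉ Q.asIdeal)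
    (hdvd : n ∣ resChar Q - 1) : frob Q • ζ = ζ := by
  have h := (isArithFrobAt_frob Q).apply_of_pow_eq_one hζ.pow_eq_one hn
  rw [card_quotient_under, ← Nat.sub_add_cancel (prime_resChar Q).one_le, pow_succ,
    (hζ.pow_eq_one_iff_dvd _).mpr hdvd, one_mul] at h
  exact h

omit [IsGalois ℚ K] in
lemma exists_smul_eq_mul (hζ : IsPrimitiveRoot ζ n) {α : 𝓞 K} {m : ℤ} (hm : m ≠ 0)
    (hα : α ^ n = m) (σ : Gal(K/ℚ)) :
    ∃ ξ : rootsOfUnity n (𝓞 K), σ • α = ((ξ : (𝓞 K)ˣ) : 𝓞 K) * α := by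
  have hα0 : α ≠ 0 := by
    rintro rfl
    rw [zero_pow (NeZero.ne n)] at hα
    exact hm (by exact_mod_cast hα.symm)
  have hσ : σ • α ∈ Polynomial.nthRoots n (m : 𝓞 K) := by
    rw [Polynomial.mem_nthRoots (NeZero.pos n), ← smul_pow', hα]
    exact map_intCast (MulSemiringAction.toRingHom _ (𝓞 K) σ) m
  rw [hζ.nthRoots_eq hα] at hσ
  obtain ⟨i, -, hi⟩ := Multiset.mem_map.mp hσ
  exact ⟨hζ.toRootsOfUnity ^ i, hi.symm⟩

omit [IsGalois ℚ K] in
lemma pow_smul_eq_mul (hζ : IsPrimitiveRoot ζ n) {α : 𝓞 K} {σ : Gal(K/ℚ)} (hσ : σ • ζ = ζ)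
    {ξ : rootsOfUnity n (𝓞 K)} (hξ : σ • α = ((ξ : (𝓞 K)ˣ) : 𝓞 K) * α) (v : ℕ) :
    (σ ^ v) • α = (((ξ ^ v : rootsOfUnity n (𝓞 K)) : (𝓞 K)ˣ) : 𝓞 K) * α := by
  obtain ⟨i, hi⟩ := exists_coe_eq_pow hζ ξ
  induction v with
  | zero => simp
  | succ v ih =>
    have hfix : σ • (((ξ ^ v : rootsOfUnity n (𝓞 K)) : (𝓞 K)ˣ) : 𝓞 K) =
        (((ξ ^ v : rootsOfUnity n (𝓞 K)) : (𝓞 K)ˣ) : 𝓞 K) := by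
      simp [hi, smul_pow', hσ]
    rw [pow_succ', mul_smul, ih, smul_mul', hfix, hξ, ← mul_assoc, pow_succ]
    rfl

omit [NeZero n] in
lemma rootsResidue_eq_pow {α : 𝓞 K} (hα : α ∉ Q.asIdeal) {ξ : rootsOfUnity n (𝓞 K)}
    (hξ : frob Q • α = ((ξ : (𝓞 K)ˣ) : 𝓞 K) * α) :
    (rootsResidue n Q ξ : 𝓞 K ⧸ Q.asIdeal) =
      Ideal.Quotient.mk Q.asIdeal α ^ (resChar Q - 1) := by
  have hmem := frob_smul_sub_mem Q α
  rw [hξ, ← Ideal.Quotient.eq, map_mul, map_pow] at hmem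
  refine mul_right_cancel₀ (b := Ideal.Quotient.mk Q.asIdeal α) ?_ ?_
  · rwa [ne_eq, Ideal.Quotient.eq_zero_iff_mem]
  · rw [coe_rootsResidue, hmem, pow_sub_one_mul (prime_resChar Q).ne_zero]

/-- If the Frobenius elements at `Q` and `Q₀` generate the same subgroup, then a splitting at `Q₀`
transfers to `Q`. -/
lemma Splits.of_zpowers_frob_eq {M : Finset ℤ} {Q₀ : HeightOneSpectrum (𝓞 K)}
    (h : Splits M (resChar Q₀)) (hζ : IsPrimitiveRoot ζ (resChar Q₀ - 1))
    (hroot : ∀ m ∈ M, ∃ α : 𝓞 K, α ^ (resChar Q₀ - 1) = m)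
    (hQ : Subgroup.zpowers (frob Q) = Subgroup.zpowers (frob Q₀))
    (hn : ((resChar Q₀ - 1 : ℕ) : 𝓞 K) ∉ Q.asIdeal) (hM : ∀ m ∈ M, (m : 𝓞 K) ∉ Q.asIdeal) :
    Splits M (resChar Q) := by
  have hq := prime_resChar Q₀
  have : Fact (resChar Q).Prime := ⟨prime_resChar Q⟩
  have : Fact (resChar Q₀).Prime := ⟨hq⟩
  have hn0 : 0 < resChar Q₀ - 1 := Nat.sub_pos_of_lt hq.one_lt
  have : NeZero (resChar Q₀ - 1) := ⟨hn0.ne'⟩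
  have hn₀ : ((resChar Q₀ - 1 : ℕ) : 𝓞 K) ∉ Q₀.asIdeal := by
    rw [← Int.cast_natCast, intCast_mem_asIdeal_iff, Int.natCast_dvd_natCast]
    exact Nat.not_dvd_of_pos_of_lt hn0 (Nat.sub_lt hq.pos one_pos)
  have hσ := frob_smul_eq_self hζ hn₀ dvd_rfl
  obtain ⟨w, hw⟩ : ∃ w : ℕ, frob Q₀ ^ w = frob Q :=
    mem_powers_iff_mem_zpowers.mpr (hQ ▸ Subgroup.mem_zpowers (frob Q))
  obtain ⟨v, hv⟩ : ∃ v : ℕ, frob Q ^ v = frob Q₀ :=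
    mem_powers_iff_mem_zpowers.mpr (hQ ▸ Subgroup.mem_zpowers (frob Q₀))
  have hτ : frob Q • ζ = ζ := by
    have := pow_smul_eq_mul hζ hσ (α := ζ) (ξ := 1) (by simpa using hσ) w
    simpa [hw] using this
  have hdvd := dvd_resChar_sub_one hζ hn hτ
  obtain ⟨ρ, hρ⟩ := exists_powerResidue hζ hn hdvd
  obtain ⟨φ, hφ⟩ := exists_rootsOfUnity_hom (Q := Q₀)
  refine h.of_monoidHom (φ.comp ((powMonoidHom v).comp ρ)) fun m hm ↦ ?_
  have hm0 : (m : ZMod (resChar Q)) ≠ 0 := by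
    rw [ne_eq, ZMod.intCast_zmod_eq_zero_iff_dvd, ← intCast_mem_asIdeal_iff]
    exact hM m hm
  have hm1 : (m : 𝓞 K) ∉ Q₀.asIdeal := by
    rw [intCast_mem_asIdeal_iff, ← ZMod.intCast_zmod_eq_zero_iff_dvd]
    exact h.intCast_ne_zero hm
  obtain ⟨α, hα⟩ := hroot m hm
  have hα_notMem {I : Ideal (𝓞 K)} (hI : (m : 𝓞 K) ∉ I) : α ∉ I := fun hαI ↦
    hI (hα ▸ I.pow_mem_of_mem hαI _ hn0)
  obtain ⟨ξ, hξ⟩ := exists_smul_eq_mul hζ (by rintro rfl; simp at hm0) hα (frob Q)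
  have hρm : ρ (Units.mk0 _ hm0) = ξ := by
    refine rootsResidue_injective hζ hn (Units.ext ?_)
    rw [hρ, rootsResidue_eq_pow (hα_notMem (hM m hm)) hξ, Units.val_pow_eq_pow_val,
      coe_primeFieldUnits (Units.val_mk0 hm0), ← Nat.mul_div_cancel' hdvd, pow_mul, ← map_pow, hα,
      map_intCast, Nat.mul_div_cancel_left _ hn0]
  have hξv := pow_smul_eq_mul hζ hτ hξ v
  rw [hv] at hξv
  refine ⟨Units.mk0 _ hm0, rfl, ?_⟩
  have hm2 : (m : ZMod (resChar Q₀)) ≠ 0 := h.intCast_ne_zero hm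
  rw [← Units.val_mk0 hm2, Units.val_inj]
  refine primeFieldUnits_injective (Units.ext ?_)
  rw [coe_primeFieldUnits (Units.val_mk0 hm2), MonoidHom.comp_apply, MonoidHom.comp_apply,
    powMonoidHom_apply, hρm, hφ, rootsResidue_eq_pow (hα_notMem hm1) hξv, ← map_pow, hα,
    map_intCast]

end Reciprocity

end Splitting

/-- If a finite set `M` of nonzero integers splits `ℤ_q` for some prime `q`,
then there are infinitely many primes `p` such that `M` splits `ℤ_p`. -/
theorem infinitely_many_split_primes_of_splits_prime
    (M : Finset ℤ) (hM : ∀ m ∈ M, m ≠ 0)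
    (q : ℕ) (hq : q.Prime) (hsplit : Splits M q) :
    {p : ℕ | p.Prime ∧ Splits M p}.Infinite := by
  have : Fact q.Prime := ⟨hq⟩
  have : NeZero (q - 1) := ⟨(Nat.sub_pos_of_lt hq.one_lt).ne'⟩
  obtain ⟨K, _, _, _, ⟨ζ, hζ⟩, hroot⟩ := exists_isGalois_isPrimitiveRoot (q - 1) M
  obtain ⟨Q₀, rfl⟩ := exists_resChar_eq (K := K) q
  have hd : ((resChar Q₀ - 1 : ℕ) : ℤ) * ∏ m ∈ M, m ≠ 0 :=
    mul_ne_zero (Nat.cast_ne_zero.mpr (NeZero.ne _)) (Finset.prod_ne_zero_iff.mpr hM)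
  refine ((infinite_resChar_of_zpowers_frob_eq (frob Q₀)).sdiff
    (((resChar Q₀ - 1 : ℕ) : ℤ) * ∏ m ∈ M, m).natAbs.divisors.finite_toSet).mono ?_
  rintro _ ⟨⟨Q, rfl, hQ⟩, hdvd⟩
  have hmem {a : ℤ} (ha : a ∣ ((resChar Q₀ - 1 : ℕ) : ℤ) * ∏ m ∈ M, m) :
      (a : 𝓞 K) ∉ Q.asIdeal := fun haQ ↦
    hdvd (Nat.mem_divisors.mpr ⟨Int.natCast_dvd.mp ((intCast_mem_asIdeal_iff.mp haQ).trans ha),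
      Int.natAbs_ne_zero.mpr hd⟩)
  refine ⟨prime_resChar Q, hsplit.of_zpowers_frob_eq hζ hroot hQ ?_ fun m hm ↦
    hmem ((Finset.dvd_prod_of_mem _ hm).mul_left _)⟩
  exact_mod_cast hmem (dvd_mul_right _ _)
end

section
/- Let m be a positive integer and let N be a subset of the additive cyclic group Z_{2m} such that 0 ∈ N, m ∈ N, and |N| is odd. Then N is not a direct factor of Z_{2m}; that is, there is no subset A ⊆ Z_{2m} such that every element of Z_{2m} has a unique representation n + a with n ∈ N and a ∈ A. -/
/-- In a factorization of `G` with an odd factor `N`, doubling `N` still covers `G`: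
for fixed `g` the map sending `x` to the `N`-component of `g - x` is an involution of `N`,
so it has a fixed point. -/
theorem exists_add_self_add_eq_of_odd_card {G : Type*} [AddCommGroup G] (N : Finset G) (A : Set G)
    (hodd : Odd N.card)
    (hfac : ∀ g : G, ∃! na : G × G, na.1 ∈ N ∧ na.2 ∈ A ∧ na.1 + na.2 = g) (g : G) :
    ∃ n ∈ N, ∃ a ∈ A, n + n + a = g := by
  choose d hd huniq using hfac
  simp only at hd huniq
  let σ : N → N := fun x => ⟨(d (g - x)).1, (hd (g - x)).1⟩
  have hσ : Function.Involutive σ := by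
    intro x
    have hx := hd (g - x)
    have h := huniq (g - σ x) (x, (d (g - x)).2) ⟨x.2, hx.2.1,
      eq_sub_of_add_eq <| Eq.trans (by simp only [σ]; abel) (eq_sub_iff_add_eq.1 hx.2.2)⟩
    exact Subtype.ext (congrArg Prod.fst h).symm
  have hcard : ¬ 2 ∣ Fintype.card N := by
    rw [Fintype.card_coe]
    exact hodd.not_two_dvd_nat
  have : Fact (Nat.Prime 2) := ⟨Nat.prime_two⟩
  obtain ⟨x, hx⟩ := Equiv.Perm.exists_fixed_point_of_prime (p := 2) (n := 1) hcard
    (σ := hσ.toPerm) (by ext x; simp [pow_two, hσ x])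
  have hx' : (d (g - x)).1 = x := congrArg Subtype.val hx
  have hdx := hd (g - x)
  refine ⟨x, x.2, (d (g - x)).2, hdx.2.1, ?_⟩
  rw [add_assoc]
  nth_rw 2 [← hx']
  rw [hdx.2.2, add_sub_cancel]

/-- In a finite group, doubling is injective on a direct factor of odd cardinality. -/
theorem injOn_add_self_of_odd_card {G : Type*} [AddCommGroup G] [Finite G] (N : Finset G)
    (A : Set G) (hodd : Odd N.card)
    (hfac : ∀ g : G, ∃! na : G × G, na.1 ∈ N ∧ na.2 ∈ A ∧ na.1 + na.2 = g) :
    Set.InjOn (fun n => n + n) (N : Set G) := by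
  have hinj : Function.Injective fun p : N × A => (p.1 + p.2 : G) := fun p q h => by
    have := (hfac (p.1 + p.2)).unique (y₁ := (↑p.1, ↑p.2)) (y₂ := (↑q.1, ↑q.2))
      ⟨p.1.2, p.2.2, rfl⟩ ⟨q.1.2, q.2.2, h.symm⟩
    exact Prod.ext (Subtype.ext (congrArg Prod.fst this)) (Subtype.ext (congrArg Prod.snd this))
  have hsurj : Function.Surjective fun p : N × A => (p.1 + p.1 + p.2 : G) := fun g => by
    obtain ⟨n, hn, a, ha, h⟩ := exists_add_self_add_eq_of_odd_card N A hodd hfac g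
    exact ⟨(⟨n, hn⟩, ⟨a, ha⟩), h⟩
  have hbij := hsurj.bijective_of_nat_card_le (Nat.card_le_card_of_injective _ hinj)
  obtain ⟨na, ⟨-, ha, -⟩, -⟩ := hfac 0
  intro x hx y hy hxy
  have := hbij.injective (a₁ := (⟨x, hx⟩, ⟨na.2, ha⟩)) (a₂ := (⟨y, hy⟩, ⟨na.2, ha⟩))
    (congrArg (· + na.2) hxy)
  exact congrArg (fun p => (p.1 : G)) this

/-- If `N ⊆ ℤ_{2m}` contains `0` and `m` and `|N|` is odd, then `N` is not a
direct factor of `ℤ_{2m}`. -/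
theorem not_direct_factor_of_odd_card (m : ℕ) (hm : 0 < m)
    (N : Finset (ZMod (2 * m)))
    (h0 : (0 : ZMod (2 * m)) ∈ N) (hmem : ((m : ℕ) : ZMod (2 * m)) ∈ N)
    (hodd : Odd N.card) :
    ¬ ∃ A : Set (ZMod (2 * m)), ∀ g : ZMod (2 * m),
      ∃! na : ZMod (2 * m) × ZMod (2 * m),
        na.1 ∈ N ∧ na.2 ∈ A ∧ na.1 + na.2 = g := by
  rintro ⟨A, hA⟩
  have : NeZero (2 * m) := ⟨by omega⟩
  have hm0 : ((m : ℕ) : ZMod (2 * m)) = 0 :=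
    injOn_add_self_of_odd_card N A hodd hA hmem h0 <| by
      simpa [two_mul] using ZMod.natCast_self (2 * m)
  have := Nat.le_of_dvd hm ((ZMod.natCast_eq_zero_iff _ _).1 hm0)
  omega
end

section
/- Let M be a finite set of nonzero integers such that -1 ∈ M, 1 ∈ M, and |M| is odd. Then M does not split Z_p for any prime p. -/
/-- If every nonzero `g` is uniquely of the form `m * s` with `m ∈ M` and `s ∈ S`, and `|M|` is odd,
then every nonzero `g` is of the form `m * (m * s)`: the solutions of `m₁ * (m₂ * s) = g` are
`|M|` in number, so the involution exchanging `m₁` and `m₂` has a fixed one. -/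
theorem exists_mul_mul_eq_of_odd_card {K : Type*} [Field K] [DecidableEq K]
    (M : Finset ℤ) (S : Finset K) (hodd : Odd M.card)
    (h : ∀ g : K, g ≠ 0 → ∃! ms : ℤ × K, ms.1 ∈ M ∧ ms.2 ∈ S ∧ (ms.1 : K) * ms.2 = g)
    (hM : ∀ m ∈ M, (m : K) ≠ 0) {g : K} (hg : g ≠ 0) :
    ∃ m ∈ M, ∃ s ∈ S, (m : K) * (m * s) = g := by
  by_contra! hno
  set U : Finset (ℤ × ℤ × K) :=
    {x ∈ M ×ˢ M ×ˢ S | (x.1 : K) * (x.2.1 * x.2.2) = g} with hU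
  have mem_U (a b : ℤ) (s : K) :
      (a, b, s) ∈ U ↔ (a ∈ M ∧ b ∈ M ∧ s ∈ S) ∧ (a : K) * (b * s) = g := by
    simp [hU]
  have hcard : U.card = M.card := by
    refine Finset.card_nbij Prod.fst ?_ ?_ ?_
    · rintro ⟨a, b, s⟩ hx
      exact ((mem_U _ _ _).1 hx).1.1
    · rintro ⟨a, b, s⟩ hx ⟨a', b', s'⟩ hy (rfl : a = a')
      obtain ⟨⟨ha, hb, hs⟩, he⟩ := (mem_U _ _ _).1 hx
      obtain ⟨⟨-, hb', hs'⟩, he'⟩ := (mem_U _ _ _).1 hy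
      have heq : (b : K) * s = b' * s' := mul_left_cancel₀ (hM a ha) (he.trans he'.symm)
      have hne : (b' : K) * s' ≠ 0 := right_ne_zero_of_mul (he' ▸ hg)
      rw [(h _ hne).unique (y₁ := (b, s)) (y₂ := (b', s')) ⟨hb, hs, heq⟩ ⟨hb', hs', rfl⟩]
    · intro a ha
      obtain ⟨⟨b, s⟩, ⟨hb, hs, he⟩, -⟩ := h ((a : K)⁻¹ * g) (mul_ne_zero (inv_ne_zero (hM a ha)) hg)
      refine ⟨(a, b, s), (mem_U _ _ _).2 ⟨⟨ha, hb, hs⟩, ?_⟩, rfl⟩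
      dsimp only at he
      rw [he, mul_inv_cancel_left₀ (hM a ha)]
  have hsum : ∑ _x ∈ U, (1 : ZMod 2) = 0 := by
    refine Finset.sum_involution (fun x _ => (x.2.1, x.1, x.2.2)) ?_ ?_ ?_ ?_
    · intros
      decide
    · rintro ⟨a, b, s⟩ hx - heq
      obtain ⟨⟨ha, hb, hs⟩, he⟩ := (mem_U _ _ _).1 hx
      simp only [Prod.mk.injEq] at heq
      obtain ⟨rfl, -⟩ := heq
      exact hno _ ha s hs he
    · rintro ⟨a, b, s⟩ hx
      obtain ⟨⟨ha, hb, hs⟩, he⟩ := (mem_U _ _ _).1 hx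
      exact (mem_U _ _ _).2 ⟨⟨hb, ha, hs⟩, by rw [← he, mul_left_comm]⟩
    · intros
      rfl
  rw [Finset.sum_const, nsmul_one, ZMod.natCast_eq_zero_iff_even, hcard] at hsum
  exact Nat.not_even_iff_odd.2 hodd hsum

/-- A finite set `M` of nonzero integers with `±1 ∈ M` and `|M|` odd does not
split `ℤ_p` for any prime `p`. -/
theorem not_splits_of_odd_card (M : Finset ℤ) (hM : ∀ m ∈ M, m ≠ 0)
    (hneg : (-1 : ℤ) ∈ M) (hpos : (1 : ℤ) ∈ M) (hodd : Odd M.card) :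
    ∀ p : ℕ, p.Prime → ¬ Splits M p := by
  rintro p hp ⟨S', h, h0⟩
  have : Fact p.Prime := ⟨hp⟩
  push Not at h0
  obtain ⟨S, rfl⟩ : ∃ S : Finset (ZMod p), (S : Set (ZMod p)) = S' := S'.toFinite.exists_finset_coe
  simp only [Finset.mem_coe] at h h0
  obtain ⟨⟨_, s₀⟩, ⟨-, hs₀, -⟩, -⟩ := h 1 one_ne_zero
  have hMp : ∀ m ∈ M, (m : ZMod p) ≠ 0 := fun m hm => left_ne_zero_of_mul (h0 m hm s₀ hs₀)
  have hcard : (M ×ˢ S).card ≤ (Finset.univ.erase (0 : ZMod p)).card := by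
    refine Finset.card_le_card_of_injOn (fun x => (x.1 : ZMod p) * x.2) ?_ ?_
    · rintro ⟨m, s⟩ hx
      obtain ⟨hm, hs⟩ := Finset.mem_product.1 hx
      simpa using h0 m hm s hs
    · rintro ⟨m, s⟩ hx ⟨m', s'⟩ hy heq
      obtain ⟨hm, hs⟩ := Finset.mem_product.1 hx
      obtain ⟨hm', hs'⟩ := Finset.mem_product.1 hy
      exact (h _ (h0 m' hm' s' hs')).unique ⟨hm, hs, heq⟩ ⟨hm', hs', rfl⟩
  have hinj : Set.InjOn (fun x : ℤ × ZMod p => (x.1 : ZMod p) * (x.1 * x.2)) ↑(M ×ˢ S) := by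
    refine Finset.injOn_of_surjOn_of_card_le _ (t := Finset.univ.erase 0) ?_ ?_ hcard
    · rintro ⟨m, s⟩ hx
      obtain ⟨hm, hs⟩ := Finset.mem_product.1 hx
      simpa using ⟨hMp m hm, right_ne_zero_of_mul (h0 m hm s hs)⟩
    · intro g hg
      obtain ⟨m, hm, s, hs, he⟩ :=
        exists_mul_mul_eq_of_odd_card M S hodd h hMp (Finset.ne_of_mem_erase hg)
      exact ⟨(m, s), Finset.mem_product.2 ⟨hm, hs⟩, he⟩
  have := hinj (Finset.mem_product.2 ⟨hneg, hs₀⟩ : ((-1 : ℤ), s₀) ∈ M ×ˢ S)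
    (Finset.mem_product.2 ⟨hpos, hs₀⟩ : ((1 : ℤ), s₀) ∈ M ×ˢ S) (by simp)
  simp at this
end

section
/- Let G be a finite abelian group written multiplicatively, and suppose G = A·B is a factorization of G. Let k be an integer relatively prime to |A|. Then G = A^k·B is a factorization of G, where A^k = {a^k : a ∈ A}; more precisely, the map (a,b) ↦ a^k·b from A × B to G is a bijection. -/
theorem MonoidAlgebra.single_mul_sum_univ {R G : Type*} [Semiring R] [Group G] [Fintype G]
    (x : G) :
    MonoidAlgebra.single x (1 : R) * ∑ g : G, MonoidAlgebra.single g (1 : R) =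
      ∑ g : G, MonoidAlgebra.single g (1 : R) := by
  simp only [Finset.mul_sum, MonoidAlgebra.single_mul_single, mul_one]
  exact Fintype.sum_equiv (Equiv.mulLeft x) _ _ fun _ => rfl

theorem surjective_prime_pow_mul {G ι κ : Type*} [CommGroup G] [Fintype G] [Fintype ι]
    [Fintype κ] {f : ι → G} {h : κ → G}
    (hfh : Function.Bijective fun x : ι × κ => f x.1 * h x.2)
    {p : ℕ} (hp : p.Prime) (hcop : p.Coprime (Fintype.card ι)) :
    Function.Surjective fun x : ι × κ => f x.1 ^ p * h x.2 := by
  classical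
  have : Fact p.Prime := ⟨hp⟩
  have : CharP (MonoidAlgebra (ZMod p) G) p :=
    charP_of_injective_algebraMap (algebraMap (ZMod p) (MonoidAlgebra (ZMod p) G)).injective p
  let a : MonoidAlgebra (ZMod p) G := ∑ i, MonoidAlgebra.single (f i) 1
  let b : MonoidAlgebra (ZMod p) G := ∑ j, MonoidAlgebra.single (h j) 1
  let N : MonoidAlgebra (ZMod p) G := ∑ g, MonoidAlgebra.single g 1
  have hab : a * b = N := by
    simp only [a, b, N, Finset.sum_mul_sum, MonoidAlgebra.single_mul_single, mul_one]
    rw [← Fintype.sum_prod_type']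
    exact Fintype.sum_bijective _ hfh _ _ fun _ => rfl
  have haN : a * N = (Fintype.card ι : ZMod p) • N := by
    simp only [a, N, Finset.sum_mul, MonoidAlgebra.single_mul_sum_univ]
    simp [Nat.cast_smul_eq_nsmul]
  have hpowN (n : ℕ) : a ^ n * N = (Fintype.card ι : ZMod p) ^ n • N := by
    induction n with
    | zero => simp
    | succ n ih => rw [pow_succ, mul_assoc, haN, mul_smul_comm, ih, smul_smul, pow_succ']
  have hpow : a ^ p = ∑ i, MonoidAlgebra.single (f i ^ p) 1 := by
    simp only [a, sum_pow_char, MonoidAlgebra.single_pow, one_pow]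
  have key : ∑ x : ι × κ, MonoidAlgebra.single (f x.1 ^ p * h x.2) (1 : ZMod p) =
      (Fintype.card ι : ZMod p) ^ (p - 1) • N := by
    rw [← hpowN, ← hab, ← mul_assoc, ← pow_succ, Nat.sub_add_cancel hp.one_le, hpow]
    simp only [b, Finset.sum_mul_sum, MonoidAlgebra.single_mul_single, mul_one]
    rw [Fintype.sum_prod_type]
  have hcard : (Fintype.card ι : ZMod p) ≠ 0 := by
    rw [Ne, ZMod.natCast_eq_zero_iff]
    exact (hp.coprime_iff_not_dvd).1 hcop
  intro g
  by_contra! hg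
  have hcoeff := congrArg (fun y : MonoidAlgebra (ZMod p) G => y.coeff g) key
  simp [N, MonoidAlgebra.coeff_sum, Finsupp.finsetSum_apply, Finsupp.single_apply, hg] at hcoeff
  exact pow_ne_zero _ hcard hcoeff.symm

theorem bijective_pow_mul {G ι κ : Type*} [CommGroup G] [Fintype G] [Fintype ι]
    [Fintype κ] {f : ι → G} {h : κ → G}
    (hfh : Function.Bijective fun x : ι × κ => f x.1 * h x.2)
    {n : ℕ} (hcop : n.Coprime (Fintype.card ι)) :
    Function.Bijective fun x : ι × κ => f x.1 ^ n * h x.2 := by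
  have hcard : Fintype.card (ι × κ) = Fintype.card G := Fintype.card_of_bijective hfh
  induction n using Nat.recOnMul generalizing f with
  | zero =>
    have : Subsingleton ι :=
      Fintype.card_le_one_iff_subsingleton.1 (by simpa using hcop.le)
    refine (Fintype.bijective_iff_injective_and_card _).2 ⟨?_, hcard⟩
    rintro ⟨i, j⟩ ⟨i', j'⟩ hij
    obtain rfl := Subsingleton.elim i i'
    exact hfh.injective (by simpa using hij)
  | one => simpa using hfh
  | prime p hp =>
    exact (Fintype.bijective_iff_surjective_and_card _).2
      ⟨surjective_prime_pow_mul hfh hp hcop, hcard⟩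
  | mul m n hm hn =>
    simp only [pow_mul]
    exact hn (f := fun i => f i ^ m) (hm hfh hcop.coprime_mul_right) hcop.coprime_mul_left

theorem bijective_inv_mul {G ι κ : Type*} [CommGroup G] [Fintype G] [Fintype ι]
    [Fintype κ] {f : ι → G} {h : κ → G}
    (hfh : Function.Bijective fun x : ι × κ => f x.1 * h x.2) :
    Function.Bijective fun x : ι × κ => (f x.1)⁻¹ * h x.2 := by
  refine (Fintype.bijective_iff_injective_and_card _).2 ⟨?_, Fintype.card_of_bijective hfh⟩
  rintro ⟨i, j⟩ ⟨i', j'⟩ hij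
  have hswap : f i' * h j = f i * h j' := by
    rwa [inv_mul_eq_iff_eq_mul, mul_left_comm, eq_inv_mul_iff_mul_eq] at hij
  have heq := hfh.injective (a₁ := (i', j)) (a₂ := (i, j')) hswap
  simp only [Prod.mk.injEq] at heq ⊢
  exact ⟨heq.1.symm, heq.2⟩

theorem bijective_zpow_mul {G ι κ : Type*} [CommGroup G] [Fintype G] [Fintype ι]
    [Fintype κ] {f : ι → G} {h : κ → G}
    (hfh : Function.Bijective fun x : ι × κ => f x.1 * h x.2)
    {k : ℤ} (hcop : IsCoprime k (Fintype.card ι : ℤ)) :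
    Function.Bijective fun x : ι × κ => f x.1 ^ k * h x.2 := by
  obtain ⟨n, rfl | rfl⟩ := k.eq_nat_or_neg
  · simpa using bijective_pow_mul hfh (Nat.isCoprime_iff_coprime.1 hcop)
  · simpa using bijective_inv_mul (f := fun i => f i ^ n)
      (bijective_pow_mul hfh (Nat.isCoprime_iff_coprime.1 ((IsCoprime.neg_left_iff _ _).1 hcop)))

/-- If `G = A·B` is a factorization of a finite abelian group `G` and `k` is an
integer coprime to `|A|`, then `G = A^k·B` is a factorization; more precisely,
`(a, b) ↦ a^k * b` is a bijection from `A × B` to `G`. -/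
theorem factorization_pow_coprime {G : Type*} [CommGroup G] [Finite G]
    (A B : Set G)
    (hfac : ∀ g : G, ∃! ab : G × G, ab.1 ∈ A ∧ ab.2 ∈ B ∧ ab.1 * ab.2 = g)
    (k : ℤ) (hk : IsCoprime k (Nat.card A : ℤ)) :
    Function.Bijective (fun ab : A × B => ((ab.1 : G) ^ k) * (ab.2 : G)) ∧
    ∀ g : G, ∃! ab : G × G,
      ab.1 ∈ {x : G | ∃ a ∈ A, x = a ^ k} ∧ ab.2 ∈ B ∧ ab.1 * ab.2 = g := by
  classical
  have := Fintype.ofFinite G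
  have := Fintype.ofFinite A
  have := Fintype.ofFinite B
  have hAB : Function.Bijective fun x : A × B => (x.1 : G) * (x.2 : G) := by
    constructor
    · rintro ⟨⟨a, ha⟩, ⟨b, hb⟩⟩ ⟨⟨a', ha'⟩, ⟨b', hb'⟩⟩ hab
      have := (hfac (a' * b')).unique (y₁ := (a, b)) (y₂ := (a', b')) ⟨ha, hb, hab⟩
        ⟨ha', hb', rfl⟩
      simp_all
    · intro g
      obtain ⟨⟨a, b⟩, ⟨ha, hb, hab⟩, -⟩ := hfac g
      exact ⟨(⟨a, ha⟩, ⟨b, hb⟩), hab⟩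
  rw [Nat.card_eq_fintype_card] at hk
  have hbij := bijective_zpow_mul hAB hk
  refine ⟨hbij, fun g => ?_⟩
  obtain ⟨⟨a, b⟩, hab⟩ := hbij.surjective g
  refine ⟨((a : G) ^ k, b), ⟨⟨a, a.2, rfl⟩, b.2, hab⟩, ?_⟩
  rintro ⟨_, b'⟩ ⟨⟨a', ha', rfl⟩, hb', hab'⟩
  have heq := hbij.injective (a₁ := (⟨a', ha'⟩, ⟨b', hb'⟩)) (a₂ := (a, b)) (hab'.trans hab.symm)
  obtain ⟨rfl, rfl⟩ := Prod.mk.inj heq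
  rfl
end

section
/- Let k₁ and k₂ be positive integers with 1 ≤ k₁ ≤ k₂, and let p be an odd prime with p ≡ 1 (mod k₁+k₂). Let M ⊆ Z_p^* be the image of [-k₁,k₂]* modulo p, and let H = ⟨-1, 2, 3, ..., k₂⟩ be the subgroup of the multiplicative group Z_p^* generated by the residues of -1, 2, 3, ..., k₂. Then M is a direct factor of Z_p^* if and only if M is a direct factor of H (i.e., there exists B ⊆ H such that every element of H is uniquely a product m·b with m ∈ M, b ∈ B). -/
/-- The subset of `ℤ_p` underlying the subgroup of `(ℤ_p)ˣ` generated by the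
units whose values lie in `S`. -/
def genSet (p : ℕ) (S : Set (ZMod p)) : Set (ZMod p) :=
  (fun u : (ZMod p)ˣ => (u : ZMod p)) ''
    ((Subgroup.closure ((fun u : (ZMod p)ˣ => (u : ZMod p)) ⁻¹' S) :
      Subgroup (ZMod p)ˣ) : Set (ZMod p)ˣ)

/-- Every element of `T` has a unique representation `a * b` with `a ∈ A`, `b ∈ B`. -/
def IsFacOn (p : ℕ) (T A B : Set (ZMod p)) : Prop :=
  ∀ g ∈ T, ∃! ab : ZMod p × ZMod p, ab.1 ∈ A ∧ ab.2 ∈ B ∧ ab.1 * ab.2 = g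

/-- A subset of a subgroup `H` of `(ℤ_p)ˣ` is a direct factor of the nonzero residues iff it is a
direct factor of `H`. -/
theorem exists_isFacOn_ne_zero_iff_exists_isFacOn_subgroup (p : ℕ) [Fact p.Prime]
    (H : Subgroup (ZMod p)ˣ) (M : Set (ZMod p))
    (hM : M ⊆ (fun u : (ZMod p)ˣ => (u : ZMod p)) '' (H : Set (ZMod p)ˣ)) :
    (∃ B : Set (ZMod p), B ⊆ {x : ZMod p | x ≠ 0} ∧ IsFacOn p {x : ZMod p | x ≠ 0} M B) ↔
    (∃ B : Set (ZMod p), B ⊆ (fun u : (ZMod p)ˣ => (u : ZMod p)) '' (H : Set (ZMod p)ˣ) ∧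
      IsFacOn p ((fun u : (ZMod p)ˣ => (u : ZMod p)) '' (H : Set (ZMod p)ˣ)) M B) := by
  constructor
  · rintro ⟨B, hB, hfac⟩
    refine ⟨B ∩ (fun u : (ZMod p)ˣ => (u : ZMod p)) '' (H : Set (ZMod p)ˣ),
      Set.inter_subset_right, ?_⟩
    rintro _ ⟨g, hg, rfl⟩
    obtain ⟨⟨m, b⟩, ⟨hm, hb, hmb⟩, huniq⟩ := hfac (g : ZMod p) g.ne_zero
    refine ⟨(m, b), ⟨hm, ⟨hb, ?_⟩, hmb⟩, fun y hy => huniq y ⟨hy.1, hy.2.1.1, hy.2.2⟩⟩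
    obtain ⟨u, hu, rfl⟩ := hM hm
    refine ⟨u⁻¹ * g, H.mul_mem (H.inv_mem hu) hg, ?_⟩
    simp only [Units.val_mul] at hmb ⊢
    rw [← hmb, Units.inv_mul_cancel_left]
  · rintro ⟨B, hB, hfac⟩
    let rep : (ZMod p)ˣ → (ZMod p)ˣ := fun u => (u : (ZMod p)ˣ ⧸ H).out
    have rep_mem (u : (ZMod p)ˣ) : u * (rep u)⁻¹ ∈ H := by
      obtain ⟨h, hh⟩ := QuotientGroup.mk_out_eq_mul H u
      have : u * (rep u)⁻¹ = (h : (ZMod p)ˣ)⁻¹ := by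
        simp only [rep, hh, mul_inv, mul_inv_cancel_left]
      rw [this]
      exact H.inv_mem h.2
    have rep_congr (u v : (ZMod p)ˣ) (h : u⁻¹ * v ∈ H) : rep u = rep v :=
      congrArg Quotient.out (QuotientGroup.eq.2 h)
    refine ⟨(fun u : (ZMod p)ˣ => (u : ZMod p)) '' {u | ((u * (rep u)⁻¹ : (ZMod p)ˣ) : ZMod p) ∈ B},
      ?_, ?_⟩
    · rintro _ ⟨u, -, rfl⟩
      exact u.ne_zero
    intro g hg
    lift g to (ZMod p)ˣ using IsUnit.mk0 g hg
    obtain ⟨⟨m, b⟩, ⟨hm, hb, hmb⟩, huniq⟩ := hfac _ ⟨_, rep_mem g, rfl⟩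
    obtain ⟨b, hbH, rfl⟩ := hB hb
    have hrep : rep (b * rep g) = rep g := by
      have hout : rep (rep g) = rep g := by simp [rep]
      rw [← rep_congr (rep g) (b * rep g) (by simpa [mul_comm b] using hbH), hout]
    refine ⟨(m, ((b * rep g : (ZMod p)ˣ) : ZMod p)), ⟨hm, ⟨b * rep g, ?_, rfl⟩, ?_⟩, ?_⟩
    · rwa [Set.mem_ofPred_eq, hrep, mul_inv_cancel_right]
    · simp only [Units.val_mul] at hmb ⊢
      rw [← mul_assoc, hmb, Units.inv_mul_cancel_right]
    · rintro ⟨m', _⟩ ⟨hm', ⟨x, hx, rfl⟩, hmx⟩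
      obtain ⟨m', hmH, rfl⟩ := hM hm'
      have hg' : m' * x = g := Units.ext hmx
      have hxg : rep x = rep g := rep_congr x g (by
        rw [← hg', mul_comm m', inv_mul_cancel_left]
        exact hmH)
      have key := huniq ((m' : ZMod p), ((x * (rep x)⁻¹ : (ZMod p)ˣ) : ZMod p))
        ⟨hm', hx, by simp only [← Units.val_mul, ← mul_assoc, hg', hxg]⟩
      rw [Prod.mk.injEq] at key ⊢
      refine ⟨key.1, congrArg Units.val ?_⟩
      rw [← Units.ext key.2, hxg, inv_mul_cancel_right]

/-- For `1 ≤ k₁ ≤ k₂` and an odd prime `p ≡ 1 (mod k₁ + k₂)`, the image `M` of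
`[-k₁,k₂]*` in `ℤ_p` is a direct factor of `ℤ_p^*` iff `M` is a direct factor
of the subgroup `H = ⟨-1, 2, …, k₂⟩` of `ℤ_p^*`. -/
theorem direct_factor_iff_direct_factor_subgroup
    (k₁ k₂ : ℕ) (h1 : 1 ≤ k₁) (h12 : k₁ ≤ k₂)
    (p : ℕ) (hp : p.Prime) (hodd : Odd p) (hmod : p % (k₁ + k₂) = 1) :
    (∃ B : Set (ZMod p), B ⊆ {x : ZMod p | x ≠ 0} ∧
      IsFacOn p {x : ZMod p | x ≠ 0}
        ((fun m : ℤ => (m : ZMod p)) '' (Set.Icc (-(k₁ : ℤ)) (k₂ : ℤ) \ {0})) B) ↔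
    (∃ B : Set (ZMod p),
      B ⊆ genSet p (insert (-1 : ZMod p) ((fun n : ℕ => (n : ZMod p)) '' Set.Icc 2 k₂)) ∧
      IsFacOn p (genSet p (insert (-1 : ZMod p) ((fun n : ℕ => (n : ZMod p)) '' Set.Icc 2 k₂)))
        ((fun m : ℤ => (m : ZMod p)) '' (Set.Icc (-(k₁ : ℤ)) (k₂ : ℤ) \ {0})) B) := by
  have : Fact p.Prime := ⟨hp⟩
  have hlt : k₁ + k₂ < p := by
    by_contra! h
    rcases h.lt_or_eq with h | h
    · rw [Nat.mod_eq_of_lt h] at hmod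
      exact hp.one_lt.ne' hmod
    · simp [h] at hmod
  refine exists_isFacOn_ne_zero_iff_exists_isFacOn_subgroup p _ _ ?_
  set S : Set (ZMod p) := insert (-1 : ZMod p) ((fun n : ℕ => (n : ZMod p)) '' Set.Icc 2 k₂)
  have hpos (n : ℕ) (hn1 : 1 ≤ n) (hn : n ≤ k₂) : ∃ u ∈ Subgroup.closure
      ((fun u : (ZMod p)ˣ => (u : ZMod p)) ⁻¹' S), (u : ZMod p) = n := by
    rcases hn1.eq_or_lt with rfl | hn2
    · exact ⟨1, one_mem _, by simp⟩
    have hne : (n : ZMod p) ≠ 0 := by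
      rw [Ne, ZMod.natCast_eq_zero_iff]
      exact fun h => absurd (Nat.le_of_dvd hn1 h) (by omega)
    refine ⟨Units.mk0 _ hne, Subgroup.subset_closure ?_, rfl⟩
    exact Or.inr ⟨n, ⟨hn2, hn⟩, rfl⟩
  rintro _ ⟨m, ⟨⟨hm1, hm2⟩, hm0⟩, rfl⟩
  have hm0' : m ≠ 0 := hm0
  obtain ⟨u, hu, hun⟩ := hpos m.natAbs (by omega) (by omega)
  rcases Int.natAbs_eq m with h | h
  · refine ⟨u, hu, ?_⟩
    rw [h]
    simpa using hun
  · refine ⟨-1 * u, Subgroup.mul_mem _ (Subgroup.subset_closure (Or.inl (by simp))) hu, ?_⟩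
    rw [h]
    simpa using hun
end
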